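/- arXiv:math/0609702 — 5 statements merged into one kernel-verified Lean document; each statement's English description precedes it below -/
import Mathlib

section
/- There exists a finite ordered set R with the following properties: R has exactly two maximal elements d and p; d and p have the same rank; R has exactly two minimal elements d̄ and p̄; the card R∖{p̄} has an automorphism ψ with ψ(d)=p, ψ(p)=d and ψ(d̄)=d̄; the card R∖{d̄} has an automorphism ψ' with ψ'(d)=p, ψ'(p)=d and ψ'(p̄)=p̄; R has an automorphism φ with φ(d)=p, φ(p)=d, φ(d̄)=p̄ and φ(p̄)=d̄; and R has no automorphism that is the identity on the minimal elements of R and not the identity on the maximal elements of R. -/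
/-- A finite ordered set: a type equipped with a partial order and a `Fintype` structure. -/
structure FinPoset where
  carrier : Type
  [po : PartialOrder carrier]
  [ft : Fintype carrier]

instance : CoeSort FinPoset Type := ⟨FinPoset.carrier⟩
attribute [instance] FinPoset.po FinPoset.ft

/-- The card of an ordered set obtained by deleting the point `x`,
as an induced subposet. -/
abbrev Card (P : Type*) [PartialOrder P] (x : P) : Type _ := {y : P // y ≠ x}

/-- The points of an ordered set on whose middle levels the dihedral group of `ZMod 3` acts:
the two top points are exchanged by exactly the reflections. -/
inductive Middle
  | bot (b : Bool)
  | x (i : ZMod 3)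
  | y (i : ZMod 3)
  | z (i : ZMod 3) (s : Bool)
  | top (s : Bool)
  deriving DecidableEq

namespace Middle

/-- `Middle` as a disjoint union. -/
def equivSum :
    Middle ≃ Bool ⊕ ZMod 3 ⊕ ZMod 3 ⊕ (ZMod 3 × Bool) ⊕ Bool where
  toFun
    | bot b => .inl b
    | x i => .inr (.inl i)
    | y i => .inr (.inr (.inl i))
    | z i s => .inr (.inr (.inr (.inl (i, s))))
    | top s => .inr (.inr (.inr (.inr s)))
  invFun
    | .inl b => bot b
    | .inr (.inl i) => x i
    | .inr (.inr (.inl i)) => y i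
    | .inr (.inr (.inr (.inl (i, s)))) => z i s
    | .inr (.inr (.inr (.inr s))) => top s
  left_inv a := by cases a <;> rfl
  right_inv a := by rcases a with _ | _ | _ | ⟨_, _⟩ | _ <;> rfl

instance : Fintype Middle := Fintype.ofEquiv _ equivSum.symm

/-- The neighbour of `i` in the direction `s` on the cycle `ZMod 3`. -/
def step (i : ZMod 3) (s : Bool) : ZMod 3 := if s then i + 1 else i - 1

/-- The index of the only middle point that is not above `bot b`. -/
def omitted (b : Bool) : ZMod 3 := if b then 0 else 2

/-- The order relation, as a Boolean function. -/
def le : Middle → Middle → Bool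
  | bot b, bot c => b == c
  | bot b, x i => i != omitted b
  | bot _, _ => true
  | x i, x j => i == j
  | x i, y j => i == j
  | x i, z j s => i == j || i == step j s
  | x _, top _ => true
  | y i, y j => i == j
  | y i, z j s => i == step j s
  | y _, top _ => true
  | z i s, z j t => i == j && s == t
  | z _ s, top t => s == t
  | top s, top t => s == t
  | _, _ => false

instance : PartialOrder Middle where
  le a b := le a b
  le_refl := by decide +kernel
  le_trans := by decide +kernel
  le_antisymm := by decide +kernel

instance : DecidableRel (α := Middle) (· ≤ ·) :=
  fun a b => inferInstanceAs (Decidable (le a b = true))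

/-- Reflection `i ↦ c - i` of the cyclic indices, reversing directions and exchanging the two
top points; the two bottom points are exchanged iff `e` is true. -/
def reflect (c : ZMod 3) (e : Bool) : Middle → Middle
  | bot b => bot (b ^^ e)
  | x i => x (c - i)
  | y i => y (c - i)
  | z i s => z (c - i) (!s)
  | top s => top (!s)

lemma reflect_involutive (c : ZMod 3) (e : Bool) : Function.Involutive (reflect c e) := by
  rintro (_ | _ | _ | _ | _) <;> simp [reflect]

/-- The reflection fixing the middle point omitted by `bot b`, as an automorphism of the card
obtained by deleting the other bottom point. -/
def cardReflect (b : Bool) : Card Middle (bot (!b)) ≃o Card Middle (bot (!b)) where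
  toEquiv := (reflect_involutive (-omitted b) false).toPerm.subtypeEquiv <| by
    revert b; decide +kernel
  map_rel_iff' := by
    rintro ⟨u, hu⟩ ⟨v, hv⟩
    change reflect (-omitted b) false u ≤ reflect (-omitted b) false v ↔ u ≤ v
    revert b u v; decide +kernel

/-- The reflection exchanging the two bottom points. -/
def swap : Middle ≃o Middle where
  toEquiv := (reflect_involutive 2 true).toPerm
  map_rel_iff' := by
    intro u v
    change reflect 2 true u ≤ reflect 2 true v ↔ u ≤ v
    revert u v; decide +kernel

lemma isMax_iff (u : Middle) : IsMax u ↔ u = top true ∨ u = top false := by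
  unfold IsMax; revert u; decide +kernel

lemma isMin_iff (u : Middle) : IsMin u ↔ u = bot true ∨ u = bot false := by
  unfold IsMin; revert u; decide +kernel

/-- The number of points below `u`. -/
def lowerCard (u : Middle) : ℕ := (Finset.univ.filter (· ≤ u)).card

lemma lowerCard_map (f : Middle ≃o Middle) (u : Middle) : lowerCard (f u) = lowerCard u := by
  refine (Finset.card_equiv f.toEquiv fun v => ?_).symm
  simp

/-- An automorphism fixing both bottom points fixes the two top points. -/
lemma map_top_of_map_bot (f : Middle ≃o Middle) (hf : ∀ b, f (bot b) = bot b) (s : Bool) :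
    f (top s) = top s := by
  have le_iff {u v : Middle} (hu : f u = u) : u ≤ f v ↔ u ≤ v := by
    conv_lhs => rw [← hu]
    exact f.le_iff_le
  have hx (i : ZMod 3) : f (x i) = x i := by
    have key : ∀ i v, lowerCard v = lowerCard (x i) →
        (∀ b, bot b ≤ v ↔ bot b ≤ x i) → v = x i := by decide +kernel
    exact key i _ (lowerCard_map f _) fun b => le_iff (hf b)
  have hy (i : ZMod 3) : f (y i) = y i := by
    have key : ∀ i v, lowerCard v = lowerCard (y i) →
        (∀ j, x j ≤ v ↔ x j ≤ y i) → v = y i := by decide +kernel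
    exact key i _ (lowerCard_map f _) fun j => le_iff (hx j)
  have hz (i : ZMod 3) (t : Bool) : f (z i t) = z i t := by
    have key : ∀ i t v, lowerCard v = lowerCard (z i t) → (∀ j, x j ≤ v ↔ x j ≤ z i t) →
        (∀ j, y j ≤ v ↔ y j ≤ z i t) → v = z i t := by decide +kernel
    exact key i t _ (lowerCard_map f _) (fun j => le_iff (hx j)) fun j => le_iff (hy j)
  have key : ∀ s v, lowerCard v = lowerCard (top s) →
      (∀ i t, z i t ≤ v ↔ z i t ≤ top s) → v = top s := by decide +kernel
  exact key s _ (lowerCard_map f _) fun i t => le_iff (hz i t)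

end Middle

/--
There exists a finite ordered set `R` with exactly two maximal elements `d` and `p` of the
same rank, exactly two minimal elements `d̄` and `p̄`, such that the card `R∖{p̄}` has an
automorphism swapping `d` and `p` and fixing `d̄`, the card `R∖{d̄}` has an automorphism
swapping `d` and `p` and fixing `p̄`, `R` has an automorphism `φ` with `φ(d)=p`, `φ(p)=d`,
`φ(d̄)=p̄`, `φ(p̄)=d̄`, and `R` has no automorphism that is the identity on the minimal
elements of `R` and not the identity on the maximal elements of `R`.
-/
theorem exists_middle_set_R :
    ∃ (R : FinPoset) (d p dbar pbar : ↥R),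
      -- exactly two maximal elements d and p
      d ≠ p ∧ (∀ x : ↥R, IsMax x ↔ x = d ∨ x = p) ∧
      -- d and p have the same rank
      Order.height d = Order.height p ∧
      -- exactly two minimal elements d̄ and p̄
      dbar ≠ pbar ∧ (∀ x : ↥R, IsMin x ↔ x = dbar ∨ x = pbar) ∧
      -- R∖{p̄} has an automorphism ψ with ψ(d)=p, ψ(p)=d, ψ(d̄)=d̄
      (∃ (h1 : d ≠ pbar) (h2 : p ≠ pbar) (h3 : dbar ≠ pbar)
          (ψ : Card ↥R pbar ≃o Card ↥R pbar),
          ψ ⟨d, h1⟩ = ⟨p, h2⟩ ∧ ψ ⟨p, h2⟩ = ⟨d, h1⟩ ∧ ψ ⟨dbar, h3⟩ = ⟨dbar, h3⟩) ∧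
      -- R∖{d̄} has an automorphism ψ' with ψ'(d)=p, ψ'(p)=d, ψ'(p̄)=p̄
      (∃ (h1 : d ≠ dbar) (h2 : p ≠ dbar) (h3 : pbar ≠ dbar)
          (ψ' : Card ↥R dbar ≃o Card ↥R dbar),
          ψ' ⟨d, h1⟩ = ⟨p, h2⟩ ∧ ψ' ⟨p, h2⟩ = ⟨d, h1⟩ ∧ ψ' ⟨pbar, h3⟩ = ⟨pbar, h3⟩) ∧
      -- R has an automorphism φ with φ(d)=p, φ(p)=d, φ(d̄)=p̄, φ(p̄)=d̄
      (∃ φ : ↥R ≃o ↥R, φ d = p ∧ φ p = d ∧ φ dbar = pbar ∧ φ pbar = dbar) ∧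
      -- R has no automorphism that is the identity on the minimal elements and
      -- not the identity on the maximal elements
      (∀ f : ↥R ≃o ↥R, (∀ x : ↥R, IsMin x → f x = x) → ∀ x : ↥R, IsMax x → f x = x) := by
  refine ⟨⟨Middle⟩, .top true, .top false, .bot true, .bot false, by decide, Middle.isMax_iff,
    (Order.height_orderIso Middle.swap (.top true)).symm, by decide, Middle.isMin_iff,
    ⟨by decide, by decide, by decide, Middle.cardReflect true, rfl, rfl, rfl⟩,
    ⟨by decide, by decide, by decide, Middle.cardReflect false, rfl, rfl, rfl⟩,
    ⟨Middle.swap, rfl, rfl, rfl, rfl⟩, fun f hf u hu => ?_⟩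
  have hbot (b : Bool) : f (Middle.bot b) = Middle.bot b :=
    hf _ ((Middle.isMin_iff _).2 (by cases b <;> simp))
  rcases (Middle.isMax_iff u).1 hu with rfl | rfl <;> exact Middle.map_top_of_map_bot f hbot _
end

section
/- There exists a finite ordered set R with exactly two maximal elements d and p of the same rank and exactly two minimal elements d̄ and p̄, such that: R∖{p̄} has an automorphism ψ with ψ(d)=p, ψ(p)=d, ψ(d̄)=d̄; R∖{d̄} has an automorphism ψ' with ψ'(d)=p, ψ'(p)=d, ψ'(p̄)=p̄; R has an automorphism φ with φ(d)=p, φ(p)=d, φ(d̄)=p̄, φ(p̄)=d̄; R has no automorphism that is the identity on the minimal elements and not the identity on the maximal elements; and, in addition, R contains two non-extremal elements c_t and c_b such that each of the cards R∖{c_b} and R∖{c_t} has an automorphism Ψ with Ψ(d̄)=d̄, Ψ(p̄)=p̄, Ψ(d)=p and Ψ(p)=d. -/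
/-- The points of the middle set: two minimal points, literals `x i = b` for five Boolean
variables, two marks, all valuations of the variables, and two maximal points. -/
inductive MiddlePoint
  | bot (m : Bool)
  | lit (i : Fin 5) (b : Bool)
  | mark (j : Bool)
  | val (v : Fin 5 → Bool)
  | top (t : Bool)
  deriving DecidableEq, Fintype

namespace MiddlePoint

/-- The parity of a valuation. -/
def parity (v : Fin 5 → Bool) : Bool :=
  v 0 ^^ v 1 ^^ v 2 ^^ v 3 ^^ v 4

/-- Whether the literal `x i = b` lies above the minimal point `bot m`. Only `bot false`
distinguishes the two literals of variable `1`, only `bot true` distinguishes those of variable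
`2`, and both distinguish those of variable `0`. -/
def overBot (m : Bool) (i : Fin 5) (b : Bool) : Bool :=
  match i with
  | 0 => b == m
  | 1 => m || b
  | 2 => !m || b
  | _ => true

/-- The variable whose literals are distinguished by a mark. -/
def markVar (j : Bool) : Fin 5 := if j then 4 else 3

/-- The order relation of the middle set. -/
def Below : MiddlePoint → MiddlePoint → Prop
  | bot m, bot n => m = n
  | bot m, lit i b => overBot m i b = true
  | bot _, mark _ => True
  | bot _, val _ => True
  | bot _, top _ => True
  | lit i b, lit j c => i = j ∧ b = c
  | lit i b, mark j => i = markVar j ∧ b = false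
  | lit i b, val v => v i = b
  | lit _ _, top _ => True
  | mark j, mark k => j = k
  | mark _, top _ => True
  | val v, val w => v = w
  | val v, top t => parity v = t
  | top s, top t => s = t
  | _, _ => False

instance : PartialOrder MiddlePoint where
  le := Below
  le_refl x := by cases x <;> simp [Below]
  le_trans x y z := by
    cases x <;> cases y <;> cases z <;> simp +contextual [Below] <;> grind
  le_antisymm x y := by
    cases x <;> cases y <;> simp +contextual [Below]

theorem le_def {x y : MiddlePoint} : x ≤ y ↔ Below x y := Iff.rfl

theorem exists_bot_le (i : Fin 5) (b : Bool) : ∃ m, bot m ≤ lit i b := by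
  simp only [le_def, Below]
  revert i b
  decide

theorem isMin_bot (m : Bool) : IsMin (bot m) := by
  rintro (_ | _ | _ | _ | _) <;> simp +contextual [le_def, Below]

theorem isMax_top (t : Bool) : IsMax (top t) := by
  rintro (_ | _ | _ | _ | _) <;> simp +contextual [le_def, Below]

theorem isMin_iff (x : MiddlePoint) : IsMin x ↔ ∃ m, x = bot m := by
  refine ⟨fun h ↦ ?_, by rintro ⟨m, rfl⟩; exact isMin_bot m⟩
  obtain ⟨m, hm⟩ : ∃ m, bot m ≤ x := by
    cases x with
    | lit i b => exact exists_bot_le i b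
    | _ => simp [le_def, Below]
  exact ⟨m, h.eq_of_ge hm⟩

theorem isMax_iff (x : MiddlePoint) : IsMax x ↔ ∃ t, x = top t := by
  refine ⟨fun h ↦ ?_, by rintro ⟨t, rfl⟩; exact isMax_top t⟩
  obtain ⟨t, ht⟩ : ∃ t, x ≤ top t := by
    cases x <;> simp [le_def, Below]
  exact ⟨t, h.eq_of_le ht⟩

/-- Negate variable `i`, and exchange the two maximal points. -/
def flip (i : Fin 5) : MiddlePoint → MiddlePoint
  | lit j b => lit j (b ^^ decide (j = i))
  | val v => val fun j ↦ v j ^^ decide (j = i)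
  | top t => top !t
  | x => x

theorem flip_flip (i : Fin 5) (x : MiddlePoint) : flip i (flip i x) = x := by
  cases x <;> simp [flip]

theorem parity_flip (i : Fin 5) (v : Fin 5 → Bool) :
    parity (fun j ↦ v j ^^ decide (j = i)) = !parity v := by
  fin_cases i <;> simp [parity]

/-- Exchange the variables `1` and `2`, and the two minimal points. -/
def exchange : MiddlePoint → MiddlePoint
  | bot m => bot !m
  | lit i b => lit (Equiv.swap 1 2 i) b
  | val v => val fun i ↦ v (Equiv.swap 1 2 i)
  | x => x

/-- A point at which negating variable `i` is compatible with the order. -/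
def Respects (i : Fin 5) : MiddlePoint → Prop
  | bot m => ∀ b, overBot m i b = true
  | mark j => markVar j ≠ i
  | _ => True

theorem flip_le_flip {i : Fin 5} {x y : MiddlePoint} (hx : Respects i x) (hy : Respects i y)
    (h : x ≤ y) : flip i x ≤ flip i y := by
  match x, y with
  | bot m, lit j b =>
    change overBot m j (b ^^ decide (j = i)) = true
    obtain rfl | hj := eq_or_ne j i
    · exact hx _
    · rw [decide_eq_false hj, Bool.xor_false]
      exact h
  | bot _, bot _ | bot _, mark _ | bot _, val _ | bot _, top _ => exact h
  | lit _ _, lit _ _ | lit _ _, mark _ | lit _ _, val _ | lit _ _, top _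
  | mark _, mark _ | mark _, top _ | val _, val _ | val _, top _ | top _, top _ =>
    simp_all [le_def, Below, flip, Respects, parity_flip]

/-- Negating a variable is an automorphism once the only obstructing point is removed. -/
def flipIso (i : Fin 5) (a : MiddlePoint) (ha : flip i a = a)
    (h : ∀ x, x ≠ a → Respects i x) : Card MiddlePoint a ≃o Card MiddlePoint a :=
  have ne (x : Card MiddlePoint a) : flip i x ≠ a := fun e ↦
    x.2 (by rw [← flip_flip i x, e, ha])
  Equiv.toOrderIso
    ⟨fun x ↦ ⟨flip i x, ne x⟩, fun x ↦ ⟨flip i x, ne x⟩,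
      fun x ↦ Subtype.ext (flip_flip i x), fun x ↦ Subtype.ext (flip_flip i x)⟩
    (fun x y hxy ↦ flip_le_flip (h x x.2) (h y y.2) hxy)
    (fun x y hxy ↦ flip_le_flip (h x x.2) (h y y.2) hxy)

theorem respects_of_ne_bot {m : Bool} {x : MiddlePoint} (hx : x ≠ bot m) :
    Respects (if m then 2 else 1) x := by
  cases x with
  | bot n => revert m n; simp [Respects, overBot]
  | mark j => revert m j; simp [Respects, markVar]
  | _ => trivial

theorem respects_of_ne_mark {j : Bool} {x : MiddlePoint} (hx : x ≠ mark j) :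
    Respects (markVar j) x := by
  cases x with
  | bot m => revert m j; simp [Respects, overBot, markVar]
  | mark k => revert j k; simp [Respects, markVar]
  | _ => trivial

theorem swap_eq_zero_iff (i : Fin 5) : Equiv.swap 1 2 i = 0 ↔ i = 0 := by
  revert i; decide

theorem parity_swap (v : Fin 5 → Bool) :
    parity (fun i ↦ v (Equiv.swap 1 2 i)) = parity v := by
  have h3 : Equiv.swap (1 : Fin 5) 2 3 = 3 := by decide
  have h4 : Equiv.swap (1 : Fin 5) 2 4 = 4 := by decide
  have h0 : Equiv.swap (1 : Fin 5) 2 0 = 0 := by decide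
  simp only [parity, Equiv.swap_apply_left, Equiv.swap_apply_right, h0, h3, h4]
  rw [Bool.xor_assoc (v 0), Bool.xor_comm (v 2), ← Bool.xor_assoc (v 0)]

theorem overBot_exchange (m : Bool) (i : Fin 5) (b : Bool) :
    overBot (!m) (Equiv.swap 1 2 i) (b ^^ decide (i = 0)) = overBot m i b := by
  revert m i b; decide

theorem swap_markVar (j : Bool) : Equiv.swap 1 2 (markVar j) = markVar j := by
  revert j; decide

theorem markVar_ne_zero (j : Bool) : markVar j ≠ 0 := by
  revert j; decide

/-- The automorphism of the middle set that exchanges both the minimal and the maximal points. -/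
def exchangeIso : MiddlePoint ≃o MiddlePoint :=
  have invol (x : MiddlePoint) : flip 0 (exchange (flip 0 (exchange x))) = x := by
    cases x <;> simp [flip, exchange, swap_eq_zero_iff]
  have mono (x y : MiddlePoint) (h : x ≤ y) :
      flip 0 (exchange x) ≤ flip 0 (exchange y) := by
    cases x <;> cases y <;>
      simp_all [le_def, Below, flip, exchange, parity_flip, parity_swap, swap_eq_zero_iff,
        overBot_exchange, swap_markVar, markVar_ne_zero]
  Equiv.toOrderIso ⟨fun x ↦ flip 0 (exchange x), fun x ↦ flip 0 (exchange x), invol, invol⟩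
    mono mono

section Rigidity

theorem isLit_iff (x : MiddlePoint) :
    (∃ i b, x = lit i b) ↔ ¬ IsMin x ∧ ∀ y < x, IsMin y := by
  simp only [isMin_iff]
  constructor
  · rintro ⟨i, b, rfl⟩
    refine ⟨by simp, fun y hy ↦ ?_⟩
    have hle := hy.le
    have hne := hy.ne
    cases y <;> simp_all [le_def, Below]
  · rintro ⟨hx, h⟩
    have not_lt (i : Fin 5) (b : Bool) : ¬ lit i b < x := fun hlt ↦ by simpa using h _ hlt
    simp only [lt_iff_le_and_ne, le_def] at not_lt
    cases x with
    | bot m => simp at hx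
    | lit i b => exact ⟨i, b, rfl⟩
    | mark j => simpa [Below] using not_lt (markVar j) false
    | val v => simpa [Below] using not_lt 0 (v 0)
    | top t => simpa [Below] using not_lt 0 false

theorem isMark_iff (x : MiddlePoint) :
    (∃ j, x = mark j) ↔
      (∃ y < x, ¬ IsMin y) ∧ ∀ y ≤ x, ¬ IsMin y → ∀ m, bot m ≤ y := by
  simp only [isMin_iff]
  constructor
  · rintro ⟨j, rfl⟩
    refine ⟨⟨lit (markVar j) false, ?_, by simp⟩, fun y hy hmin m ↦ ?_⟩
    · exact lt_of_le_of_ne ⟨rfl, rfl⟩ (by simp)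
    · cases y <;> simp_all [le_def, Below]
      revert m j
      simp [overBot, markVar]
  · rintro ⟨⟨y, hy, hmin⟩, h⟩
    have not_le (b : Bool) : ¬ lit 0 b ≤ x := fun hle ↦ by
      simpa [le_def, Below, overBot] using h _ hle (by simp) (!b)
    have hle := hy.le
    have hne := hy.ne
    cases x with
    | mark j => exact ⟨j, rfl⟩
    | val v => exact absurd rfl (not_le (v 0))
    | top t => exact absurd trivial (not_le false)
    | bot m => cases y <;> simp_all [le_def, Below]
    | lit i b => cases y <;> simp_all [le_def, Below]

variable (f : MiddlePoint ≃o MiddlePoint)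

theorem map_lit (hf : ∀ m, f (bot m) = bot m) (i : Fin 5) (b : Bool) :
    ∃ j c, f (lit i b) = lit j c ∧ ∀ m, overBot m j c = overBot m i b := by
  obtain ⟨hmin, hlt⟩ := (isLit_iff (lit i b)).1 ⟨i, b, rfl⟩
  obtain ⟨j, c, h⟩ := (isLit_iff (f (lit i b))).2 ⟨by rwa [f.isMin_apply], fun y hy ↦ by
    rw [← f.symm.isMin_apply]
    exact hlt _ (f.symm_apply_lt.2 hy)⟩
  refine ⟨j, c, h, fun m ↦ ?_⟩
  have key : bot m ≤ lit j c ↔ bot m ≤ lit i b := by rw [← h, ← hf m, f.le_iff_le, hf m]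
  exact Bool.eq_iff_iff.2 key

theorem map_mark (hf : ∀ m, f (bot m) = bot m) (j : Bool) : ∃ k, f (mark j) = mark k := by
  obtain ⟨⟨y, hy, hmin⟩, h⟩ := (isMark_iff (mark j)).1 ⟨j, rfl⟩
  refine (isMark_iff _).2
    ⟨⟨f y, f.lt_iff_lt.2 hy, by rwa [f.isMin_apply]⟩, fun z hz hzmin m ↦ ?_⟩
  rw [← hf m, ← f.le_symm_apply]
  exact h _ (f.symm_apply_le.2 hz) (by rwa [f.symm.isMin_apply]) m

theorem map_top (hf : ∀ m, f (bot m) = bot m) (t : Bool) : f (top t) = top t := by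
  have hf' (m : Bool) : f.symm (bot m) = bot m := f.symm_apply_eq.2 (hf m).symm
  set z : MiddlePoint := val fun _ ↦ false
  have zero_or_two : ∀ i b, (∀ m, overBot m i b = !m) → b = false := by decide
  have zero_or_one : ∀ i b, (∀ m, overBot m i b = m) →
      (i = 0 ∧ b = true) ∨ (i = 1 ∧ b = false) := by decide
  have lit_le (i : Fin 5) (h : ∀ m, overBot m i false = !m) : lit i false ≤ f z := by
    obtain ⟨j, c, hj, hc⟩ := map_lit f.symm hf' i false
    rw [← f.symm_apply_le, hj, zero_or_two j c fun m ↦ (hc m).trans (h m)]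
    rfl
  have lit_mark (j : Bool) : lit (markVar j) false ≤ f z := by
    obtain ⟨i, c, hi, -⟩ := map_lit f.symm hf' (markVar j) false
    obtain ⟨k, hk⟩ := map_mark f.symm hf' j
    have h : lit (markVar j) false ≤ mark j := ⟨rfl, rfl⟩
    rw [← f.symm.le_iff_le, hi, hk] at h
    rw [← f.symm_apply_le, hi, h.2]
    rfl
  have nonmax : ¬ IsMax (f z) := by simp [f.isMax_apply, isMax_iff, z]
  have h0 := lit_le 0 (by decide)
  have h2 := lit_le 2 (by decide)
  have h3 := lit_mark false
  have h4 := lit_mark true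
  obtain ⟨i, c, hi, hc⟩ := map_lit f hf 1 false
  have h1 : lit i c ≤ f z := by
    rw [← hi, f.le_iff_le]
    rfl
  have fz : f z = z := by
    cases hw : f z with
    | val w =>
      rw [hw] at h0 h1 h2 h3 h4
      simp only [le_def, Below] at h0 h1 h2 h3 h4
      obtain ⟨rfl, rfl⟩ | ⟨rfl, rfl⟩ := zero_or_one i c fun m ↦ (hc m).trans (by revert m; decide)
      · simp [h0] at h1
      · refine congrArg val (funext fun i ↦ ?_)
        fin_cases i <;> assumption
    | top t => exact absurd (hw ▸ isMax_top t) nonmax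
    | mark j => exact absurd (hw ▸ h0).1.symm (markVar_ne_zero j)
    | lit j b =>
      rw [hw] at h0 h2
      exact absurd (h0.1.trans h2.1.symm) (by decide)
    | bot m => exact (hw ▸ h0).elim
  obtain ⟨s, hs⟩ := (isMax_iff _).1 ((f.isMax_apply (x := top false)).2 (isMax_top false))
  have hs' : s = false := by
    have h : z ≤ top false := rfl
    rw [← f.le_iff_le, fz, hs] at h
    exact h.symm
  subst hs'
  obtain ⟨r, hr⟩ := (isMax_iff _).1 ((f.isMax_apply (x := top true)).2 (isMax_top true))
  cases t with
  | false => exact hs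
  | true =>
    cases r with
    | false => exact absurd (f.injective (hr.trans hs.symm)) (by simp)
    | true => exact hr

end Rigidity

end MiddlePoint

/--
There exists a finite ordered set `R` with exactly two maximal elements `d` and `p` of the
same rank and exactly two minimal elements `d̄` and `p̄`, such that: `R∖{p̄}` has an
automorphism swapping `d` and `p` and fixing `d̄`; `R∖{d̄}` has an automorphism swapping
`d` and `p` and fixing `p̄`; `R` has an automorphism `φ` with `φ(d)=p`, `φ(p)=d`,
`φ(d̄)=p̄`, `φ(p̄)=d̄`; `R` has no automorphism that is the identity on the minimal
elements and not the identity on the maximal elements; and, in addition, `R` contains two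
non-extremal elements `c_t` and `c_b` such that each of the cards `R∖{c_b}` and `R∖{c_t}`
has an automorphism `Ψ` with `Ψ(d̄)=d̄`, `Ψ(p̄)=p̄`, `Ψ(d)=p` and `Ψ(p)=d`.
-/
theorem exists_middle_set_R_with_ct_cb :
    ∃ (R : FinPoset) (d p dbar pbar ct cb : ↥R),
      -- exactly two maximal elements d and p
      d ≠ p ∧ (∀ x : ↥R, IsMax x ↔ x = d ∨ x = p) ∧
      -- d and p have the same rank
      Order.height d = Order.height p ∧
      -- exactly two minimal elements d̄ and p̄
      dbar ≠ pbar ∧ (∀ x : ↥R, IsMin x ↔ x = dbar ∨ x = pbar) ∧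
      -- R∖{p̄} has an automorphism ψ with ψ(d)=p, ψ(p)=d, ψ(d̄)=d̄
      (∃ (h1 : d ≠ pbar) (h2 : p ≠ pbar) (h3 : dbar ≠ pbar)
          (ψ : Card ↥R pbar ≃o Card ↥R pbar),
          ψ ⟨d, h1⟩ = ⟨p, h2⟩ ∧ ψ ⟨p, h2⟩ = ⟨d, h1⟩ ∧ ψ ⟨dbar, h3⟩ = ⟨dbar, h3⟩) ∧
      -- R∖{d̄} has an automorphism ψ' with ψ'(d)=p, ψ'(p)=d, ψ'(p̄)=p̄
      (∃ (h1 : d ≠ dbar) (h2 : p ≠ dbar) (h3 : pbar ≠ dbar)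
          (ψ' : Card ↥R dbar ≃o Card ↥R dbar),
          ψ' ⟨d, h1⟩ = ⟨p, h2⟩ ∧ ψ' ⟨p, h2⟩ = ⟨d, h1⟩ ∧ ψ' ⟨pbar, h3⟩ = ⟨pbar, h3⟩) ∧
      -- R has an automorphism φ with φ(d)=p, φ(p)=d, φ(d̄)=p̄, φ(p̄)=d̄
      (∃ φ : ↥R ≃o ↥R, φ d = p ∧ φ p = d ∧ φ dbar = pbar ∧ φ pbar = dbar) ∧
      -- R has no automorphism that is the identity on the minimal elements and
      -- not the identity on the maximal elements
      (∀ f : ↥R ≃o ↥R, (∀ x : ↥R, IsMin x → f x = x) → ∀ x : ↥R, IsMax x → f x = x) ∧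
      -- c_t and c_b are non-extremal
      (¬ IsMax ct ∧ ¬ IsMin ct) ∧ (¬ IsMax cb ∧ ¬ IsMin cb) ∧
      -- R∖{c_b} has an automorphism Ψ with Ψ(d̄)=d̄, Ψ(p̄)=p̄, Ψ(d)=p, Ψ(p)=d
      (∃ (h1 : dbar ≠ cb) (h2 : pbar ≠ cb) (h3 : d ≠ cb) (h4 : p ≠ cb)
          (Ψ : Card ↥R cb ≃o Card ↥R cb),
          Ψ ⟨dbar, h1⟩ = ⟨dbar, h1⟩ ∧ Ψ ⟨pbar, h2⟩ = ⟨pbar, h2⟩ ∧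
          Ψ ⟨d, h3⟩ = ⟨p, h4⟩ ∧ Ψ ⟨p, h4⟩ = ⟨d, h3⟩) ∧
      -- R∖{c_t} has an automorphism Ψ with Ψ(d̄)=d̄, Ψ(p̄)=p̄, Ψ(d)=p, Ψ(p)=d
      (∃ (h1 : dbar ≠ ct) (h2 : pbar ≠ ct) (h3 : d ≠ ct) (h4 : p ≠ ct)
          (Ψ : Card ↥R ct ≃o Card ↥R ct),
          Ψ ⟨dbar, h1⟩ = ⟨dbar, h1⟩ ∧ Ψ ⟨pbar, h2⟩ = ⟨pbar, h2⟩ ∧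
          Ψ ⟨d, h3⟩ = ⟨p, h4⟩ ∧ Ψ ⟨p, h4⟩ = ⟨d, h3⟩) := by
  open MiddlePoint in
  refine ⟨⟨MiddlePoint⟩, top false, top true, bot false, bot true, mark true, mark false,
    by simp, fun x ↦ by simp [isMax_iff], (Order.height_orderIso exchangeIso _).symm, by simp,
    fun x ↦ by simp [isMin_iff], ?_, ?_, ⟨exchangeIso, rfl, rfl, rfl, rfl⟩, ?_,
    by simp [isMax_iff, isMin_iff], by simp [isMax_iff, isMin_iff], ?_, ?_⟩
  · exact ⟨by simp, by simp, by simp,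
      flipIso _ _ rfl fun _ ↦ respects_of_ne_bot, rfl, rfl, rfl⟩
  · exact ⟨by simp, by simp, by simp,
      flipIso _ _ rfl fun _ ↦ respects_of_ne_bot, rfl, rfl, rfl⟩
  · intro f hf x hx
    obtain ⟨t, rfl⟩ := (isMax_iff x).1 hx
    exact map_top f (fun m ↦ hf _ (isMin_bot m)) t
  · exact ⟨by simp, by simp, by simp, by simp,
      flipIso _ _ rfl fun _ ↦ respects_of_ne_mark, rfl, rfl, rfl, rfl⟩
  · exact ⟨by simp, by simp, by simp, by simp,
      flipIso _ _ rfl fun _ ↦ respects_of_ne_mark, rfl, rfl, rfl, rfl⟩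
end

section
/- With Q, R, n, and the stacked ordered sets P1 and P2 as in the construction described in the context, P1 and P2 are not order-isomorphic. -/
/-- The neighborhood `↕x = {y : y ≤ x or y ≥ x}` of a point `x`,
as an induced subposet. -/
abbrev Nbhd (P : Type*) [PartialOrder P] (x : P) : Type _ := {y : P // y ≤ x ∨ x ≤ y}

/-- The hypotheses on the bottom set `Q` of the construction:
exactly two maximal elements `d`, `p` of the same rank; an isomorphism
`Q∖{d} → Q∖{p}` sending `p` to `d`; exactly two minimal elements `a`, `b`;
automorphisms of `Q∖{a}` and `Q∖{b}` swapping `d` and `p` and fixing the other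
minimal element; and rigidity. -/
structure QHyps (Q : Type*) [PartialOrder Q] (a b d p : Q) : Prop where
  dp_ne : d ≠ p
  max_iff : ∀ x : Q, IsMax x ↔ x = d ∨ x = p
  rank_eq : Order.height d = Order.height p
  iso_del_max : ∃ ψ : Card Q d ≃o Card Q p, ψ ⟨p, Ne.symm dp_ne⟩ = ⟨d, dp_ne⟩
  ab_ne : a ≠ b
  min_iff : ∀ x : Q, IsMin x ↔ x = a ∨ x = b
  auto_del_a : ∃ (hpa : p ≠ a) (hda : d ≠ a) (hba : b ≠ a)
      (ψ : Card Q a ≃o Card Q a),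
      ψ ⟨p, hpa⟩ = ⟨d, hda⟩ ∧ ψ ⟨d, hda⟩ = ⟨p, hpa⟩ ∧ ψ ⟨b, hba⟩ = ⟨b, hba⟩
  auto_del_b : ∃ (hpb : p ≠ b) (hdb : d ≠ b) (hab : a ≠ b)
      (ψ : Card Q b ≃o Card Q b),
      ψ ⟨p, hpb⟩ = ⟨d, hdb⟩ ∧ ψ ⟨d, hdb⟩ = ⟨p, hpb⟩ ∧ ψ ⟨a, hab⟩ = ⟨a, hab⟩
  rigid : ∀ f : Q ≃o Q, ∀ x, f x = x

/-- The hypotheses on the middle set `R` of the construction: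
exactly two maximal elements `dd`, `pp` of the same rank; exactly two minimal
elements `dbar`, `pbar`; automorphisms of `R∖{p̄}` and `R∖{d̄}` swapping the two
maximal elements and fixing the remaining minimal element; an automorphism of `R`
swapping the maximal elements and swapping the minimal elements; and no
automorphism of `R` that is the identity on the minimal elements and not the
identity on the maximal elements. -/
structure RHyps (R : Type*) [PartialOrder R] (dd pp dbar pbar : R) : Prop where
  dp_ne : dd ≠ pp
  max_iff : ∀ x : R, IsMax x ↔ x = dd ∨ x = pp
  rank_eq : Order.height dd = Order.height pp
  bar_ne : dbar ≠ pbar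
  min_iff : ∀ x : R, IsMin x ↔ x = dbar ∨ x = pbar
  auto_del_pbar : ∃ (h1 : dd ≠ pbar) (h2 : pp ≠ pbar) (h3 : dbar ≠ pbar)
      (ψ : Card R pbar ≃o Card R pbar),
      ψ ⟨dd, h1⟩ = ⟨pp, h2⟩ ∧ ψ ⟨pp, h2⟩ = ⟨dd, h1⟩ ∧ ψ ⟨dbar, h3⟩ = ⟨dbar, h3⟩
  auto_del_dbar : ∃ (h1 : dd ≠ dbar) (h2 : pp ≠ dbar) (h3 : pbar ≠ dbar)
      (ψ : Card R dbar ≃o Card R dbar),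
      ψ ⟨dd, h1⟩ = ⟨pp, h2⟩ ∧ ψ ⟨pp, h2⟩ = ⟨dd, h1⟩ ∧ ψ ⟨pbar, h3⟩ = ⟨pbar, h3⟩
  auto_swap : ∃ φ : R ≃o R, φ dd = pp ∧ φ pp = dd ∧ φ dbar = pbar ∧ φ pbar = dbar
  no_twist : ∀ f : R ≃o R, (∀ x, IsMin x → f x = x) → ∀ x, IsMax x → f x = x

/-- Data exhibiting the ordered set `P` as the stack obtained from `Q`, `n` copies of
`R`, and the dual `Q̃` of `Q` (the latter represented by the order-reversing embedding
`eT` of `Q` into `P`), with the indicated identifications, the comparabilities placing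
each non-maximal element of one layer below all non-minimal elements of the next layer,
and all comparabilities forced by transitivity (and no others).  If `twist = false`
the top copy of `R` is glued to `Q̃` via `d_n = d̃`, `p_n = p̃` (the set `P1`); if
`twist = true` it is glued via `d_n = p̃`, `p_n = d̃` (the set `P2`). -/
structure StackData (Q R P : Type*) [PartialOrder Q] [PartialOrder R] [PartialOrder P]
    (a b d p : Q) (dd pp dbar pbar : R) (n : ℕ) (twist : Bool) where
  hn : 0 < n
  /-- the copy of `Q` at the bottom -/
  eQ : Q → P
  /-- the copies `R_1, …, R_n` (indexed by `Fin n`) -/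
  eR : Fin n → R → P
  /-- the copy of the dual `Q̃` of `Q` at the top (order-reversing) -/
  eT : Q → P
  eQ_iff : ∀ q q', eQ q ≤ eQ q' ↔ q ≤ q'
  eR_iff : ∀ i x y, eR i x ≤ eR i y ↔ x ≤ y
  eT_iff : ∀ q q', eT q ≤ eT q' ↔ q' ≤ q
  cover : ∀ z : P, (∃ q, z = eQ q) ∨ (∃ i x, z = eR i x) ∨ (∃ q, z = eT q)
  -- identifications at the bottom: d = d̄₁, p = p̄₁
  id_bot_d : eQ d = eR ⟨0, hn⟩ dbar
  id_bot_p : eQ p = eR ⟨0, hn⟩ pbar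
  -- identifications in the middle: d_i = d̄_{i+1}, p_i = p̄_{i+1}
  id_mid_d : ∀ (i : ℕ) (h : i + 1 < n), eR ⟨i, Nat.lt_of_succ_lt h⟩ dd = eR ⟨i + 1, h⟩ dbar
  id_mid_p : ∀ (i : ℕ) (h : i + 1 < n), eR ⟨i, Nat.lt_of_succ_lt h⟩ pp = eR ⟨i + 1, h⟩ pbar
  -- identification at the top (straight or twisted)
  id_top_d : eR ⟨n - 1, Nat.sub_lt hn Nat.one_pos⟩ dd = eT (if twist then p else d)
  id_top_p : eR ⟨n - 1, Nat.sub_lt hn Nat.one_pos⟩ pp = eT (if twist then d else p)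
  -- the pieces only overlap at the identified points
  eQ_meet_eR : ∀ q i x, eQ q = eR i x →
      i = ⟨0, hn⟩ ∧ ((q = d ∧ x = dbar) ∨ (q = p ∧ x = pbar))
  eR_meet_eR : ∀ (i j : Fin n) x y, (i : ℕ) < (j : ℕ) → eR i x = eR j y →
      (j : ℕ) = (i : ℕ) + 1 ∧ ((x = dd ∧ y = dbar) ∨ (x = pp ∧ y = pbar))
  eR_meet_eT : ∀ (i : Fin n) x q, eR i x = eT q →
      (i : ℕ) = n - 1 ∧ ((x = dd ∧ q = (if twist then p else d)) ∨
        (x = pp ∧ q = (if twist then d else p)))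
  eQ_meet_eT : ∀ q q', eQ q ≠ eT q'
  /-- the order on `P` is generated by the orders of the layers together with the
  comparabilities placing non-maximal elements of each layer below the non-minimal
  elements of the next layer (all further comparabilities forced by transitivity). -/
  le_iff : ∀ z w : P, z ≤ w ↔ Relation.ReflTransGen (fun u v =>
      (∃ q q', q ≤ q' ∧ u = eQ q ∧ v = eQ q') ∨
      (∃ i : Fin n, ∃ x y, x ≤ y ∧ u = eR i x ∧ v = eR i y) ∨
      (∃ q q', q' ≤ q ∧ u = eT q ∧ v = eT q') ∨
      (∃ q x, ¬ IsMax q ∧ ¬ IsMin x ∧ u = eQ q ∧ v = eR ⟨0, hn⟩ x) ∨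
      (∃ i : ℕ, ∃ h : i + 1 < n, ∃ x y, ¬ IsMax x ∧ ¬ IsMin y ∧
          u = eR ⟨i, Nat.lt_of_succ_lt h⟩ x ∧ v = eR ⟨i + 1, h⟩ y) ∨
      (∃ x q, ¬ IsMax x ∧ ¬ IsMax q ∧
          u = eR ⟨n - 1, Nat.sub_lt hn Nat.one_pos⟩ x ∧ v = eT q)) z w

/-- The rank of an element of a finite order, as a natural number. -/
noncomputable def rk {A : Type*} [PartialOrder A] (x : A) : ℕ := (Order.height x).toNat

section Rank

variable {A B : Type*} [PartialOrder A] [PartialOrder B]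

theorem coe_rk [Finite A] (x : A) : (rk x : ℕ∞) = Order.height x :=
  ENat.natCast_toNat (Order.height_eq_top_iff.not.mpr fun h => by
    cases nonempty_fintype A
    obtain ⟨l, -, hl⟩ := h (Fintype.card A)
    have := l.length_lt_card
    omega)

theorem rk_strictMono [Finite A] : StrictMono (rk : A → ℕ) := fun x y h => by
  have := Order.height_strictMono h (by rw [← coe_rk]; exact ENat.natCast_lt_top _)
  rw [← coe_rk, ← coe_rk] at this
  exact_mod_cast this

theorem exists_lt_rk_eq [Finite A] {x : A} {m : ℕ} (h : m < rk x) : ∃ y < x, rk y = m := by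
  have hx : Order.height x < ⊤ := by rw [← coe_rk]; exact ENat.natCast_lt_top _
  obtain ⟨y, hy, hm⟩ := (Order.coe_lt_height_iff (n := m) hx).mp
    (by rw [← coe_rk]; exact_mod_cast h)
  rw [← coe_rk] at hm
  exact ⟨y, hy, by exact_mod_cast hm⟩

theorem rk_eq_zero_iff [Finite A] {x : A} : rk x = 0 ↔ IsMin x := by
  rw [← Order.height_eq_zero, ← coe_rk]
  norm_cast

theorem rk_orderIso (f : A ≃o B) (x : A) : rk (f x) = rk x := by
  rw [rk, Order.height_orderIso, rk]

/-- A strictly monotone function to `ℕ` that decreases by at most one step at a time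
is the rank. -/
theorem rk_eq_of_strictMono [Finite A] {f : A → ℕ} (hf : StrictMono f)
    (hs : ∀ x m, f x = m + 1 → ∃ y < x, f y = m) (x : A) : rk x = f x := by
  induction hn : f x using Nat.strong_induction_on generalizing x with
  | _ n ih =>
    apply le_antisymm
    · by_contra! h
      obtain ⟨y, hy, hr⟩ := exists_lt_rk_eq h
      have hlt := hf hy
      have := ih (f y) (by omega) y rfl
      omega
    · cases n with
      | zero => exact Nat.zero_le _
      | succ m =>
        obtain ⟨y, hy, hm⟩ := hs x m hn
        have := ih m (by omega) y hm
        have := rk_strictMono hy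
        omega

theorem rk_lt_of_not_isMax [Finite A] {u v : A} (hmax : ∀ x : A, IsMax x ↔ x = u ∨ x = v)
    (huv : Order.height u = Order.height v) {x : A} (hx : ¬ IsMax x) : rk x < rk u := by
  obtain ⟨y, hxy, hy⟩ := Finite.exists_le_maximal (p := fun _ : A => True) (a := x) trivial
  have hy' : IsMax y := fun z hz => hy.2 trivial hz
  have hr : rk y = rk u := by
    rcases (hmax y).mp hy' with rfl | rfl
    · rfl
    · simp [rk, huv]
  rw [← hr]
  exact rk_strictMono (lt_of_le_of_ne hxy fun h => hx (h ▸ hy'))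

theorem rk_le_of_isMax_iff [Finite A] {u v : A} (hmax : ∀ x : A, IsMax x ↔ x = u ∨ x = v)
    (huv : Order.height u = Order.height v) (x : A) : rk x ≤ rk u := by
  by_cases hx : IsMax x
  · rcases (hmax x).mp hx with rfl | rfl
    · rfl
    · simp [rk, huv]
  · exact (rk_lt_of_not_isMax hmax huv hx).le

theorem eq_of_map_le_iff {e : A → B} (he : ∀ x y, e x ≤ e y ↔ x ≤ y) {x y : A}
    (h : e x = e y) : x = y :=
  le_antisymm ((he x y).mp h.le) ((he y x).mp h.ge)

/-- An isomorphism that carries an embedded copy of `A` into another embedded copy of `A`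
induces an automorphism of the finite order `A`. -/
theorem exists_orderIso_of_map_range [Finite A] {P P' : Type*} [PartialOrder P] [PartialOrder P']
    (Φ : P ≃o P') {e : A → P} {e' : A → P'} (he : ∀ x y, e x ≤ e y ↔ x ≤ y)
    (he' : ∀ x y, e' x ≤ e' y ↔ x ≤ y) (h : ∀ x, ∃ y, Φ (e x) = e' y) :
    ∃ g : A ≃o A, ∀ x, Φ (e x) = e' (g x) := by
  choose g hg using h
  have hle : ∀ x y, g x ≤ g y ↔ x ≤ y := fun x y => by
    rw [← he', ← hg, ← hg, Φ.le_iff_le, he]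
  let G : A ↪o A := OrderEmbedding.ofMapLEIff g hle
  exact ⟨RelIso.ofSurjective G (Finite.surjective_of_injective G.injective), hg⟩

end Rank

namespace StackData

variable {Q R P : Type*} [PartialOrder Q] [PartialOrder R] [PartialOrder P]
  {a b d p : Q} {dd pp dbar pbar : R} {n : ℕ} {t : Bool}

theorem eR_last (S : StackData Q R P a b d p dd pp dbar pbar n t) {i : Fin n} {x : R}
    (hi : (i : ℕ) + 1 = n) (hx : x = dd ∨ x = pp) :
    ∃ q, (q = d ∨ q = p) ∧ S.eR i x = S.eT q := by
  obtain rfl : i = ⟨n - 1, Nat.sub_lt S.hn Nat.one_pos⟩ := Fin.ext (by simp; omega)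
  rcases hx with rfl | rfl
  · exact ⟨_, by cases t <;> simp, S.id_top_d⟩
  · exact ⟨_, by cases t <;> simp, S.id_top_p⟩

theorem eT_of_isMax (S : StackData Q R P a b d p dd pp dbar pbar n t) {q : Q}
    (hq : q = d ∨ q = p) :
    ∃ x, (x = dd ∨ x = pp) ∧ S.eT q = S.eR ⟨n - 1, Nat.sub_lt S.hn Nat.one_pos⟩ x := by
  have h1 := S.id_top_d
  have h2 := S.id_top_p
  cases t <;> rcases hq with rfl | rfl <;> simp at h1 h2
  exacts [⟨dd, by simp, h1.symm⟩, ⟨pp, by simp, h2.symm⟩, ⟨pp, by simp, h2.symm⟩,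
    ⟨dd, by simp, h1.symm⟩]

theorem eR_eq_next (S : StackData Q R P a b d p dd pp dbar pbar n t) {i j : Fin n} {x : R}
    (hij : (j : ℕ) = i + 1) (hx : x = dd ∨ x = pp) :
    ∃ y, (y = dbar ∨ y = pbar) ∧ S.eR i x = S.eR j y := by
  obtain ⟨i, hi⟩ := i
  obtain ⟨j, hj⟩ := j
  obtain rfl : j = i + 1 := hij
  rcases hx with rfl | rfl
  · exact ⟨_, Or.inl rfl, S.id_mid_d i hj⟩
  · exact ⟨_, Or.inr rfl, S.id_mid_p i hj⟩

theorem eR_eq_prev (S : StackData Q R P a b d p dd pp dbar pbar n t) {i j : Fin n} {y : R}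
    (hij : (j : ℕ) = i + 1) (hy : y = dbar ∨ y = pbar) :
    ∃ x, (x = dd ∨ x = pp) ∧ S.eR j y = S.eR i x := by
  obtain ⟨i, hi⟩ := i
  obtain ⟨j, hj⟩ := j
  obtain rfl : j = i + 1 := hij
  rcases hy with rfl | rfl
  · exact ⟨_, Or.inl rfl, (S.id_mid_d i hj).symm⟩
  · exact ⟨_, Or.inr rfl, (S.id_mid_p i hj).symm⟩

theorem eR_zero (S : StackData Q R P a b d p dd pp dbar pbar n t) {i : Fin n} {x : R}
    (hi : (i : ℕ) = 0) (hx : x = dbar ∨ x = pbar) :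
    ∃ q, (q = d ∨ q = p) ∧ S.eR i x = S.eQ q := by
  obtain rfl : i = ⟨0, S.hn⟩ := Fin.ext hi
  rcases hx with rfl | rfl
  · exact ⟨_, Or.inl rfl, S.id_bot_d.symm⟩
  · exact ⟨_, Or.inr rfl, S.id_bot_p.symm⟩

/-- Every point of the stack lies in `Q`, or is a non-minimal point of some copy of `R`
or of the dual of `Q`. -/
theorem cover_of_not_isMin (hQ : QHyps Q a b d p) (hR : RHyps R dd pp dbar pbar)
    (S : StackData Q R P a b d p dd pp dbar pbar n t) (z : P) :
    (∃ q, z = S.eQ q) ∨ (∃ i x, ¬ IsMin x ∧ z = S.eR i x) ∨ ∃ q, ¬ IsMax q ∧ z = S.eT q := by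
  have hmin : ∀ x, x = dd ∨ x = pp → ¬ IsMin x := by
    obtain ⟨h1, h2, -, -⟩ := hR.auto_del_pbar
    obtain ⟨h3, h4, -, -⟩ := hR.auto_del_dbar
    rintro x (rfl | rfl) h <;> rcases (hR.min_iff _).mp h with h | h <;> contradiction
  rcases S.cover z with h | ⟨i, x, rfl⟩ | ⟨q, rfl⟩
  · exact Or.inl h
  · by_cases hx : IsMin x
    · rcases Nat.eq_zero_or_pos (i : ℕ) with hi | hi
      · obtain ⟨q, -, h⟩ := S.eR_zero hi ((hR.min_iff x).mp hx)
        exact Or.inl ⟨q, h⟩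
      · obtain ⟨y, hy, h⟩ := S.eR_eq_prev (i := ⟨i - 1, by omega⟩) (j := i) (by simp; omega)
          ((hR.min_iff x).mp hx)
        exact Or.inr (Or.inl ⟨_, y, hmin y hy, h⟩)
    · exact Or.inr (Or.inl ⟨i, x, hx, rfl⟩)
  · by_cases hq : IsMax q
    · obtain ⟨x, hx, h⟩ := S.eT_of_isMax ((hQ.max_iff q).mp hq)
      exact Or.inr (Or.inl ⟨_, x, hmin x hx, h⟩)
    · exact Or.inr (Or.inr ⟨q, hq, rfl⟩)

variable [Finite Q] [Finite R]

theorem exists_level (hQ : QHyps Q a b d p) (hR : RHyps R dd pp dbar pbar)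
    (S : StackData Q R P a b d p dd pp dbar pbar n t) :
    ∃ f : P → ℕ, (∀ q, f (S.eQ q) = rk q) ∧
      (∀ i x, f (S.eR i x) = rk d + i * rk dd + rk x) ∧
      ∀ q, f (S.eT q) = rk d + n * rk dd + rk (OrderDual.toDual q) := by
  have hp : rk p = rk d := by simp [rk, hQ.rank_eq]
  have hpp : rk pp = rk dd := by simp [rk, hR.rank_eq]
  have hd0 : rk dbar = 0 := rk_eq_zero_iff.mpr ((hR.min_iff _).mpr (Or.inl rfl))
  have hp0 : rk pbar = 0 := rk_eq_zero_iff.mpr ((hR.min_iff _).mpr (Or.inr rfl))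
  have htop : ∀ q, q = d ∨ q = p → rk (OrderDual.toDual q) = 0 := fun q hq =>
    rk_eq_zero_iff.mpr ((hQ.max_iff q).mpr hq).toDual
  have hQR : ∀ q i x, S.eQ q = S.eR i x → rk q = rk d + i * rk dd + rk x := by
    intro q i x h
    obtain ⟨rfl, ⟨rfl, rfl⟩ | ⟨rfl, rfl⟩⟩ := S.eQ_meet_eR q i x h <;> simp [*]
  have hRR : ∀ (i j : Fin n) x y, S.eR i x = S.eR j y → (i : ℕ) < j →
      rk d + i * rk dd + rk x = rk d + j * rk dd + rk y := by
    intro i j x y h hij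
    obtain ⟨hj, ⟨rfl, rfl⟩ | ⟨rfl, rfl⟩⟩ := S.eR_meet_eR i j x y hij h <;>
      rw [hj] <;> simp only [hpp, hd0, hp0] <;> ring
  have hRT : ∀ (i : Fin n) x q, S.eR i x = S.eT q →
      rk d + i * rk dd + rk x = rk d + n * rk dd + rk (OrderDual.toDual q) := by
    intro i x q h
    obtain ⟨hi, hxq⟩ := S.eR_meet_eT i x q h
    have hq : q = d ∨ q = p := by cases t <;> simp at hxq <;> tauto
    have hx : rk x = rk dd := by rcases hxq with ⟨rfl, -⟩ | ⟨rfl, -⟩ <;> simp [hpp]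
    have hn : n = i + 1 := by omega
    rw [htop q hq, hx]
    conv_rhs => rw [hn]
    ring
  let F : P → ℕ → Prop := fun z m => (∃ q, z = S.eQ q ∧ m = rk q) ∨
    (∃ i x, z = S.eR i x ∧ m = rk d + i * rk dd + rk x) ∨
    ∃ q, z = S.eT q ∧ m = rk d + n * rk dd + rk (OrderDual.toDual q)
  have hF : ∀ z, ∃ m, F z m := by
    intro z
    rcases S.cover z with ⟨q, h⟩ | ⟨i, x, h⟩ | ⟨q, h⟩
    exacts [⟨_, Or.inl ⟨q, h, rfl⟩⟩, ⟨_, Or.inr (Or.inl ⟨i, x, h, rfl⟩)⟩,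
      ⟨_, Or.inr (Or.inr ⟨q, h, rfl⟩)⟩]
  choose f hf using hF
  refine ⟨f, fun q => ?_, fun i x => ?_, fun q => ?_⟩
  · rcases hf (S.eQ q) with ⟨q', h, hm⟩ | ⟨i, x, h, hm⟩ | ⟨q', h, hm⟩ <;> rw [hm]
    · rw [eq_of_map_le_iff S.eQ_iff h]
    · exact (hQR _ _ _ h).symm
    · exact absurd h (S.eQ_meet_eT _ _)
  · rcases hf (S.eR i x) with ⟨q', h, hm⟩ | ⟨j, y, h, hm⟩ | ⟨q', h, hm⟩ <;> rw [hm]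
    · exact hQR _ _ _ h.symm
    · rcases lt_trichotomy (i : ℕ) j with hij | hij | hij
      · exact (hRR _ _ _ _ h hij).symm
      · obtain rfl : i = j := Fin.ext hij
        rw [eq_of_map_le_iff (S.eR_iff i) h]
      · exact hRR _ _ _ _ h.symm hij
    · exact (hRT _ _ _ h).symm
  · rcases hf (S.eT q) with ⟨q', h, hm⟩ | ⟨j, y, h, hm⟩ | ⟨q', h, hm⟩ <;> rw [hm]
    · exact absurd h.symm (S.eQ_meet_eT _ _)
    · exact hRT _ _ _ h.symm
    · rw [le_antisymm ((S.eT_iff _ _).mp h.ge) ((S.eT_iff _ _).mp h.le)]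

variable [Finite P]

/-- The ranks in the stack: each layer starts at the rank of the two maximal elements of the
layer below it. -/
theorem rk_layers (hQ : QHyps Q a b d p) (hR : RHyps R dd pp dbar pbar)
    (S : StackData Q R P a b d p dd pp dbar pbar n t) :
    (∀ q, rk (S.eQ q) = rk q) ∧
      (∀ i x, rk (S.eR i x) = rk d + i * rk dd + rk x) ∧
      ∀ q, rk (S.eT q) = rk d + n * rk dd + rk (OrderDual.toDual q) := by
  obtain ⟨f, hfQ, hfR, hfT⟩ := S.exists_level hQ hR
  suffices h : ∀ z, rk z = f z by simp only [h]; exact ⟨hfQ, hfR, hfT⟩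
  have hrQ : ∀ q : Q, ¬ IsMax q → rk q < rk d := fun q =>
    rk_lt_of_not_isMax hQ.max_iff hQ.rank_eq
  have hrR : ∀ x : R, ¬ IsMax x → rk x < rk dd := fun x =>
    rk_lt_of_not_isMax hR.max_iff hR.rank_eq
  have hrmin : ∀ x : R, ¬ IsMin x → 0 < rk x := fun x hx =>
    Nat.pos_of_ne_zero (rk_eq_zero_iff.not.mpr hx)
  apply rk_eq_of_strictMono
  · have key : ∀ z w : P, z ≤ w → z = w ∨ f z < f w := by
      intro z w h
      induction (S.le_iff z w).mp h with
      | refl => exact Or.inl rfl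
      | @tail u v _ huv ih =>
        have ih := ih ((S.le_iff _ _).mpr ‹_›)
        have step : u = v ∨ f u < f v := by
          rcases huv with ⟨q, q', hq, rfl, rfl⟩ | ⟨i, x, y, hx, rfl, rfl⟩ |
            ⟨q, q', hq, rfl, rfl⟩ | ⟨q, x, hq, hx, rfl, rfl⟩ |
            ⟨i, hi, x, y, hx, hy, rfl, rfl⟩ | ⟨x, q, hx, hq, rfl, rfl⟩
          · rcases hq.eq_or_lt with rfl | hq
            · exact Or.inl rfl
            · exact Or.inr (by simpa [hfQ] using rk_strictMono hq)
          · rcases hx.eq_or_lt with rfl | hx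
            · exact Or.inl rfl
            · exact Or.inr (by simpa [hfR] using rk_strictMono hx)
          · rcases hq.eq_or_lt with rfl | hq
            · exact Or.inl rfl
            · exact Or.inr (by
                simpa [hfT] using rk_strictMono (show OrderDual.toDual q < OrderDual.toDual q' from hq))
          · right
            have := hrQ q hq
            simp only [hfQ, hfR]
            omega
          · right
            have := hrR x hx
            have := hrmin y hy
            simp only [hfR]
            linarith [Nat.succ_mul i (rk dd)]
          · right
            have := hrR x hx
            have h1 : n * rk dd = (n - 1) * rk dd + rk dd := by
              rw [← Nat.succ_mul, Nat.succ_eq_add_one, Nat.sub_add_cancel S.hn]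
            simp only [hfR, hfT]
            omega
        rcases ih with rfl | ih
        · exact step
        · rcases step with rfl | step
          · exact Or.inr ih
          · exact Or.inr (ih.trans step)
    exact fun z w h => (key z w h.le).resolve_left h.ne
  · intro z m hm
    rcases S.cover_of_not_isMin hQ hR z with ⟨q, rfl⟩ | ⟨i, x, hx, rfl⟩ | ⟨q, hq, rfl⟩
    · rw [hfQ] at hm
      obtain ⟨y, hy, hr⟩ := exists_lt_rk_eq (x := q) (m := m) (by omega)
      exact ⟨_, lt_of_le_not_ge ((S.eQ_iff _ _).mpr hy.le)
        (fun h => hy.not_ge ((S.eQ_iff _ _).mp h)), by rw [hfQ, hr]⟩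
    · rw [hfR] at hm
      have := hrmin x hx
      obtain ⟨y, hy, hr⟩ := exists_lt_rk_eq (x := x) (m := rk x - 1) (by omega)
      exact ⟨_, lt_of_le_not_ge ((S.eR_iff i _ _).mpr hy.le)
        (fun h => hy.not_ge ((S.eR_iff i _ _).mp h)), by rw [hfR, hr]; omega⟩
    · rw [hfT] at hm
      have : rk (OrderDual.toDual q) ≠ 0 :=
        rk_eq_zero_iff.not.mpr (fun h => hq (isMin_toDual_iff.mp h))
      obtain ⟨y, hy, hr⟩ := exists_lt_rk_eq (x := OrderDual.toDual q)
        (m := rk (OrderDual.toDual q) - 1) (by omega)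
      have hy' : q < OrderDual.ofDual y := hy
      exact ⟨S.eT (OrderDual.ofDual y), lt_of_le_not_ge ((S.eT_iff _ _).mpr hy'.le)
        (fun h => hy'.not_ge ((S.eT_iff _ _).mp h)), by
          rw [hfT, OrderDual.toDual_ofDual, hr]; omega⟩

theorem rk_dd_pos (hR : RHyps R dd pp dbar pbar) : 0 < rk dd := by
  obtain ⟨h1, -, -, -⟩ := hR.auto_del_pbar
  obtain ⟨h2, -, -, -⟩ := hR.auto_del_dbar
  exact Nat.pos_of_ne_zero (rk_eq_zero_iff.not.mpr fun h =>
    ((hR.min_iff _).mp h).elim h2 h1)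

theorem exists_eQ_of_rk_le (hQ : QHyps Q a b d p) (hR : RHyps R dd pp dbar pbar)
    (S : StackData Q R P a b d p dd pp dbar pbar n t) {z : P} (hz : rk z ≤ rk d) :
    ∃ q, z = S.eQ q := by
  obtain ⟨-, hfR, hfT⟩ := S.rk_layers hQ hR
  rcases S.cover_of_not_isMin hQ hR z with h | ⟨i, x, hx, rfl⟩ | ⟨q, hq, rfl⟩
  · exact h
  · have := rk_eq_zero_iff.not.mpr hx
    rw [hfR] at hz
    omega
  · have : rk (OrderDual.toDual q) ≠ 0 :=
      rk_eq_zero_iff.not.mpr (fun h => hq (isMin_toDual_iff.mp h))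
    rw [hfT] at hz
    omega

theorem exists_eT_of_le_rk (hQ : QHyps Q a b d p) (hR : RHyps R dd pp dbar pbar)
    (S : StackData Q R P a b d p dd pp dbar pbar n t) {z : P}
    (hz : rk d + n * rk dd ≤ rk z) : ∃ q, z = S.eT q := by
  obtain ⟨hfQ, hfR, -⟩ := S.rk_layers hQ hR
  have hk := rk_dd_pos hR
  rcases S.cover z with ⟨q, rfl⟩ | ⟨i, x, rfl⟩ | h
  · have := rk_le_of_isMax_iff hQ.max_iff hQ.rank_eq q
    have := Nat.mul_pos S.hn hk
    rw [hfQ] at hz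
    omega
  · rw [hfR] at hz
    have hx := rk_le_of_isMax_iff hR.max_iff hR.rank_eq x
    have hi : (i : ℕ) + 1 = n := by
      by_contra hne
      have := Nat.mul_le_mul_right (rk dd) (show (i : ℕ) + 2 ≤ n by omega)
      linarith [Nat.add_mul (i : ℕ) 2 (rk dd)]
    have hmax : IsMax x := by
      by_contra h
      have := rk_lt_of_not_isMax hR.max_iff hR.rank_eq h
      have hn : n * rk dd = i * rk dd + rk dd := by rw [← Nat.succ_mul, Nat.succ_eq_add_one, hi]
      omega
    obtain ⟨q, -, h⟩ := S.eR_last hi ((hR.max_iff x).mp hmax)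
    exact ⟨q, h⟩
  · exact h

theorem exists_eR_of_rk_mem (hQ : QHyps Q a b d p) (hR : RHyps R dd pp dbar pbar)
    (S : StackData Q R P a b d p dd pp dbar pbar n t) (i : Fin n) {z : P}
    (h1 : rk d + i * rk dd ≤ rk z) (h2 : rk z ≤ rk d + (i + 1) * rk dd) :
    ∃ x, z = S.eR i x := by
  obtain ⟨hfQ, hfR, hfT⟩ := S.rk_layers hQ hR
  have hk := rk_dd_pos hR
  rcases S.cover z with ⟨q, rfl⟩ | ⟨j, x, rfl⟩ | ⟨q, rfl⟩
  · have hq := rk_le_of_isMax_iff hQ.max_iff hQ.rank_eq q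
    rw [hfQ] at h1
    have hi : (i : ℕ) = 0 := by
      by_contra hne
      have := Nat.mul_pos (Nat.pos_of_ne_zero hne) hk
      omega
    obtain rfl : i = ⟨0, S.hn⟩ := Fin.ext hi
    have hmax : IsMax q := by
      by_contra h
      have := rk_lt_of_not_isMax hQ.max_iff hQ.rank_eq h
      omega
    rcases (hQ.max_iff q).mp hmax with rfl | rfl
    · exact ⟨_, S.id_bot_d⟩
    · exact ⟨_, S.id_bot_p⟩
  · rw [hfR] at h1 h2
    have hx := rk_le_of_isMax_iff hR.max_iff hR.rank_eq x
    rcases lt_trichotomy (j : ℕ) i with hij | hij | hij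
    · have hi : (i : ℕ) = j + 1 := by
        by_contra hne
        have := Nat.mul_le_mul_right (rk dd) (show (j : ℕ) + 2 ≤ i by omega)
        linarith [Nat.add_mul (j : ℕ) 2 (rk dd)]
      have hmax : IsMax x := by
        by_contra h
        have := rk_lt_of_not_isMax hR.max_iff hR.rank_eq h
        rw [hi, Nat.add_mul] at h1
        omega
      obtain ⟨y, -, h⟩ := S.eR_eq_next hi ((hR.max_iff x).mp hmax)
      exact ⟨y, h⟩
    · obtain rfl : j = i := Fin.ext hij
      exact ⟨x, rfl⟩
    · have hj : (j : ℕ) = i + 1 := by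
        by_contra hne
        have := Nat.mul_le_mul_right (rk dd) (show (i : ℕ) + 2 ≤ j by omega)
        linarith [Nat.add_mul (i : ℕ) 2 (rk dd), Nat.add_mul (i : ℕ) 1 (rk dd)]
      have hmin : IsMin x := by
        rw [← rk_eq_zero_iff]
        rw [hj] at h2
        omega
      obtain ⟨y, -, h⟩ := S.eR_eq_prev hj ((hR.min_iff x).mp hmin)
      exact ⟨y, h⟩
  · rw [hfT] at h2
    have hi : (i : ℕ) + 1 = n := by
      by_contra hne
      have := Nat.mul_le_mul_right (rk dd) (show (i : ℕ) + 2 ≤ n by omega)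
      linarith [Nat.add_mul (i : ℕ) 2 (rk dd), Nat.add_mul (i : ℕ) 1 (rk dd)]
    have hmax : IsMax q := by
      have : rk (OrderDual.toDual q) = 0 := by
        rw [hi] at h2
        omega
      exact isMin_toDual_iff.mp (rk_eq_zero_iff.mp this)
    obtain ⟨x, -, h⟩ := S.eT_of_isMax ((hQ.max_iff q).mp hmax)
    have hl : i = ⟨n - 1, Nat.sub_lt S.hn Nat.one_pos⟩ := Fin.ext (by simp; omega)
    exact ⟨x, hl ▸ h⟩

/-- Isomorphic stacks over the same `Q`, `R` and `n` have the same top identification. -/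
theorem twist_eq {P' : Type*} [PartialOrder P'] [Finite P'] {t' : Bool}
    (hQ : QHyps Q a b d p) (hR : RHyps R dd pp dbar pbar)
    (S : StackData Q R P a b d p dd pp dbar pbar n t)
    (S' : StackData Q R P' a b d p dd pp dbar pbar n t') (Φ : P ≃o P') : t = t' := by
  obtain ⟨hfQ, hfR, hfT⟩ := S.rk_layers hQ hR
  obtain ⟨gQ, hgQ⟩ := exists_orderIso_of_map_range Φ S.eQ_iff S'.eQ_iff fun q =>
    S'.exists_eQ_of_rk_le hQ hR (by
      rw [rk_orderIso, hfQ]; exact rk_le_of_isMax_iff hQ.max_iff hQ.rank_eq q)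
  obtain ⟨gT, hgT⟩ := exists_orderIso_of_map_range (A := Qᵒᵈ) Φ
    (e := fun q => S.eT (OrderDual.ofDual q)) (e' := fun q => S'.eT (OrderDual.ofDual q))
    (fun _ _ => S.eT_iff _ _) (fun _ _ => S'.eT_iff _ _) fun q => by
      obtain ⟨y, hy⟩ := S'.exists_eT_of_le_rk hQ hR (z := Φ (S.eT (OrderDual.ofDual q))) (by
        rw [rk_orderIso, hfT]; omega)
      exact ⟨OrderDual.toDual y, hy⟩
  have hT : ∀ q, Φ (S.eT q) = S'.eT q := fun q => by
    have h : gT (OrderDual.toDual q) = OrderDual.toDual q := hQ.rigid gT.dual q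
    simpa [h] using hgT (OrderDual.toDual q)
  have hstep : ∀ i : Fin n, Φ (S.eR i dbar) = S'.eR i dbar → Φ (S.eR i pbar) = S'.eR i pbar →
      Φ (S.eR i dd) = S'.eR i dd ∧ Φ (S.eR i pp) = S'.eR i pp := by
    intro i h1 h2
    obtain ⟨g, hg⟩ := exists_orderIso_of_map_range Φ (S.eR_iff i) (S'.eR_iff i) fun x =>
      S'.exists_eR_of_rk_mem hQ hR i (by rw [rk_orderIso, hfR]; omega) (by
        have := rk_le_of_isMax_iff hR.max_iff hR.rank_eq x
        rw [rk_orderIso, hfR, Nat.add_mul]; omega)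
    have hmax := hR.no_twist g fun x hx => by
      rcases (hR.min_iff x).mp hx with rfl | rfl
      · exact eq_of_map_le_iff (S'.eR_iff i) ((hg _).symm.trans h1)
      · exact eq_of_map_le_iff (S'.eR_iff i) ((hg _).symm.trans h2)
    rw [hg, hg, hmax dd ((hR.max_iff _).mpr (Or.inl rfl)),
      hmax pp ((hR.max_iff _).mpr (Or.inr rfl))]
    exact ⟨rfl, rfl⟩
  have hall : ∀ (i : ℕ) (hi : i < n), Φ (S.eR ⟨i, hi⟩ dd) = S'.eR ⟨i, hi⟩ dd ∧
      Φ (S.eR ⟨i, hi⟩ pp) = S'.eR ⟨i, hi⟩ pp := by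
    intro i
    induction i with
    | zero =>
      intro hi
      apply hstep
      · rw [← S.id_bot_d, ← S'.id_bot_d, hgQ, hQ.rigid]
      · rw [← S.id_bot_p, ← S'.id_bot_p, hgQ, hQ.rigid]
    | succ i ih =>
      intro hi
      obtain ⟨h1, h2⟩ := ih (by omega)
      apply hstep
      · rw [← S.id_mid_d, ← S'.id_mid_d, h1]
      · rw [← S.id_mid_p, ← S'.id_mid_p, h2]
  have h := (hall (n - 1) (Nat.sub_lt S.hn Nat.one_pos)).1
  rw [S.id_top_d, S'.id_top_d, hT] at h
  have h' := le_antisymm ((S'.eT_iff _ _).mp h.ge) ((S'.eT_iff _ _).mp h.le)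
  have hne := hQ.dp_ne
  cases t <;> cases t' <;> first
    | rfl
    | exact absurd h' (by simpa using hne)
    | exact absurd h' (by simpa using hne.symm)

end StackData

/--
With `Q`, `R`, `n`, and the stacked ordered sets `P1` and `P2` as in the construction
(`P1` with the straight identification at the top, `P2` with the twisted one),
`P1` and `P2` are not order-isomorphic.
-/
theorem stacked_sets_not_isomorphic
    {Q R P1 P2 : Type*} [PartialOrder Q] [Fintype Q] [PartialOrder R] [Fintype R]
    [PartialOrder P1] [Fintype P1] [PartialOrder P2] [Fintype P2]
    {a b d p : Q} {dd pp dbar pbar : R} {n : ℕ}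
    (hQ : QHyps Q a b d p) (hR : RHyps R dd pp dbar pbar)
    (S1 : StackData Q R P1 a b d p dd pp dbar pbar n false)
    (S2 : StackData Q R P2 a b d p dd pp dbar pbar n true) :
    IsEmpty (P1 ≃o P2) := by
  exact ⟨fun Φ => Bool.noConfusion (S1.twist_eq hQ hR S2 Φ)⟩
end

section
/- With Q, R, n, and the stacked ordered sets P1 and P2 as in the construction described in the context, P1 and P2 have equal marked maximal decks and equal marked minimal decks; that is, there is a bijection σ from the maximal elements of P1 onto the maximal elements of P2 such that for each maximal element m of P1 there is an order isomorphism from P1∖{m} onto P2∖{σ(m)} mapping maximal elements of P1 to maximal elements of P2, and dually there is such a bijection and card isomorphisms for the minimal elements. -/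
/-- `P` and `P'` have equal marked maximal decks: a bijection between the maximal
elements such that corresponding maximal cards are isomorphic via isomorphisms that
map maximal elements of `P` to maximal elements of `P'`. -/
def EqualMarkedMaxDecks (P P' : Type*) [PartialOrder P] [PartialOrder P'] : Prop :=
  ∃ σ : {x : P // IsMax x} ≃ {y : P' // IsMax y},
    ∀ m : {x : P // IsMax x}, ∃ Φ : Card P m.val ≃o Card P' (σ m).val,
      ∀ z : Card P m.val, IsMax z.val → IsMax (Φ z).val

/-- `P` and `P'` have equal marked minimal decks: a bijection between the minimal
elements such that corresponding minimal cards are isomorphic via isomorphisms that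
map minimal elements of `P` to minimal elements of `P'`. -/
def EqualMarkedMinDecks (P P' : Type*) [PartialOrder P] [PartialOrder P'] : Prop :=
  ∃ σ : {x : P // IsMin x} ≃ {y : P' // IsMin y},
    ∀ m : {x : P // IsMin x}, ∃ Φ : Card P m.val ≃o Card P' (σ m).val,
      ∀ z : Card P m.val, IsMin z.val → IsMin (Φ z).val

namespace StackData

variable {Q R P P' : Type*} [PartialOrder Q] [PartialOrder R] [PartialOrder P] [PartialOrder P']
  {a b d p : Q} {dd pp dbar pbar : R} {n : ℕ} {t t' : Bool}

theorem isMin_eQ (S : StackData Q R P a b d p dd pp dbar pbar n t) {q : Q}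
    (hq : IsMin q) (hd : q ≠ d) (hp : q ≠ p) : IsMin (S.eQ q) := by
  have eQ_inj : ∀ x y, S.eQ x = S.eQ y → x = y := fun x y h =>
    le_antisymm ((S.eQ_iff _ _).1 h.le) ((S.eQ_iff _ _).1 h.ge)
  have not_eR : ∀ i x, S.eQ q ≠ S.eR i x := fun i x h => by
    rcases (S.eQ_meet_eR _ _ _ h).2 with h | h
    exacts [hd h.1, hp h.1]
  intro w hw
  rw [S.le_iff] at hw
  refine le_of_eq ?_
  induction hw using Relation.ReflTransGen.head_induction_on with
  | refl => rfl
  | head h _ ih =>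
    subst ih
    rcases h with ⟨x, y, hxy, rfl, h⟩ | ⟨i, x, y, -, -, h⟩ | ⟨x, y, -, -, h⟩ |
      ⟨x, y, -, -, -, h⟩ | ⟨i, hi, x, y, -, -, -, h⟩ | ⟨x, y, -, -, -, h⟩
    · obtain rfl := eQ_inj _ _ h
      rw [hq.eq_of_le hxy]
    · exact absurd h (not_eR _ _)
    · exact absurd h (S.eQ_meet_eT _ _)
    · exact absurd h (not_eR _ _)
    · exact absurd h (not_eR _ _)
    · exact absurd h (S.eQ_meet_eT _ _)

theorem isMax_eT (S : StackData Q R P a b d p dd pp dbar pbar n t) {q : Q}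
    (hq : IsMin q) (hd : q ≠ d) (hp : q ≠ p) : IsMax (S.eT q) := by
  have eT_inj : ∀ x y, S.eT x = S.eT y → x = y := fun x y h =>
    le_antisymm ((S.eT_iff _ _).1 h.ge) ((S.eT_iff _ _).1 h.le)
  have not_eR : ∀ i x, S.eT q ≠ S.eR i x := fun i x h => by
    have := (S.eR_meet_eT _ _ _ h.symm).2
    cases t <;> simp_all
  intro w hw
  rw [S.le_iff] at hw
  refine ge_of_eq ?_
  induction hw with
  | refl => rfl
  | tail _ h ih =>
    subst ih
    rcases h with ⟨x, y, -, h, -⟩ | ⟨i, x, y, -, h, -⟩ | ⟨x, y, hxy, h, rfl⟩ |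
      ⟨x, y, -, -, h, -⟩ | ⟨i, hi, x, y, -, -, h, -⟩ | ⟨x, y, -, -, h, -⟩
    · exact absurd h.symm (S.eQ_meet_eT _ _)
    · exact absurd h (not_eR _ _)
    · obtain rfl := eT_inj _ _ h
      rw [hq.eq_of_le hxy]
    · exact absurd h.symm (S.eQ_meet_eT _ _)
    · exact absurd h (not_eR _ _)
    · exact absurd h (not_eR _ _)

theorem isMin_of_eQ (S : StackData Q R P a b d p dd pp dbar pbar n t) {q : Q}
    (h : IsMin (S.eQ q)) : IsMin q :=
  fun _ hy => (S.eQ_iff _ _).1 (h ((S.eQ_iff _ _).2 hy))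

theorem isMax_of_eQ (S : StackData Q R P a b d p dd pp dbar pbar n t) {q : Q}
    (h : IsMax (S.eQ q)) : IsMax q :=
  fun _ hy => (S.eQ_iff _ _).1 (h ((S.eQ_iff _ _).2 hy))

theorem isMin_of_eR (S : StackData Q R P a b d p dd pp dbar pbar n t) {i : Fin n} {x : R}
    (h : IsMin (S.eR i x)) : IsMin x :=
  fun _ hy => (S.eR_iff _ _ _).1 (h ((S.eR_iff _ _ _).2 hy))

theorem isMax_of_eR (S : StackData Q R P a b d p dd pp dbar pbar n t) {i : Fin n} {x : R}
    (h : IsMax (S.eR i x)) : IsMax x :=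
  fun _ hy => (S.eR_iff _ _ _).1 (h ((S.eR_iff _ _ _).2 hy))

theorem isMax_of_isMin_eT (S : StackData Q R P a b d p dd pp dbar pbar n t) {q : Q}
    (h : IsMin (S.eT q)) : IsMax q :=
  fun _ hy => (S.eT_iff _ _).1 (h ((S.eT_iff _ _).2 hy))

theorem isMin_of_isMax_eT (S : StackData Q R P a b d p dd pp dbar pbar n t) {q : Q}
    (h : IsMax (S.eT q)) : IsMin q :=
  fun _ hy => (S.eT_iff _ _).1 (h ((S.eT_iff _ _).2 hy))

theorem isMin_iff (S : StackData Q R P a b d p dd pp dbar pbar n t)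
    (hQ : QHyps Q a b d p) (hR : RHyps R dd pp dbar pbar) (u : P) :
    IsMin u ↔ u = S.eQ a ∨ u = S.eQ b := by
  obtain ⟨hpa, hda, -, -⟩ := hQ.auto_del_a
  obtain ⟨hpb, hdb, -, -⟩ := hQ.auto_del_b
  obtain ⟨hdp, hpp, -, -⟩ := hR.auto_del_pbar
  obtain ⟨hdd, hpd, -, -⟩ := hR.auto_del_dbar
  constructor
  · intro hu
    have not_dd : ∀ i, ¬ IsMin (S.eR i dd) := fun i h => by
      rcases (hR.min_iff _).1 (S.isMin_of_eR h) with h | h <;> contradiction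
    have not_pp : ∀ i, ¬ IsMin (S.eR i pp) := fun i h => by
      rcases (hR.min_iff _).1 (S.isMin_of_eR h) with h | h <;> contradiction
    rcases S.cover u with ⟨q, rfl⟩ | ⟨⟨i, hi⟩, x, rfl⟩ | ⟨q, rfl⟩
    · rcases (hQ.min_iff _).1 (S.isMin_of_eQ hu) with rfl | rfl <;> simp
    · exfalso
      rcases (hR.min_iff _).1 (S.isMin_of_eR hu) with rfl | rfl <;> cases i
      · rw [← S.id_bot_d] at hu
        rcases (hQ.min_iff _).1 (S.isMin_of_eQ hu) with h | h <;> contradiction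
      · rw [← S.id_mid_d] at hu
        exact not_dd _ hu
      · rw [← S.id_bot_p] at hu
        rcases (hQ.min_iff _).1 (S.isMin_of_eQ hu) with h | h <;> contradiction
      · rw [← S.id_mid_p] at hu
        exact not_pp _ hu
    · exfalso
      have h1 := S.id_top_d
      have h2 := S.id_top_p
      have h3 := not_dd ⟨n - 1, Nat.sub_lt S.hn Nat.one_pos⟩
      have h4 := not_pp ⟨n - 1, Nat.sub_lt S.hn Nat.one_pos⟩
      rw [h1] at h3
      rw [h2] at h4
      rcases (hQ.max_iff _).1 (S.isMax_of_isMin_eT hu) with rfl | rfl <;> cases t <;> simp_all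
  · rintro (rfl | rfl)
    · exact S.isMin_eQ ((hQ.min_iff _).2 (.inl rfl)) hda.symm hpa.symm
    · exact S.isMin_eQ ((hQ.min_iff _).2 (.inr rfl)) hdb.symm hpb.symm

theorem isMax_iff (S : StackData Q R P a b d p dd pp dbar pbar n t)
    (hQ : QHyps Q a b d p) (hR : RHyps R dd pp dbar pbar) (u : P) :
    IsMax u ↔ u = S.eT a ∨ u = S.eT b := by
  obtain ⟨hpa, hda, -, -⟩ := hQ.auto_del_a
  obtain ⟨hpb, hdb, -, -⟩ := hQ.auto_del_b
  obtain ⟨hdp, hpp, -, -⟩ := hR.auto_del_pbar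
  obtain ⟨hdd, hpd, -, -⟩ := hR.auto_del_dbar
  constructor
  · intro hu
    have not_dbar : ∀ i, ¬ IsMax (S.eR i dbar) := fun i h => by
      rcases (hR.max_iff _).1 (S.isMax_of_eR h) with h | h <;> exact absurd h.symm ‹_›
    have not_pbar : ∀ i, ¬ IsMax (S.eR i pbar) := fun i h => by
      rcases (hR.max_iff _).1 (S.isMax_of_eR h) with h | h <;> exact absurd h.symm ‹_›
    have not_d : ¬ IsMax (S.eT d) := fun h => by
      rcases (hQ.min_iff _).1 (S.isMin_of_isMax_eT h) with h | h <;> contradiction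
    have not_p : ¬ IsMax (S.eT p) := fun h => by
      rcases (hQ.min_iff _).1 (S.isMin_of_isMax_eT h) with h | h <;> contradiction
    rcases S.cover u with ⟨q, rfl⟩ | ⟨⟨i, hi⟩, x, rfl⟩ | ⟨q, rfl⟩
    · exfalso
      rcases (hQ.max_iff _).1 (S.isMax_of_eQ hu) with rfl | rfl
      · rw [S.id_bot_d] at hu
        exact not_dbar _ hu
      · rw [S.id_bot_p] at hu
        exact not_pbar _ hu
    · exfalso
      by_cases hin : i + 1 < n
      · rcases (hR.max_iff _).1 (S.isMax_of_eR hu) with rfl | rfl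
        · rw [S.id_mid_d i hin] at hu
          exact not_dbar _ hu
        · rw [S.id_mid_p i hin] at hu
          exact not_pbar _ hu
      · obtain rfl : i = n - 1 := by omega
        rcases (hR.max_iff _).1 (S.isMax_of_eR hu) with rfl | rfl
        · rw [S.id_top_d] at hu
          cases t
          exacts [not_d hu, not_p hu]
        · rw [S.id_top_p] at hu
          cases t
          exacts [not_p hu, not_d hu]
    · rcases (hQ.min_iff _).1 (S.isMin_of_isMax_eT hu) with rfl | rfl <;> simp
  · rintro (rfl | rfl)
    · exact S.isMax_eT ((hQ.min_iff _).2 (.inl rfl)) hda.symm hpa.symm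
    · exact S.isMax_eT ((hQ.min_iff _).2 (.inr rfl)) hdb.symm hpb.symm

/-- Maps of the layers `Q`, `R`, `Q̃` that respect the identifications of two stacks, and that
respect the layer orders away from the point `z` of the first stack. -/
structure CompatibleLayers (S : StackData Q R P a b d p dd pp dbar pbar n t)
    (S' : StackData Q R P' a b d p dd pp dbar pbar n t')
    (z : P) (gQ : Q → Q) (gR : R → R) (gT : Q → Q) : Prop where
  bot_d : S'.eQ (gQ d) = S'.eR ⟨0, S.hn⟩ (gR dbar)
  bot_p : S'.eQ (gQ p) = S'.eR ⟨0, S.hn⟩ (gR pbar)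
  mid_d : ∀ (i : ℕ) (h : i + 1 < n),
    S'.eR ⟨i, Nat.lt_of_succ_lt h⟩ (gR dd) = S'.eR ⟨i + 1, h⟩ (gR dbar)
  mid_p : ∀ (i : ℕ) (h : i + 1 < n),
    S'.eR ⟨i, Nat.lt_of_succ_lt h⟩ (gR pp) = S'.eR ⟨i + 1, h⟩ (gR pbar)
  top_d : S'.eR ⟨n - 1, Nat.sub_lt S.hn Nat.one_pos⟩ (gR dd) = S'.eT (gT (if t then p else d))
  top_p : S'.eR ⟨n - 1, Nat.sub_lt S.hn Nat.one_pos⟩ (gR pp) = S'.eT (gT (if t then d else p))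
  le_Q : ∀ q q', S.eQ q ≠ z → S.eQ q' ≠ z → q ≤ q' → gQ q ≤ gQ q'
  le_R : ∀ x y, x ≤ y → gR x ≤ gR y
  le_T : ∀ q q', S.eT q ≠ z → S.eT q' ≠ z → q ≤ q' → gT q ≤ gT q'
  max_Q : ∀ q, ¬ IsMax q → ¬ IsMax (gQ q)
  max_R : ∀ x, ¬ IsMax x → ¬ IsMax (gR x)
  min_R : ∀ x, ¬ IsMin x → ¬ IsMin (gR x)
  max_T : ∀ q, ¬ IsMax q → ¬ IsMax (gT q)

/-- Compatible layer maps glue to a map of stacks that is monotone away from the extremal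
point `z`. -/
theorem CompatibleLayers.exists_map {S : StackData Q R P a b d p dd pp dbar pbar n t}
    {S' : StackData Q R P' a b d p dd pp dbar pbar n t'} {z : P} {gQ : Q → Q} {gR : R → R}
    {gT : Q → Q} (h : CompatibleLayers S S' z gQ gR gT) (hz : IsMin z ∨ IsMax z) :
    ∃ F : P → P', (∀ q, F (S.eQ q) = S'.eQ (gQ q)) ∧
      (∀ i x, F (S.eR i x) = S'.eR i (gR x)) ∧ (∀ q, F (S.eT q) = S'.eT (gT q)) ∧
      ∀ u v, u ≠ z → v ≠ z → u ≤ v → F u ≤ F v := by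
  have eQ_inj : ∀ x y, S.eQ x = S.eQ y → x = y := fun x y h =>
    le_antisymm ((S.eQ_iff _ _).1 h.le) ((S.eQ_iff _ _).1 h.ge)
  have eR_inj : ∀ i x y, S.eR i x = S.eR i y → x = y := fun i x y h =>
    le_antisymm ((S.eR_iff _ _ _).1 h.le) ((S.eR_iff _ _ _).1 h.ge)
  have eT_inj : ∀ x y, S.eT x = S.eT y → x = y := fun x y h =>
    le_antisymm ((S.eT_iff _ _).1 h.ge) ((S.eT_iff _ _).1 h.le)
  have hQR : ∀ q i x, S.eQ q = S.eR i x → S'.eQ (gQ q) = S'.eR i (gR x) := by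
    intro q i x e
    obtain ⟨rfl, ⟨rfl, rfl⟩ | ⟨rfl, rfl⟩⟩ := S.eQ_meet_eR _ _ _ e
    exacts [h.bot_d, h.bot_p]
  have hRT : ∀ i x q, S.eR i x = S.eT q → S'.eR i (gR x) = S'.eT (gT q) := by
    rintro ⟨i, hi⟩ x q e
    obtain ⟨h1, ⟨rfl, rfl⟩ | ⟨rfl, rfl⟩⟩ := S.eR_meet_eT _ _ _ e <;> obtain rfl : i = n - 1 := h1
    exacts [h.top_d, h.top_p]
  have hRR_lt : ∀ (i j : Fin n) x y, (i : ℕ) < j → S.eR i x = S.eR j y →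
      S'.eR i (gR x) = S'.eR j (gR y) := by
    rintro ⟨i, hi⟩ ⟨j, hj⟩ x y hij e
    obtain ⟨h1, ⟨rfl, rfl⟩ | ⟨rfl, rfl⟩⟩ := S.eR_meet_eR _ _ _ _ hij e <;>
      obtain rfl : j = i + 1 := h1
    exacts [h.mid_d _ _, h.mid_p _ _]
  have hRR : ∀ (i j : Fin n) x y, S.eR i x = S.eR j y → S'.eR i (gR x) = S'.eR j (gR y) := by
    intro i j x y e
    rcases lt_trichotomy (i : ℕ) j with hij | hij | hij
    · exact hRR_lt _ _ _ _ hij e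
    · obtain rfl := Fin.ext hij
      rw [eR_inj _ _ _ e]
    · exact (hRR_lt _ _ _ _ hij e.symm).symm
  have hF : ∀ u, ∃ v, (∀ q, u = S.eQ q → v = S'.eQ (gQ q)) ∧
      (∀ i x, u = S.eR i x → v = S'.eR i (gR x)) ∧ (∀ q, u = S.eT q → v = S'.eT (gT q)) := by
    intro u
    rcases S.cover u with ⟨q, rfl⟩ | ⟨i, x, rfl⟩ | ⟨q, rfl⟩
    · exact ⟨_, fun q' e => by rw [eQ_inj _ _ e], fun i x e => hQR _ _ _ e,
        fun q' e => absurd e (S.eQ_meet_eT _ _)⟩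
    · exact ⟨_, fun q' e => (hQR _ _ _ e.symm).symm, fun j y e => hRR _ _ _ _ e,
        fun q' e => hRT _ _ _ e⟩
    · exact ⟨_, fun q' e => absurd e.symm (S.eQ_meet_eT _ _),
        fun j y e => (hRT _ _ _ e.symm).symm, fun q' e => by rw [eT_inj _ _ e]⟩
  choose F hFQ hFR hFT using hF
  refine ⟨F, fun q => hFQ _ _ rfl, fun i x => hFR _ _ _ rfl, fun q => hFT _ _ rfl, ?_⟩
  intro u v hu hv huv
  rw [S.le_iff] at huv
  induction huv with
  | refl => exact le_rfl
  | @tail w v huw hwv ih =>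
    have huw' := (S.le_iff _ _).2 huw
    have hwv' := (S.le_iff _ _).2 (.single hwv)
    have hw : w ≠ z := by
      rintro rfl
      rcases hz with hz | hz
      exacts [hu (hz.eq_of_le huw'), hv (hz.eq_of_ge hwv')]
    refine (ih hw).trans ?_
    have step := (S'.le_iff (F w) (F v)).2
    rcases hwv with ⟨x, y, hxy, rfl, rfl⟩ | ⟨i, x, y, hxy, rfl, rfl⟩ | ⟨x, y, hxy, rfl, rfl⟩ |
      ⟨x, y, hx, hy, rfl, rfl⟩ | ⟨i, hi, x, y, hx, hy, rfl, rfl⟩ | ⟨x, y, hx, hy, rfl, rfl⟩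
    · rw [hFQ _ _ rfl, hFQ _ _ rfl, S'.eQ_iff]
      exact h.le_Q _ _ hw hv hxy
    · rw [hFR _ _ _ rfl, hFR _ _ _ rfl, S'.eR_iff]
      exact h.le_R _ _ hxy
    · rw [hFT _ _ rfl, hFT _ _ rfl, S'.eT_iff]
      exact h.le_T _ _ hv hw hxy
    · exact step <| .single <| .inr <| .inr <| .inr <| .inl
        ⟨_, _, h.max_Q _ hx, h.min_R _ hy, hFQ _ _ rfl, hFR _ _ _ rfl⟩
    · exact step <| .single <| .inr <| .inr <| .inr <| .inr <| .inl
        ⟨i, hi, _, _, h.max_R _ hx, h.min_R _ hy, hFR _ _ _ rfl, hFR _ _ _ rfl⟩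
    · exact step <| .single <| .inr <| .inr <| .inr <| .inr <| .inr
        ⟨_, _, h.max_R _ hx, h.max_T _ hy, hFR _ _ _ rfl, hFT _ _ rfl⟩

/-- Mutually inverse compatible layer maps glue to a bijection of stacks that is an order
isomorphism away from a pair of corresponding extremal points. -/
theorem CompatibleLayers.exists_equiv {S : StackData Q R P a b d p dd pp dbar pbar n t}
    {S' : StackData Q R P' a b d p dd pp dbar pbar n t'} {z : P} {z' : P'}
    {gQ : Equiv.Perm Q} {gR : Equiv.Perm R} {gT : Equiv.Perm Q}
    (h : CompatibleLayers S S' z gQ gR gT)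
    (h' : CompatibleLayers S' S z' gQ.symm gR.symm gT.symm)
    (hz : IsMin z ∨ IsMax z) (hz' : IsMin z' ∨ IsMax z')
    (hzz' : (∃ q, z = S.eQ q ∧ z' = S'.eQ (gQ q)) ∨ ∃ q, z = S.eT q ∧ z' = S'.eT (gT q)) :
    ∃ F : P ≃ P', (∀ q, F (S.eQ q) = S'.eQ (gQ q)) ∧ (∀ q, F (S.eT q) = S'.eT (gT q)) ∧
      ∀ u v, u ≠ z → v ≠ z → (F u ≤ F v ↔ u ≤ v) := by
  obtain ⟨F, hFQ, hFR, hFT, hF⟩ := h.exists_map hz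
  obtain ⟨G, hGQ, hGR, hGT, hG⟩ := h'.exists_map hz'
  have hGF : ∀ u, G (F u) = u := fun u => by
    rcases S.cover u with ⟨q, rfl⟩ | ⟨i, x, rfl⟩ | ⟨q, rfl⟩ <;> simp [hFQ, hFR, hFT, hGQ, hGR, hGT]
  have hFG : ∀ u, F (G u) = u := fun u => by
    rcases S'.cover u with ⟨q, rfl⟩ | ⟨i, x, rfl⟩ | ⟨q, rfl⟩ <;>
      simp [hFQ, hFR, hFT, hGQ, hGR, hGT]
  have hGz : G z' = z := by
    rcases hzz' with ⟨q, rfl, rfl⟩ | ⟨q, rfl, rfl⟩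
    · simp [hGQ]
    · simp [hGT]
  have hne : ∀ u, u ≠ z → F u ≠ z' := fun u hu e => hu (by rw [← hGF u, e, hGz])
  refine ⟨⟨F, G, hGF, hFG⟩, hFQ, hFT, fun u v hu hv => ⟨fun huv => ?_, hF u v hu hv⟩⟩
  simpa only [Equiv.coe_fn_mk, hGF] using hG _ _ (hne u hu) (hne v hv) huv

end StackData

/-- An automorphism of the card at `c` that swaps `x` and `y` and fixes `e`, extended to a
permutation of the whole set fixing `c`. -/
theorem Card.exists_perm {Q : Type*} [PartialOrder Q] {c e x y : Q} (hy : y ≠ c) (hx : x ≠ c)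
    (he : e ≠ c) (ψ : Card Q c ≃o Card Q c) (h1 : ψ ⟨y, hy⟩ = ⟨x, hx⟩)
    (h2 : ψ ⟨x, hx⟩ = ⟨y, hy⟩) (h3 : ψ ⟨e, he⟩ = ⟨e, he⟩) :
    ∃ g : Equiv.Perm Q, g c = c ∧ g e = e ∧ g x = y ∧ g y = x ∧
      ∀ u v, u ≠ c → v ≠ c → (g u ≤ g v ↔ u ≤ v) := by
  classical
  have key : ∀ u (hu : u ≠ c), Equiv.Perm.ofSubtype ψ.toEquiv u = ψ ⟨u, hu⟩ := fun u hu =>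
    Equiv.Perm.ofSubtype_apply_of_mem (p := fun u => u ≠ c) ψ.toEquiv hu
  refine ⟨Equiv.Perm.ofSubtype ψ.toEquiv,
    Equiv.Perm.ofSubtype_apply_of_not_mem _ (by simp), ?_, ?_, ?_, ?_⟩
  · rw [key e he, h3]
  · rw [key x hx, h2]
  · rw [key y hy, h1]
  · intro u v hu hv
    rw [key u hu, key v hv, Subtype.coe_le_coe, ψ.le_iff_le, Subtype.mk_le_mk]

namespace QHyps

variable {Q : Type*} [PartialOrder Q] {a b d p : Q}

/-- Deleting either minimal point allows a swap of `d` and `p`. -/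
theorem exists_swap (hQ : QHyps Q a b d p) {c : Q} (hc : c = a ∨ c = b) :
    ∃ g : Equiv.Perm Q, g a = a ∧ g b = b ∧ g d = p ∧ g p = d ∧
      ∀ u v, u ≠ c → v ≠ c → (g u ≤ g v ↔ u ≤ v) := by
  rcases hc with rfl | rfl
  · obtain ⟨hp, hd, he, ψ, h1, h2, h3⟩ := hQ.auto_del_a
    exact Card.exists_perm hp hd he ψ h1 h2 h3
  · obtain ⟨hp, hd, he, ψ, h1, h2, h3⟩ := hQ.auto_del_b
    obtain ⟨g, hb, ha, h⟩ := Card.exists_perm hp hd he ψ h1 h2 h3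
    exact ⟨g, ha, hb, h⟩

theorem not_isMax_of_swap (hQ : QHyps Q a b d p) {g : Equiv.Perm Q} (hd : g d = p)
    (hp : g p = d) {q : Q} (hq : ¬ IsMax q) : ¬ IsMax (g q) := by
  rw [hQ.max_iff] at hq ⊢
  rintro (h | h)
  · exact hq (.inr (g.injective (h.trans hp.symm)))
  · exact hq (.inl (g.injective (h.trans hd.symm)))

end QHyps

namespace StackData

variable {Q R P P' : Type*} [PartialOrder Q] [PartialOrder R] [PartialOrder P] [PartialOrder P']
  {a b d p : Q} {dd pp dbar pbar : R} {n : ℕ} {t t' : Bool}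

theorem compatibleLayers_bottom (S : StackData Q R P a b d p dd pp dbar pbar n t)
    (S' : StackData Q R P' a b d p dd pp dbar pbar n t') (htt' : t' = !t)
    (hQ : QHyps Q a b d p) {c : Q} {g : Equiv.Perm Q} (hd : g d = p) (hp : g p = d)
    (hg : ∀ u v, u ≠ c → v ≠ c → u ≤ v → g u ≤ g v) {φ : R ≃o R} (h1 : φ dd = pp)
    (h2 : φ pp = dd) (h3 : φ dbar = pbar) (h4 : φ pbar = dbar) :
    CompatibleLayers S S' (S.eQ c) g φ.toEquiv (Equiv.refl Q) where
  bot_d := by simpa [hd, h3] using S'.id_bot_p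
  bot_p := by simpa [hp, h4] using S'.id_bot_d
  mid_d i h := by simpa [h1, h3] using S'.id_mid_p i h
  mid_p i h := by simpa [h2, h4] using S'.id_mid_d i h
  top_d := by
    subst htt'
    have := S'.id_top_p
    cases t <;> simpa [h1] using this
  top_p := by
    subst htt'
    have := S'.id_top_d
    cases t <;> simpa [h2] using this
  le_Q u v hu hv := hg u v (fun e => hu (by rw [e])) (fun e => hv (by rw [e]))
  le_R x y h := φ.monotone h
  le_T _ _ _ _ h := h
  max_Q _ := hQ.not_isMax_of_swap hd hp
  max_R x h := (φ.isMax_apply).not.2 h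
  min_R x h := (φ.isMin_apply).not.2 h
  max_T _ h := h

theorem compatibleLayers_top (S : StackData Q R P a b d p dd pp dbar pbar n t)
    (S' : StackData Q R P' a b d p dd pp dbar pbar n t') (htt' : t' = !t)
    (hQ : QHyps Q a b d p) {c : Q} {g : Equiv.Perm Q} (hd : g d = p) (hp : g p = d)
    (hg : ∀ u v, u ≠ c → v ≠ c → u ≤ v → g u ≤ g v) :
    CompatibleLayers S S' (S.eT c) (Equiv.refl Q) (Equiv.refl R) g where
  bot_d := S'.id_bot_d
  bot_p := S'.id_bot_p
  mid_d := S'.id_mid_d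
  mid_p := S'.id_mid_p
  top_d := by
    subst htt'
    have := S'.id_top_d
    cases t <;> simpa [hd, hp] using this
  top_p := by
    subst htt'
    have := S'.id_top_p
    cases t <;> simpa [hd, hp] using this
  le_Q _ _ _ _ h := h
  le_R _ _ h := h
  le_T u v hu hv := hg u v (fun e => hu (by rw [e])) (fun e => hv (by rw [e]))
  max_Q _ h := h
  max_R _ h := h
  min_R _ h := h
  max_T _ := hQ.not_isMax_of_swap hd hp

theorem exists_equiv_bottom (S : StackData Q R P a b d p dd pp dbar pbar n t)
    (S' : StackData Q R P' a b d p dd pp dbar pbar n t') (htt' : t' = !t)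
    (hQ : QHyps Q a b d p) (hR : RHyps R dd pp dbar pbar) {c : Q} (hc : c = a ∨ c = b) :
    ∃ F : P ≃ P', F (S.eQ a) = S'.eQ a ∧ F (S.eQ b) = S'.eQ b ∧
      ∀ u v, u ≠ S.eQ c → v ≠ S.eQ c → (F u ≤ F v ↔ u ≤ v) := by
  obtain ⟨g, ha, hb, hd, hp, hg⟩ := hQ.exists_swap hc
  obtain ⟨φ, h1, h2, h3, h4⟩ := hR.auto_swap
  have hgc : g c = c := by rcases hc with rfl | rfl <;> assumption
  have hg' : ∀ u v, u ≠ c → v ≠ c → u ≤ v → g.symm u ≤ g.symm v := fun u v hu hv h => by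
    rw [← hg _ _ (by rwa [Ne, Equiv.symm_apply_eq, hgc]) (by rwa [Ne, Equiv.symm_apply_eq, hgc])]
    simpa using h
  have hz : IsMin (S.eQ c) := (S.isMin_iff hQ hR _).2 (by rcases hc with rfl | rfl <;> simp)
  have hz' : IsMin (S'.eQ c) := (S'.isMin_iff hQ hR _).2 (by rcases hc with rfl | rfl <;> simp)
  have key := S.compatibleLayers_bottom S' htt' hQ hd hp
    (fun u v hu hv => (hg u v hu hv).2) h1 h2 h3 h4
  have key' := S'.compatibleLayers_bottom S (by simp [htt']) hQ (c := c) (g := g.symm) (φ := φ.symm)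
    (by simp [Equiv.symm_apply_eq, hp]) (by simp [Equiv.symm_apply_eq, hd]) hg'
    (by simp [OrderIso.symm_apply_eq, h2]) (by simp [OrderIso.symm_apply_eq, h1])
    (by simp [OrderIso.symm_apply_eq, h4]) (by simp [OrderIso.symm_apply_eq, h3])
  obtain ⟨F, hFQ, -, hF⟩ := key.exists_equiv key' (.inl hz) (.inl hz')
    (.inl ⟨c, rfl, by rw [hgc]⟩)
  exact ⟨F, by rw [hFQ, ha], by rw [hFQ, hb], hF⟩

theorem exists_equiv_top (S : StackData Q R P a b d p dd pp dbar pbar n t)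
    (S' : StackData Q R P' a b d p dd pp dbar pbar n t') (htt' : t' = !t)
    (hQ : QHyps Q a b d p) (hR : RHyps R dd pp dbar pbar) {c : Q} (hc : c = a ∨ c = b) :
    ∃ F : P ≃ P', F (S.eT a) = S'.eT a ∧ F (S.eT b) = S'.eT b ∧
      ∀ u v, u ≠ S.eT c → v ≠ S.eT c → (F u ≤ F v ↔ u ≤ v) := by
  obtain ⟨g, ha, hb, hd, hp, hg⟩ := hQ.exists_swap hc
  have hgc : g c = c := by rcases hc with rfl | rfl <;> assumption
  have hg' : ∀ u v, u ≠ c → v ≠ c → u ≤ v → g.symm u ≤ g.symm v := fun u v hu hv h => by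
    rw [← hg _ _ (by rwa [Ne, Equiv.symm_apply_eq, hgc]) (by rwa [Ne, Equiv.symm_apply_eq, hgc])]
    simpa using h
  have hz : IsMax (S.eT c) := (S.isMax_iff hQ hR _).2 (by rcases hc with rfl | rfl <;> simp)
  have hz' : IsMax (S'.eT c) := (S'.isMax_iff hQ hR _).2 (by rcases hc with rfl | rfl <;> simp)
  have key := S.compatibleLayers_top S' htt' hQ hd hp (fun u v hu hv => (hg u v hu hv).2)
  have key' := S'.compatibleLayers_top S (by simp [htt']) hQ (c := c) (g := g.symm)
    (by simp [Equiv.symm_apply_eq, hp]) (by simp [Equiv.symm_apply_eq, hd]) hg'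
  obtain ⟨F, -, hFT, hF⟩ := key.exists_equiv key' (.inr hz) (.inr hz')
    (.inr ⟨c, rfl, by rw [hgc]⟩)
  exact ⟨F, by rw [hFT, ha], by rw [hFT, hb], hF⟩

end StackData

/-- If the points satisfying `M`, respectively `M'`, are `x, y`, respectively `x', y'`, and for
each `c ∈ {x, y}` some bijection with `x ↦ x'`, `y ↦ y'` is an isomorphism away from `c`, then the
decks of cards at these points agree, with marked points preserved. -/
theorem exists_marked_deck_equiv {P P' : Type*} [PartialOrder P] [PartialOrder P']
    {M : P → Prop} {M' : P' → Prop} {x y : P} {x' y' : P'}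
    (hM : ∀ u, M u ↔ u = x ∨ u = y) (hM' : ∀ u, M' u ↔ u = x' ∨ u = y')
    (h : ∀ c, c = x ∨ c = y → ∃ F : P ≃ P', F x = x' ∧ F y = y' ∧
      ∀ u v, u ≠ c → v ≠ c → (F u ≤ F v ↔ u ≤ v)) :
    ∃ σ : {u // M u} ≃ {u // M' u}, ∀ m : {u // M u},
      ∃ Φ : Card P m.val ≃o Card P' (σ m).val, ∀ z, M z.val → M' (Φ z).val := by
  have hFM : ∀ F : P ≃ P', F x = x' → F y = y' → ∀ u, M u ↔ M' (F u) := by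
    rintro F rfl rfl u
    simp [hM, hM']
  obtain ⟨F₀, hx₀, hy₀, -⟩ := h x (.inl rfl)
  refine ⟨F₀.subtypeEquiv (hFM F₀ hx₀ hy₀), fun ⟨m, hm⟩ => ?_⟩
  obtain ⟨F, hx, hy, hF⟩ := h m ((hM m).1 hm)
  have hm' : F m = F₀ m := by
    rcases (hM m).1 hm with rfl | rfl
    exacts [hx.trans hx₀.symm, hy.trans hy₀.symm]
  exact ⟨⟨F.subtypeEquiv fun u => by simp [← hm'], fun {u v} => hF u v u.2 v.2⟩,
    fun z hz => (hFM F hx hy z).1 hz⟩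

/--
With `Q`, `R`, `n`, and the stacked ordered sets `P1` and `P2` as in the construction,
`P1` and `P2` have equal marked maximal decks and equal marked minimal decks.
-/
theorem stacked_sets_equal_marked_extremal_decks
    {Q R P1 P2 : Type*} [PartialOrder Q] [Fintype Q] [PartialOrder R] [Fintype R]
    [PartialOrder P1] [Fintype P1] [PartialOrder P2] [Fintype P2]
    {a b d p : Q} {dd pp dbar pbar : R} {n : ℕ}
    (hQ : QHyps Q a b d p) (hR : RHyps R dd pp dbar pbar)
    (S1 : StackData Q R P1 a b d p dd pp dbar pbar n false)
    (S2 : StackData Q R P2 a b d p dd pp dbar pbar n true) :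
    EqualMarkedMaxDecks P1 P2 ∧ EqualMarkedMinDecks P1 P2 := by
  refine ⟨exists_marked_deck_equiv (S1.isMax_iff hQ hR) (S2.isMax_iff hQ hR) ?_,
    exists_marked_deck_equiv (S1.isMin_iff hQ hR) (S2.isMin_iff hQ hR) ?_⟩
  · rintro c (rfl | rfl)
    exacts [S1.exists_equiv_top S2 rfl hQ hR (.inl rfl), S1.exists_equiv_top S2 rfl hQ hR (.inr rfl)]
  · rintro c (rfl | rfl)
    exacts [S1.exists_equiv_bottom S2 rfl hQ hR (.inl rfl),
      S1.exists_equiv_bottom S2 rfl hQ hR (.inr rfl)]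
end

section
/- With Q, R, n, and the stacked ordered sets P1 and P2 as in the construction described in the context: for each i=0,…,n the card P1∖{d_i} is order-isomorphic to the card P2∖{d_i} and the card P1∖{p_i} is order-isomorphic to the card P2∖{p_i}, and these isomorphisms Φ can be chosen so that rank_{P2}(Φ(x)) = rank_{P1}(x) for all x; moreover, for every element x ∈ {a, b, ã, b̃, d_0, p_0, …, d_n, p_n} the neighborhood ↕_{P1}x is order-isomorphic to the neighborhood ↕_{P2}x. -/
/-- A relational partial isomorphism between `A` and `B` with domain `X` and codomain `Y`. -/
structure PartialOrderIso {A B : Type*} [PartialOrder A] [PartialOrder B] (g : A → B → Prop)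
    (X : A → Prop) (Y : B → Prop) : Prop where
  dom : ∀ u, X u ↔ ∃ v, g u v
  cod : ∀ v, Y v ↔ ∃ u, g u v
  le_iff : ∀ {u v u' v'}, g u v → g u' v' → (u ≤ u' ↔ v ≤ v')

namespace PartialOrderIso

variable {A B : Type*} [PartialOrder A] [PartialOrder B] {g : A → B → Prop}
  {X : A → Prop} {Y : B → Prop}

theorem flip (h : PartialOrderIso g X Y) : PartialOrderIso (flip g) Y X where
  dom := h.cod
  cod := h.dom
  le_iff h1 h2 := (h.le_iff h1 h2).symm

theorem right_unique (h : PartialOrderIso g X Y) {u v v'} (h1 : g u v) (h2 : g u v') : v = v' :=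
  le_antisymm ((h.le_iff h1 h2).1 le_rfl) ((h.le_iff h2 h1).1 le_rfl)

theorem left_unique (h : PartialOrderIso g X Y) {u u' v} (h1 : g u v) (h2 : g u' v) : u = u' :=
  h.flip.right_unique h1 h2

theorem exists_orderIso (h : PartialOrderIso g X Y) :
    ∃ Φ : {u // X u} ≃o {v // Y v}, ∀ u, g u.1 (Φ u).1 := by
  choose f hf using fun u : {u // X u} => (h.dom u).1 u.2
  choose f' hf' using fun v : {v // Y v} => (h.cod v).1 v.2
  refine ⟨⟨⟨fun u => ⟨f u, (h.cod _).2 ⟨_, hf u⟩⟩, fun v => ⟨f' v, (h.dom _).2 ⟨_, hf' v⟩⟩,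
    fun u => Subtype.ext (h.left_unique (hf' _) (hf u)),
    fun v => Subtype.ext (h.right_unique (hf _) (hf' v))⟩, ?_⟩, hf⟩
  intro u u'
  exact (h.le_iff (hf u) (hf u')).symm

theorem of_eq : PartialOrderIso (fun u v : A => u = v) (fun _ => True) (fun _ => True) where
  dom u := by simp
  cod u := by simp
  le_iff := by rintro _ _ _ _ rfl rfl; rfl

theorem of_orderIso (e : A ≃o B) :
    PartialOrderIso (fun u v => e u = v) (fun _ => True) (fun _ => True) where
  dom u := by simp
  cod v := ⟨fun _ => ⟨e.symm v, by simp⟩, fun _ => trivial⟩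
  le_iff := by rintro _ _ _ _ rfl rfl; simp

end PartialOrderIso

/-- The graph of an order isomorphism between two cards. -/
def cardRel {A B : Type*} [PartialOrder A] [PartialOrder B] {x : A} {y : B}
    (e : Card A x ≃o Card B y) (u : A) (v : B) : Prop :=
  ∃ (hu : u ≠ x) (hv : v ≠ y), e ⟨u, hu⟩ = ⟨v, hv⟩

theorem PartialOrderIso.of_card {A B : Type*} [PartialOrder A] [PartialOrder B] {x : A} {y : B}
    (e : Card A x ≃o Card B y) : PartialOrderIso (cardRel e) (· ≠ x) (· ≠ y) where
  dom u := ⟨fun h => ⟨(e ⟨u, h⟩).1, h, (e ⟨u, h⟩).2, rfl⟩, fun ⟨_, h, _⟩ => h⟩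
  cod v := ⟨fun h => ⟨(e.symm ⟨v, h⟩).1, (e.symm ⟨v, h⟩).2, h, by simp⟩, fun ⟨_, _, h, _⟩ => h⟩
  le_iff := by
    rintro u v u' v' ⟨h1, h2, h3⟩ ⟨h1', h2', h3'⟩
    change (⟨u, h1⟩ : Card A x) ≤ ⟨u', h1'⟩ ↔ (⟨v, h2⟩ : Card B y) ≤ ⟨v', h2'⟩
    rw [← h3, ← h3', e.le_iff_le]

theorem cardRel_symm {A B : Type*} [PartialOrder A] [PartialOrder B] {x : A} {y : B}
    {e : Card A x ≃o Card B y} {u : A} {v : B} (h : cardRel e u v) : cardRel e.symm v u := by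
  obtain ⟨h1, h2, h3⟩ := h
  exact ⟨h2, h1, by rw [← h3, e.symm_apply_apply]⟩

theorem cardRel_refl {A : Type*} [PartialOrder A] {x u : A} (h : u ≠ x) :
    cardRel (OrderIso.refl (Card A x)) u u := ⟨h, h, rfl⟩

theorem height_le_of_forall_lt {A : Type*} [PartialOrder A] {x : A} {m : ℕ∞}
    (h : ∀ y < x, Order.height y + 1 ≤ m) : Order.height x ≤ m := by
  rw [Order.height_eq_iSup_lt_height]
  exact iSup₂_le h

theorem height_embedding_eq_add {L P : Type*} [PartialOrder L] [Finite L] [PartialOrder P]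
    (e : L → P) (he : ∀ x y, e x ≤ e y ↔ x ≤ y) (H : ℕ∞)
    (hmin : ∀ x, IsMin x → Order.height (e x) = H)
    (hlt : ∀ x z, ¬ IsMin x → z < e x → (∃ y, z = e y) ∨ Order.height z + 1 ≤ H) (x : L) :
    Order.height (e x) = H + Order.height x := by
  have he' : ∀ x y, e x < e y ↔ x < y := fun x y => by
    rw [lt_iff_le_not_ge, lt_iff_le_not_ge, he, he]
  induction x using (wellFounded_lt (α := L)).induction with
  | _ x ih =>
  by_cases hx : IsMin x
  · rw [hmin x hx, Order.height_eq_zero.2 hx, add_zero]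
  apply le_antisymm
  · refine height_le_of_forall_lt fun z hz => ?_
    rcases hlt x z hx hz with ⟨y, rfl⟩ | h
    · rw [he'] at hz
      rw [ih y hz, add_assoc]
      gcongr
      exact Order.height_add_one_le hz
    · exact h.trans le_self_add
  · obtain ⟨y₀, hy₀⟩ := not_isMin_iff.1 hx
    have : Nonempty {y // y < x} := ⟨⟨y₀, hy₀⟩⟩
    rw [Order.height_eq_iSup_lt_height x, iSup_subtype', ENat.add_iSup]
    refine iSup_le fun y => ?_
    rw [← add_assoc, ← ih y y.2]
    exact Order.height_add_one_le ((he' _ _).2 y.2)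

/-- If every point above `x` is sent above some point of the height of `x`, then an isomorphism
of cards does not decrease heights. -/
theorem height_le_height_card_iso {A B : Type*} [PartialOrder A] [Finite A] [PartialOrder B]
    {x : A} {y : B} (Φ : Card A x ≃o Card B y)
    (h : ∀ z : Card A x, x < z.1 → ∃ u < (Φ z).1, Order.height u = Order.height x)
    (z : Card A x) : Order.height z.1 ≤ Order.height (Φ z).1 := by
  have : ∀ (z : A) (hz : z ≠ x), Order.height z ≤ Order.height (Φ ⟨z, hz⟩).1 := by
    intro z
    induction z using (wellFounded_lt (α := A)).induction with
    | _ z ih =>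
    intro hz
    refine height_le_of_forall_lt fun w hw => ?_
    by_cases hwx : w = x
    · obtain ⟨u, hu, hu'⟩ := h ⟨z, hz⟩ (hwx ▸ hw)
      rw [hwx]
      rw [← hu']
      exact Order.height_add_one_le hu
    · refine (add_le_add_left (ih w hw hwx) 1).trans (Order.height_add_one_le ?_)
      have : Φ ⟨w, hwx⟩ < Φ ⟨z, hz⟩ := Φ.lt_iff_lt.2 hw
      exact this
  exact this z.1 z.2

theorem nonempty_nbhd_orderIso {A B : Type*} [PartialOrder A] [PartialOrder B] {x u : A} {y v : B}
    (Φ : Card A x ≃o Card B y) (hux : ¬ u ≤ x) (hxu : ¬ x ≤ u) (hvy : ¬ v ≤ y) (hyv : ¬ y ≤ v)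
    (h : cardRel Φ u v) : Nonempty (Nbhd A u ≃o Nbhd B v) := by
  have key := PartialOrderIso.of_card Φ
  have : PartialOrderIso (fun s t => cardRel Φ s t ∧ (s ≤ u ∨ u ≤ s))
      (fun s => s ≤ u ∨ u ≤ s) (fun t => t ≤ v ∨ v ≤ t) := by
    refine ⟨fun s => ⟨fun hs => ?_, fun ⟨_, h⟩ => h.2⟩, fun t => ⟨fun ht => ?_, ?_⟩,
      fun h1 h2 => key.le_iff h1.1 h2.1⟩
    · obtain ⟨t, ht⟩ := (key.dom s).1 (by rintro rfl; tauto)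
      exact ⟨t, ht, hs⟩
    · obtain ⟨s, hs⟩ := (key.cod t).1 (by rintro rfl; tauto)
      exact ⟨s, hs, by rwa [key.le_iff hs h, key.le_iff h hs]⟩
    · rintro ⟨s, hs, hs'⟩
      rwa [key.le_iff hs h, key.le_iff h hs] at hs'
  obtain ⟨Φ', -⟩ := this.exists_orderIso
  exact ⟨Φ'⟩

/-- A decomposition of an ordered set into layers `0, …, n + 1`, where consecutive layers `k` and
`k + 1` meet exactly in the two points `cut k true` and `cut k false`, which are maximal in layer
`k` and minimal in layer `k + 1`. -/
structure Layering (P : Type*) [PartialOrder P] (n : ℕ) (mem : ℕ → P → Prop)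
    (cut : ℕ → Bool → P) : Prop where
  ex : ∀ z, ∃ k, mem k z
  bound : ∀ {k z}, mem k z → k ≤ n + 1
  adj : ∀ {k l z}, mem k z → mem l z → k < l → l = k + 1 ∧ ∃ b, z = cut k b
  cut_mem : ∀ {k} b, k ≤ n → mem k (cut k b)
  cut_mem' : ∀ {k} b, k ≤ n → mem (k + 1) (cut k b)
  cut_max : ∀ {k b u}, k ≤ n → mem k u → cut k b ≤ u → u = cut k b
  cut_min : ∀ {k b u}, k ≤ n → mem (k + 1) u → u ≤ cut k b → u = cut k b
  cut_ne : ∀ {k b b'}, k ≤ n → cut k b = cut k b' → b = b'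
  above : ∀ {k w}, k ≤ n → mem (k + 1) w → ∃ b, cut k b ≤ w
  below : ∀ {k w}, k ≤ n → mem k w → ∃ b, w ≤ cut k b
  step : ∀ {k z w}, mem k z → ¬ mem (k + 1) z → mem (k + 1) w → ¬ mem k w → z ≤ w
  gen : ∀ {z w}, z ≤ w → Relation.ReflTransGen (fun u v => u ≤ v ∧
    ((∃ k, mem k u ∧ mem k v) ∨
      ∃ k, mem k u ∧ ¬ mem (k + 1) u ∧ mem (k + 1) v ∧ ¬ mem k v)) z w

namespace Layering

variable {P : Type*} [PartialOrder P] {n : ℕ} {mem : ℕ → P → Prop} {cut : ℕ → Bool → P}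

theorem le_of_lt_index (L : Layering P n mem cut) {z w : P}
    (h : ∀ k l, mem k z → mem l w → k < l) : z ≤ w := by
  have main : ∀ (m k : ℕ) (w : P), mem k z → ¬ mem (k + 1) z → mem (k + 1 + m) w →
      ¬ mem (k + m) w → z ≤ w := by
    intro m
    induction m with
    | zero => exact fun k w h1 h2 h3 h4 => L.step h1 h2 h3 h4
    | succ m ih =>
      intro k w h1 h2 h3 h4
      have hb := L.bound h3
      have h3' : mem (k + m + 1 + 1) w := by convert h3 using 1; omega
      obtain ⟨b, hbw⟩ := L.above (by omega) h3'
      refine (ih k _ h1 h2 ?_ ?_).trans hbw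
      · convert L.cut_mem (k := k + m + 1) b (by omega) using 1; omega
      · intro hc
        have := (L.adj hc (L.cut_mem' (k := k + m + 1) b (by omega)) (by omega)).1
        omega
  obtain ⟨k, hk⟩ := L.ex z
  obtain ⟨l, hl⟩ := L.ex w
  obtain ⟨k, hk, hk'⟩ : ∃ k, mem k z ∧ ¬ mem (k + 1) z := by
    by_cases hc : mem (k + 1) z
    · exact ⟨k + 1, hc, fun hd => by have := (L.adj hk hd (by omega)).1; omega⟩
    · exact ⟨k, hk, hc⟩
  obtain ⟨l, hl, hl'⟩ : ∃ l, mem l w ∧ ∀ j, j + 1 = l → ¬ mem j w := by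
    by_cases hc : ∃ j, j + 1 = l ∧ mem j w
    · obtain ⟨j, rfl, hj⟩ := hc
      exact ⟨j, hj, fun i hi hd => by have := (L.adj hd hl (by omega)).1; omega⟩
    · exact ⟨l, hl, fun j hj hd => hc ⟨j, hj, hd⟩⟩
  have := h k l hk hl
  obtain ⟨m, rfl⟩ := Nat.exists_eq_add_of_lt this
  exact main m k w hk hk' (by convert hl using 1; omega) (hl' _ rfl)

theorem max_unique (L : Layering P n mem cut) {k : ℕ} {z u : P} (h1 : mem k z)
    (h2 : mem (k + 1) z) (h3 : mem k u) (h : z ≤ u) : u = z := by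
  obtain ⟨b, rfl⟩ := (L.adj h1 h2 (by omega)).2
  exact L.cut_max (by have := L.bound h2; omega) h3 h

theorem min_unique (L : Layering P n mem cut) {k : ℕ} {z u : P} (h1 : mem k z)
    (h2 : mem (k + 1) z) (h3 : mem (k + 1) u) (h : u ≤ z) : u = z := by
  obtain ⟨b, rfl⟩ := (L.adj h1 h2 (by omega)).2
  exact L.cut_min (by have := L.bound h2; omega) h3 h

theorem index_le (L : Layering P n mem cut) {k l : ℕ} {z : P} (h1 : mem k z) (h2 : mem l z) :
    l ≤ k + 1 := by
  by_contra hc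
  have := (L.adj h1 h2 (by omega)).1
  omega

theorem le_cases (L : Layering P n mem cut) {z w : P} (h : z ≤ w) :
    (∃ k, mem k z ∧ mem k w) ∨ ∀ k l, mem k z → mem l w → k < l := by
  suffices h : z ≤ w ∧ ((∃ k, mem k z ∧ mem k w) ∨ ∀ k l, mem k z → mem l w → k < l) from h.2
  replace h := L.gen h
  induction h with
  | refl => exact ⟨le_rfl, Or.inl ((L.ex z).imp fun k hk => ⟨hk, hk⟩)⟩
  | @tail u w _ huw ih =>
    obtain ⟨huw, hs⟩ := huw
    obtain ⟨hzu, ih⟩ := ih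
    refine ⟨hzu.trans huw, ?_⟩
    replace hs : (∃ k, mem k u ∧ mem k w) ∨ ∀ k l, mem k u → mem l w → k < l := by
      refine hs.imp_right ?_
      rintro ⟨k, h1, h2, h3, h4⟩ i j hi hj
      have hi' := L.index_le h1 hi
      have hj' := L.index_le hj h3
      have : i ≠ k + 1 := by rintro rfl; exact h2 hi
      have : j ≠ k := by rintro rfl; exact h4 hj
      omega
    rcases ih with ⟨k, hk, hk'⟩ | ih
    · rcases hs with ⟨l, hl, hl'⟩ | hs
      · by_cases hkl : k = l
        · subst hkl; exact Or.inl ⟨k, hk, hl'⟩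
        rcases lt_or_gt_of_ne hkl with hkl | hkl
        · obtain rfl := (L.adj hk' hl hkl).1
          by_cases h1 : mem (k + 1) z
          · exact Or.inl ⟨_, h1, hl'⟩
          by_cases h2 : mem k w
          · exact Or.inl ⟨_, hk, h2⟩
          refine Or.inr fun i j hi hj => ?_
          have hi' := L.index_le hk hi
          have hj' := L.index_le hj hl'
          have : i ≠ k + 1 := by rintro rfl; exact h1 hi
          have : j ≠ k := by rintro rfl; exact h2 hj
          omega
        · obtain rfl := (L.adj hl hk' hkl).1
          have := L.min_unique hl hk' hk hzu
          subst this
          exact Or.inl ⟨l, hl, hl'⟩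
      · by_cases h1 : ∃ j, k < j ∧ mem j z
        · obtain ⟨j, hj, hj'⟩ := h1
          obtain rfl := (L.adj hk hj' hj).1
          have := L.max_unique hk hj' hk' hzu
          subst this
          exact Or.inr hs
        · refine Or.inr fun i j hi hj => lt_of_le_of_lt ?_ (hs k j hk' hj)
          by_contra hc
          exact h1 ⟨i, by omega, hi⟩
    · rcases hs with ⟨l, hl, hl'⟩ | hs
      · by_cases h1 : ∃ j, j < l ∧ mem j w
        · obtain ⟨j, hj, hj'⟩ := h1
          obtain rfl := (L.adj hj' hl' hj).1
          have := L.min_unique hj' hl' hl huw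
          subst this
          exact Or.inr ih
        · refine Or.inr fun i j hi hj => lt_of_lt_of_le (ih i l hi hl) ?_
          by_contra hc
          exact h1 ⟨j, by omega, hj⟩
      · obtain ⟨m, hm⟩ := L.ex u
        exact Or.inr fun i j hi hj => (ih i m hi hm).trans (hs m j hm hj)

theorem eq_or_eq_of_mem_cut (L : Layering P n mem cut) {k l : ℕ} {b : Bool} (hk : k ≤ n)
    (h : mem l (cut k b)) : l = k ∨ l = k + 1 := by
  have h1 := L.index_le (L.cut_mem b hk) h
  have h2 := L.index_le h (L.cut_mem' b hk)
  omega

theorem lt_index_of_cut_lt (L : Layering P n mem cut) {k : ℕ} {b : Bool} {y : P} (hk : k ≤ n)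
    (h : cut k b < y) : ∀ l, mem l y → k < l := by
  have h0 : ¬ mem k y := fun hc => h.ne' (L.cut_max hk hc h.le)
  intro l hl
  rcases L.le_cases h.le with ⟨i, hi, hi'⟩ | h
  · rcases L.eq_or_eq_of_mem_cut hk hi with rfl | rfl
    · exact absurd hi' h0
    · have := L.index_le hl hi'
      have : l ≠ k := by rintro rfl; exact h0 hl
      omega
  · exact h k l (L.cut_mem b hk) hl

theorem exists_cut_lt (L : Layering P n mem cut) {k : ℕ} {y : P} (hk : k ≤ n)
    (h : ∀ l, mem l y → k < l) : ∃ b, cut k b < y := by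
  have hne : ∀ b, cut k b ≠ y := by
    rintro b rfl
    exact lt_irrefl _ (h k (L.cut_mem b hk))
  by_cases h1 : mem (k + 1) y
  · obtain ⟨b, hb⟩ := L.above hk h1
    exact ⟨b, lt_of_le_of_ne hb (hne b)⟩
  · refine ⟨true, lt_of_le_of_ne (L.le_of_lt_index fun i j hi hj => ?_) (hne true)⟩
    have := L.eq_or_eq_of_mem_cut hk hi
    have := h j hj
    have : j ≠ k + 1 := by rintro rfl; exact h1 hj
    omega

theorem exists_lt_cut (L : Layering P n mem cut) {k : ℕ} {y : P} (hk : k ≤ n)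
    (h : ∀ l, mem l y → l ≤ k) : ∃ b, y < cut k b := by
  have hne : ∀ b, y ≠ cut k b := by
    rintro b rfl
    have := h (k + 1) (L.cut_mem' b hk)
    omega
  by_cases h1 : mem k y
  · obtain ⟨b, hb⟩ := L.below hk h1
    exact ⟨b, lt_of_le_of_ne hb (hne b)⟩
  · refine ⟨true, lt_of_le_of_ne (L.le_of_lt_index fun i j hi hj => ?_) (hne true)⟩
    have := L.eq_or_eq_of_mem_cut hk hj
    have := h i hi
    have : i ≠ k := by rintro rfl; exact h1 hi
    omega

theorem not_cut_le_cut (L : Layering P n mem cut) {k : ℕ} {b : Bool} (hk : k ≤ n) :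
    ¬ cut k b ≤ cut k !b := fun h => by
  simpa using L.cut_ne hk (L.cut_max hk (L.cut_mem _ hk) h)

end Layering

/-- A family of relations between corresponding layers of two layered ordered sets, which are
isomorphisms of the layers with the points `x` and `y` removed and which agree on the points shared
by consecutive layers. -/
structure LayerRel {P₁ P₂ : Type*} [PartialOrder P₁] [PartialOrder P₂] (n : ℕ)
    (mem₁ : ℕ → P₁ → Prop) (cut₁ : ℕ → Bool → P₁) (mem₂ : ℕ → P₂ → Prop) (cut₂ : ℕ → Bool → P₂)
    (G : ℕ → P₁ → P₂ → Prop) (x : P₁) (y : P₂) : Prop where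
  mem_left : ∀ {k z w}, G k z w → mem₁ k z
  mem_right : ∀ {k z w}, G k z w → mem₂ k w
  ne_left : ∀ {k z w}, G k z w → z ≠ x
  ne_right : ∀ {k z w}, G k z w → w ≠ y
  total_left : ∀ {k z}, mem₁ k z → z ≠ x → ∃ w, G k z w
  total_right : ∀ {k w}, mem₂ k w → w ≠ y → ∃ z, G k z w
  le_iff : ∀ {k z w z' w'}, G k z w → G k z' w' → (z ≤ z' ↔ w ≤ w')
  cut_left : ∀ {k b w}, k ≤ n → (G k (cut₁ k b) w ↔ G (k + 1) (cut₁ k b) w)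
  cut_right : ∀ {k b z}, k ≤ n → (G k z (cut₂ k b) ↔ G (k + 1) z (cut₂ k b))

namespace LayerRel

variable {P₁ P₂ : Type*} [PartialOrder P₁] [PartialOrder P₂] {n : ℕ}
  {mem₁ : ℕ → P₁ → Prop} {cut₁ : ℕ → Bool → P₁} {mem₂ : ℕ → P₂ → Prop} {cut₂ : ℕ → Bool → P₂}
  {G : ℕ → P₁ → P₂ → Prop} {x : P₁} {y : P₂}

theorem flip (h : LayerRel n mem₁ cut₁ mem₂ cut₂ G x y) :
    LayerRel n mem₂ cut₂ mem₁ cut₁ (fun k => flip (G k)) y x where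
  mem_left := h.mem_right
  mem_right := h.mem_left
  ne_left := h.ne_right
  ne_right := h.ne_left
  total_left := h.total_right
  total_right := h.total_left
  le_iff h1 h2 := (h.le_iff h1 h2).symm
  cut_left := h.cut_right
  cut_right := h.cut_left

theorem of_mem_left (h : LayerRel n mem₁ cut₁ mem₂ cut₂ G x y) (L₁ : Layering P₁ n mem₁ cut₁)
    {k l : ℕ} {z : P₁} {w : P₂} (hk : G k z w) (hl : mem₁ l z) : G l z w := by
  rcases lt_trichotomy k l with hkl | rfl | hkl
  · obtain ⟨rfl, b, rfl⟩ := L₁.adj (h.mem_left hk) hl hkl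
    exact (h.cut_left (by have := L₁.bound hl; omega)).1 hk
  · exact hk
  · obtain ⟨rfl, b, rfl⟩ := L₁.adj hl (h.mem_left hk) hkl
    exact (h.cut_left (by have := L₁.bound (h.mem_left hk); omega)).2 hk

theorem mem_iff (h : LayerRel n mem₁ cut₁ mem₂ cut₂ G x y) (L₁ : Layering P₁ n mem₁ cut₁)
    (L₂ : Layering P₂ n mem₂ cut₂) {k l : ℕ} {z : P₁} {w : P₂} (hk : G k z w) :
    mem₁ l z ↔ mem₂ l w :=
  ⟨fun hl => h.mem_right (h.of_mem_left L₁ hk hl),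
    fun hl => h.mem_left (h.flip.of_mem_left L₂ hk hl)⟩

theorem le_of_le (h : LayerRel n mem₁ cut₁ mem₂ cut₂ G x y) (L₁ : Layering P₁ n mem₁ cut₁)
    (L₂ : Layering P₂ n mem₂ cut₂) {k k' : ℕ} {z z' : P₁} {w w' : P₂} (hk : G k z w)
    (hk' : G k' z' w') (hz : z ≤ z') : w ≤ w' := by
  rcases L₁.le_cases hz with ⟨l, hl, hl'⟩ | hz
  · exact (h.le_iff (h.of_mem_left L₁ hk hl) (h.of_mem_left L₁ hk' hl')).1 hz
  · refine L₂.le_of_lt_index fun i j hi hj => hz i j ?_ ?_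
    · exact (h.mem_iff L₁ L₂ hk).2 hi
    · exact (h.mem_iff L₁ L₂ hk').2 hj

theorem exists_orderIso (h : LayerRel n mem₁ cut₁ mem₂ cut₂ G x y)
    (L₁ : Layering P₁ n mem₁ cut₁) (L₂ : Layering P₂ n mem₂ cut₂) :
    ∃ Φ : Card P₁ x ≃o Card P₂ y, (∀ z l, mem₁ l z.1 ↔ mem₂ l (Φ z).1) ∧
      ∀ k z w, G k z w → cardRel Φ z w := by
  have key : PartialOrderIso (fun z w => ∃ k, G k z w) (· ≠ x) (· ≠ y) := by
    refine ⟨fun z => ⟨fun hz => ?_, fun ⟨w, k, hk⟩ => h.ne_left hk⟩,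
      fun w => ⟨fun hw => ?_, fun ⟨w, k, hk⟩ => h.ne_right hk⟩, ?_⟩
    · obtain ⟨k, hk⟩ := L₁.ex z
      obtain ⟨w, hw⟩ := h.total_left hk hz
      exact ⟨w, k, hw⟩
    · obtain ⟨k, hk⟩ := L₂.ex w
      obtain ⟨z, hz⟩ := h.total_right hk hw
      exact ⟨z, k, hz⟩
    · rintro z w z' w' ⟨k, hk⟩ ⟨k', hk'⟩
      exact ⟨h.le_of_le L₁ L₂ hk hk', h.flip.le_of_le L₂ L₁ hk hk'⟩
  obtain ⟨Φ, hΦ⟩ := key.exists_orderIso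
  refine ⟨Φ, fun z l => ?_, fun k z w hk => ?_⟩
  · obtain ⟨k, hk⟩ := hΦ z
    exact h.mem_iff L₁ L₂ hk
  · exact ⟨h.ne_left hk, h.ne_right hk, Subtype.ext (key.right_unique (hΦ _) ⟨k, hk⟩)⟩

end LayerRel

theorem Layering.height_card_iso {P₁ P₂ : Type*} [PartialOrder P₁] [PartialOrder P₂]
    [Finite P₁] [Finite P₂] {n : ℕ}
    {mem₁ : ℕ → P₁ → Prop} {cut₁ : ℕ → Bool → P₁} {mem₂ : ℕ → P₂ → Prop} {cut₂ : ℕ → Bool → P₂}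
    (L₁ : Layering P₁ n mem₁ cut₁) (L₂ : Layering P₂ n mem₂ cut₂) {k : ℕ} (hk : k ≤ n) {H : ℕ∞}
    (h₁ : ∀ b, Order.height (cut₁ k b) = H) (h₂ : ∀ b, Order.height (cut₂ k b) = H) {b b' : Bool}
    (Φ : Card P₁ (cut₁ k b) ≃o Card P₂ (cut₂ k b'))
    (hΦ : ∀ z l, mem₁ l z.1 ↔ mem₂ l (Φ z).1) (z : Card P₁ (cut₁ k b)) :
    Order.height (Φ z).1 = Order.height z.1 := by
  apply le_antisymm
  · have := height_le_height_card_iso Φ.symm (fun w hw => ?_) (Φ z)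
    · simpa using this
    · have := L₂.lt_index_of_cut_lt hk hw
      obtain ⟨c, hc⟩ := L₁.exists_cut_lt (y := (Φ.symm w).1) hk
        fun l hl => this l (by simpa using (hΦ _ l).1 hl)
      exact ⟨_, hc, by rw [h₁, h₂]⟩
  · refine height_le_height_card_iso Φ (fun w hw => ?_) z
    have := L₁.lt_index_of_cut_lt hk hw
    obtain ⟨c, hc⟩ := L₂.exists_cut_lt (y := (Φ w).1) hk fun l hl => this l ((hΦ _ l).2 hl)
    exact ⟨_, hc, by rw [h₁, h₂]⟩

namespace StackData

variable {Q R P : Type*} [PartialOrder Q] [PartialOrder R] [PartialOrder P]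
  {a b d p : Q} {dd pp dbar pbar : R} {n : ℕ} {τ : Bool}

theorem eQ_inj (S : StackData Q R P a b d p dd pp dbar pbar n τ) {q q' : Q} :
    S.eQ q = S.eQ q' ↔ q = q' := by
  simp only [le_antisymm_iff, S.eQ_iff]

theorem eR_inj (S : StackData Q R P a b d p dd pp dbar pbar n τ) {i : Fin n} {x y : R} :
    S.eR i x = S.eR i y ↔ x = y := by
  simp only [le_antisymm_iff, S.eR_iff]

theorem eT_inj (S : StackData Q R P a b d p dd pp dbar pbar n τ) {q q' : Q} :
    S.eT q = S.eT q' ↔ q = q' := by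
  simp only [le_antisymm_iff, S.eT_iff]
  exact and_comm

/-- Membership in the `k`-th layer: layer `0` is the copy of `Q`, layer `i + 1` is the copy of `R`
with index `i`, and layer `n + 1` is the copy of the dual of `Q`. -/
def mem (S : StackData Q R P a b d p dd pp dbar pbar n τ) (k : ℕ) (z : P) : Prop :=
  (k = 0 ∧ ∃ q, z = S.eQ q) ∨ (∃ i : Fin n, k = i + 1 ∧ ∃ x, z = S.eR i x) ∨
    (k = n + 1 ∧ ∃ q, z = S.eT q)

/-- The points `d_k = cut k true` and `p_k = cut k false`. -/
def cut (S : StackData Q R P a b d p dd pp dbar pbar n τ) : ℕ → Bool → P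
  | 0, c => S.eQ (cond c d p)
  | k + 1, c => if h : k < n then S.eR ⟨k, h⟩ (cond c dd pp) else S.eQ (cond c d p)

theorem mem_zero (S : StackData Q R P a b d p dd pp dbar pbar n τ) {z : P} :
    S.mem 0 z ↔ ∃ q, z = S.eQ q := by
  simp [mem]

theorem mem_succ (S : StackData Q R P a b d p dd pp dbar pbar n τ) (i : Fin n) {z : P} :
    S.mem (i + 1) z ↔ ∃ x, z = S.eR i x := by
  have := i.2
  simp only [mem, Nat.add_right_cancel_iff, Nat.succ_ne_zero, false_and, false_or]
  constructor
  · rintro (⟨j, hj, h⟩ | ⟨h, -⟩)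
    · rwa [Fin.ext hj]
    · omega
  · exact fun h => Or.inl ⟨i, rfl, h⟩

theorem mem_top (S : StackData Q R P a b d p dd pp dbar pbar n τ) {z : P} :
    S.mem (n + 1) z ↔ ∃ q, z = S.eT q := by
  simp only [mem, Nat.add_right_cancel_iff, Nat.succ_ne_zero, false_and, false_or, true_and]
  constructor
  · rintro (⟨j, hj, h⟩ | h)
    · have := j.2; omega
    · exact h
  · exact Or.inr

theorem cut_zero (S : StackData Q R P a b d p dd pp dbar pbar n τ) (c : Bool) :
    S.cut 0 c = S.eQ (cond c d p) := rfl

theorem cut_succ (S : StackData Q R P a b d p dd pp dbar pbar n τ) (i : Fin n) (c : Bool) :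
    S.cut (i + 1) c = S.eR i (cond c dd pp) := by
  simp [cut]

theorem cut_eq_bot (S : StackData Q R P a b d p dd pp dbar pbar n τ) (i : Fin n) (c : Bool) :
    S.cut i c = S.eR i (cond c dbar pbar) := by
  obtain ⟨i, hi⟩ := i
  cases i with
  | zero => cases c <;> simp [cut, S.id_bot_d, S.id_bot_p]
  | succ i =>
    rw [show ((⟨i + 1, hi⟩ : Fin n) : ℕ) = ((⟨i, by omega⟩ : Fin n) : ℕ) + 1 from rfl, cut_succ]
    cases c <;> simp [S.id_mid_d i hi, S.id_mid_p i hi]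

theorem cut_top (S : StackData Q R P a b d p dd pp dbar pbar n τ) (c : Bool) :
    S.cut n c = S.eT (cond (c ^^ τ) d p) := by
  have hn := S.hn
  have := S.cut_succ ⟨n - 1, by omega⟩ c
  rw [show ((⟨n - 1, by omega⟩ : Fin n) : ℕ) + 1 = n from Nat.succ_pred_eq_of_pos hn] at this
  rw [this]
  cases c
  · simp only [cond_false, S.id_top_p]; cases τ <;> rfl
  · simp only [cond_true, S.id_top_d]; cases τ <;> rfl

theorem mem_bound (S : StackData Q R P a b d p dd pp dbar pbar n τ) {k : ℕ} {z : P}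
    (h : S.mem k z) : k ≤ n + 1 := by
  rcases h with ⟨h, -⟩ | ⟨i, h, -⟩ | ⟨h, -⟩ <;> omega

theorem mem_adj (S : StackData Q R P a b d p dd pp dbar pbar n τ) {k l : ℕ} {z : P}
    (hk : S.mem k z) (hl : S.mem l z) (hkl : k < l) : l = k + 1 ∧ ∃ c, z = S.cut k c := by
  rcases hk with ⟨rfl, q, rfl⟩ | ⟨i, rfl, x, rfl⟩ | ⟨rfl, q, rfl⟩
  · rcases hl with ⟨rfl, _⟩ | ⟨j, rfl, y, hy⟩ | ⟨rfl, q', hq'⟩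
    · omega
    · obtain ⟨rfl, h | h⟩ := S.eQ_meet_eR _ _ _ hy
      · exact ⟨rfl, true, by rw [h.1]; rfl⟩
      · exact ⟨rfl, false, by rw [h.1]; rfl⟩
    · exact absurd hq' (S.eQ_meet_eT _ _)
  · rcases hl with ⟨rfl, _⟩ | ⟨j, rfl, y, hy⟩ | ⟨rfl, q', hq'⟩
    · omega
    · obtain ⟨hj, h⟩ := S.eR_meet_eR _ _ _ _ (by omega) hy
      refine ⟨by omega, ?_⟩
      rcases h with h | h
      · exact ⟨true, by rw [cut_succ, h.1]; rfl⟩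
      · exact ⟨false, by rw [cut_succ, h.1]; rfl⟩
    · obtain ⟨hj, h⟩ := S.eR_meet_eT _ _ _ hq'
      refine ⟨by have := S.hn; omega, ?_⟩
      rcases h with h | h
      · exact ⟨true, by rw [cut_succ, h.1]; rfl⟩
      · exact ⟨false, by rw [cut_succ, h.1]; rfl⟩
  · have := S.mem_bound hl
    omega

theorem cut_mem_lower (S : StackData Q R P a b d p dd pp dbar pbar n τ) {k : ℕ} (c : Bool)
    (hk : k ≤ n) : S.mem k (S.cut k c) := by
  cases k with
  | zero => exact S.mem_zero.2 ⟨_, rfl⟩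
  | succ k => exact (S.mem_succ ⟨k, hk⟩).2 ⟨_, S.cut_succ ⟨k, hk⟩ c⟩

theorem cut_mem_upper (S : StackData Q R P a b d p dd pp dbar pbar n τ) {k : ℕ} (c : Bool)
    (hk : k ≤ n) : S.mem (k + 1) (S.cut k c) := by
  rcases hk.lt_or_eq with hk | rfl
  · exact (S.mem_succ ⟨k, hk⟩).2 ⟨_, S.cut_eq_bot ⟨k, hk⟩ c⟩
  · exact S.mem_top.2 ⟨_, S.cut_top c⟩

theorem isMax_iff_cond {A : Type*} [PartialOrder A] {u v : A}
    (h : ∀ x, IsMax x ↔ x = u ∨ x = v) (x : A) : IsMax x ↔ ∃ c, x = cond c u v := by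
  rw [h]; simp [or_comm]

theorem isMin_iff_cond {A : Type*} [PartialOrder A] {u v : A}
    (h : ∀ x, IsMin x ↔ x = u ∨ x = v) (x : A) : IsMin x ↔ ∃ c, x = cond c u v := by
  rw [h]; simp [or_comm]

theorem mem_eQ (S : StackData Q R P a b d p dd pp dbar pbar n τ) (hQ : QHyps Q a b d p) (q : Q) :
    S.mem 1 (S.eQ q) ↔ IsMax q := by
  rw [isMax_iff_cond hQ.max_iff]
  constructor
  · intro h
    obtain ⟨-, c, hc⟩ := S.mem_adj (S.mem_zero.2 ⟨q, rfl⟩) h one_pos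
    exact ⟨c, S.eQ_inj.1 hc⟩
  · rintro ⟨c, rfl⟩
    exact S.cut_mem_upper (k := 0) c (by omega)

theorem mem_eR_upper (S : StackData Q R P a b d p dd pp dbar pbar n τ)
    (hR : RHyps R dd pp dbar pbar) (i : Fin n) (x : R) :
    S.mem (i + 1 + 1) (S.eR i x) ↔ IsMax x := by
  rw [isMax_iff_cond hR.max_iff]
  constructor
  · intro h
    obtain ⟨-, c, hc⟩ := S.mem_adj ((S.mem_succ i).2 ⟨x, rfl⟩) h (by omega)
    exact ⟨c, S.eR_inj.1 (hc.trans (S.cut_succ i c))⟩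
  · rintro ⟨c, rfl⟩
    rw [← cut_succ]
    exact S.cut_mem_upper c i.2

theorem mem_eR_lower (S : StackData Q R P a b d p dd pp dbar pbar n τ)
    (hR : RHyps R dd pp dbar pbar) (i : Fin n) (x : R) :
    S.mem i (S.eR i x) ↔ IsMin x := by
  rw [isMin_iff_cond hR.min_iff]
  constructor
  · intro h
    obtain ⟨-, c, hc⟩ := S.mem_adj h ((S.mem_succ i).2 ⟨x, rfl⟩) (by omega)
    exact ⟨c, S.eR_inj.1 (hc.trans (S.cut_eq_bot i c))⟩
  · rintro ⟨c, rfl⟩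
    rw [← cut_eq_bot]
    exact S.cut_mem_lower c i.2.le

theorem mem_eT (S : StackData Q R P a b d p dd pp dbar pbar n τ) (hQ : QHyps Q a b d p) (q : Q) :
    S.mem n (S.eT q) ↔ IsMax q := by
  rw [isMax_iff_cond hQ.max_iff]
  constructor
  · intro h
    obtain ⟨-, c, hc⟩ := S.mem_adj h (S.mem_top.2 ⟨q, rfl⟩) (by omega)
    exact ⟨_, S.eT_inj.1 (hc.trans (S.cut_top c))⟩
  · rintro ⟨c, rfl⟩
    have := S.cut_mem_lower (k := n) (c ^^ τ) le_rfl
    rwa [cut_top, Bool.xor_assoc, Bool.xor_self, Bool.xor_false] at this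

theorem isMax_cond {A : Type*} [PartialOrder A] {u v : A}
    (h : ∀ x, IsMax x ↔ x = u ∨ x = v) (c : Bool) : IsMax (cond c u v) :=
  (isMax_iff_cond h _).2 ⟨c, rfl⟩

theorem isMin_cond {A : Type*} [PartialOrder A] {u v : A}
    (h : ∀ x, IsMin x ↔ x = u ∨ x = v) (c : Bool) : IsMin (cond c u v) :=
  (isMin_iff_cond h _).2 ⟨c, rfl⟩

theorem exists_le_cond {A : Type*} [PartialOrder A] [Finite A] {u v : A}
    (h : ∀ x, IsMax x ↔ x = u ∨ x = v) (x : A) : ∃ c, x ≤ cond c u v := by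
  obtain ⟨m, hm, hm'⟩ := Finite.exists_le_maximal (p := fun _ : A => True) (a := x) trivial
  obtain ⟨c, rfl⟩ := (isMax_iff_cond h m).1 fun y hy => hm'.2 trivial hy
  exact ⟨c, hm⟩

theorem exists_cond_le {A : Type*} [PartialOrder A] [Finite A] {u v : A}
    (h : ∀ x, IsMin x ↔ x = u ∨ x = v) (x : A) : ∃ c, cond c u v ≤ x := by
  obtain ⟨m, hm, hm'⟩ := Finite.exists_le_minimal (p := fun _ : A => True) (a := x) trivial
  obtain ⟨c, rfl⟩ := (isMin_iff_cond h m).1 fun y hy => hm'.2 trivial hy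
  exact ⟨c, hm⟩

theorem cond_injective {A : Type*} {u v : A} (h : u ≠ v) {c c' : Bool}
    (hc : cond c u v = cond c' u v) : c = c' := by
  cases c <;> cases c' <;> simp_all

theorem layering [Finite Q] [Finite R] (S : StackData Q R P a b d p dd pp dbar pbar n τ)
    (hQ : QHyps Q a b d p) (hR : RHyps R dd pp dbar pbar) : Layering P n S.mem S.cut where
  ex z := by
    rcases S.cover z with h | ⟨i, h⟩ | h
    · exact ⟨0, S.mem_zero.2 h⟩
    · exact ⟨i + 1, (S.mem_succ i).2 h⟩
    · exact ⟨n + 1, S.mem_top.2 h⟩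
  bound := S.mem_bound
  adj := S.mem_adj
  cut_mem := S.cut_mem_lower
  cut_mem' := S.cut_mem_upper
  cut_max := by
    intro k c u hk hu h
    cases k with
    | zero =>
      obtain ⟨q, rfl⟩ := S.mem_zero.1 hu
      rw [cut_zero, S.eQ_iff] at h
      rw [cut_zero, S.eQ_inj]
      exact (isMax_cond hQ.max_iff c).eq_of_ge h
    | succ k =>
      obtain ⟨x, rfl⟩ := (S.mem_succ ⟨k, hk⟩).1 hu
      rw [S.cut_succ ⟨k, hk⟩, S.eR_iff] at h
      rw [S.cut_succ ⟨k, hk⟩, S.eR_inj]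
      exact (isMax_cond hR.max_iff c).eq_of_ge h
  cut_min := by
    intro k c u hk hu h
    rcases hk.lt_or_eq with hk | rfl
    · obtain ⟨x, rfl⟩ := (S.mem_succ ⟨k, hk⟩).1 hu
      rw [S.cut_eq_bot ⟨k, hk⟩, S.eR_iff] at h
      rw [S.cut_eq_bot ⟨k, hk⟩, S.eR_inj]
      exact (isMin_cond hR.min_iff c).eq_of_le h
    · obtain ⟨q, rfl⟩ := S.mem_top.1 hu
      rw [cut_top, S.eT_iff] at h
      rw [cut_top, S.eT_inj]
      exact (isMax_cond hQ.max_iff _).eq_of_ge h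
  cut_ne := by
    intro k c c' hk h
    cases k with
    | zero => exact cond_injective hQ.dp_ne (S.eQ_inj.1 h)
    | succ k =>
      rw [S.cut_succ ⟨k, hk⟩, S.cut_succ ⟨k, hk⟩, S.eR_inj] at h
      exact cond_injective hR.dp_ne h
  above := by
    intro k w hk h
    rcases hk.lt_or_eq with hk | rfl
    · obtain ⟨x, rfl⟩ := (S.mem_succ ⟨k, hk⟩).1 h
      obtain ⟨c, hc⟩ := exists_cond_le hR.min_iff x
      exact ⟨c, by rwa [S.cut_eq_bot ⟨k, hk⟩, S.eR_iff]⟩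
    · obtain ⟨q, rfl⟩ := S.mem_top.1 h
      obtain ⟨c, hc⟩ := exists_le_cond hQ.max_iff q
      refine ⟨c ^^ τ, ?_⟩
      rwa [S.cut_top, S.eT_iff, Bool.xor_assoc, Bool.xor_self, Bool.xor_false]
  below := by
    intro k w hk h
    cases k with
    | zero =>
      obtain ⟨q, rfl⟩ := S.mem_zero.1 h
      obtain ⟨c, hc⟩ := exists_le_cond hQ.max_iff q
      exact ⟨c, by rwa [S.cut_zero, S.eQ_iff]⟩
    | succ k =>
      obtain ⟨x, rfl⟩ := (S.mem_succ ⟨k, hk⟩).1 h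
      obtain ⟨c, hc⟩ := exists_le_cond hR.max_iff x
      exact ⟨c, by rwa [S.cut_succ ⟨k, hk⟩, S.eR_iff]⟩
  step := by
    intro k z w h1 h2 h3 h4
    have hn := S.hn
    rw [S.le_iff]
    apply Relation.ReflTransGen.single
    rcases h1 with ⟨rfl, q, rfl⟩ | ⟨i, rfl, x, rfl⟩ | ⟨rfl, q, rfl⟩
    · obtain ⟨y, rfl⟩ := (S.mem_succ ⟨0, hn⟩).1 h3
      rw [zero_add, S.mem_eQ hQ] at h2
      have h4 := (S.mem_eR_lower hR ⟨0, hn⟩ y).not.1 h4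
      exact Or.inr (Or.inr (Or.inr (Or.inl ⟨q, y, h2, h4, rfl, rfl⟩)))
    · rw [S.mem_eR_upper hR] at h2
      by_cases hi : (i : ℕ) + 1 < n
      · obtain ⟨y, rfl⟩ := (S.mem_succ ⟨i + 1, hi⟩).1 h3
        have h4 := (S.mem_eR_lower hR ⟨i + 1, hi⟩ y).not.1 h4
        exact Or.inr (Or.inr (Or.inr (Or.inr (Or.inl ⟨i, hi, x, y, h2, h4, rfl, rfl⟩))))
      · have hi' : (i : ℕ) + 1 = n := by omega
        rw [hi'] at h3 h4
        obtain ⟨q, rfl⟩ := S.mem_top.1 h3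
        rw [S.mem_eT hQ] at h4
        refine Or.inr (Or.inr (Or.inr (Or.inr (Or.inr ⟨x, q, h2, h4, ?_, rfl⟩))))
        congr 1
        exact Fin.ext (by simp; omega)
    · have := S.mem_bound h3
      omega
  gen := by
    intro z w h
    refine Relation.ReflTransGen.mono ?_ _ _ ((S.le_iff z w).1 h)
    intro u v huv
    refine ⟨(S.le_iff u v).2 (.single huv), ?_⟩
    have hn := S.hn
    rcases huv with ⟨q, q', -, rfl, rfl⟩ | ⟨i, x, y, -, rfl, rfl⟩ | ⟨q, q', -, rfl, rfl⟩ |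
      ⟨q, x, h1, h2, rfl, rfl⟩ | ⟨i, hi, x, y, h1, h2, rfl, rfl⟩ | ⟨x, q, h1, h2, rfl, rfl⟩
    · exact Or.inl ⟨0, S.mem_zero.2 ⟨_, rfl⟩, S.mem_zero.2 ⟨_, rfl⟩⟩
    · exact Or.inl ⟨i + 1, (S.mem_succ i).2 ⟨_, rfl⟩, (S.mem_succ i).2 ⟨_, rfl⟩⟩
    · exact Or.inl ⟨n + 1, S.mem_top.2 ⟨_, rfl⟩, S.mem_top.2 ⟨_, rfl⟩⟩
    · exact Or.inr ⟨0, S.mem_zero.2 ⟨_, rfl⟩, (S.mem_eQ hQ q).not.2 h1,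
        (S.mem_succ ⟨0, hn⟩).2 ⟨_, rfl⟩, (S.mem_eR_lower hR ⟨0, hn⟩ x).not.2 h2⟩
    · exact Or.inr ⟨i + 1, (S.mem_succ ⟨i, by omega⟩).2 ⟨_, rfl⟩,
        (S.mem_eR_upper hR ⟨i, by omega⟩ x).not.2 h1,
        (S.mem_succ ⟨i + 1, hi⟩).2 ⟨_, rfl⟩, (S.mem_eR_lower hR ⟨i + 1, hi⟩ y).not.2 h2⟩
    · have hn' : n - 1 + 1 = n := by omega
      have h3 := (S.mem_succ ⟨n - 1, by omega⟩).2 ⟨x, rfl⟩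
      have h4 := (S.mem_eR_upper hR ⟨n - 1, by omega⟩ x).not.2 h1
      simp only [hn'] at h3 h4
      exact Or.inr ⟨n, h3, h4, S.mem_top.2 ⟨_, rfl⟩, (S.mem_eT hQ q).not.2 h2⟩

theorem height_cut [Finite Q] [Finite R] (S : StackData Q R P a b d p dd pp dbar pbar n τ)
    (hQ : QHyps Q a b d p) (hR : RHyps R dd pp dbar pbar) {k : ℕ} (hk : k ≤ n) (c : Bool) :
    Order.height (S.cut k c) = Order.height d + k * Order.height dd := by
  have L := S.layering hQ hR
  have hd : ∀ c, Order.height (cond c d p) = Order.height d := by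
    rintro (_ | _)
    · exact hQ.rank_eq.symm
    · rfl
  have hdd : ∀ c, Order.height (cond c dd pp) = Order.height dd := by
    rintro (_ | _)
    · exact hR.rank_eq.symm
    · rfl
  induction k generalizing c with
  | zero =>
    have hlow : ∀ q z, z < S.eQ q → ∃ q', z = S.eQ q' := by
      intro q z hz
      have hq : S.mem 0 (S.eQ q) := S.mem_zero.2 ⟨q, rfl⟩
      rcases L.le_cases hz.le with ⟨k, h1, h2⟩ | h
      · have := L.index_le hq h2
        obtain rfl | rfl : k = 0 ∨ k = 1 := by omega
        · exact S.mem_zero.1 h1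
        · exact absurd (L.min_unique hq h2 h1 hz.le) hz.ne
      · obtain ⟨k, hk⟩ := L.ex z
        exact absurd (h k 0 hk hq) (by omega)
    rw [cut_zero, height_embedding_eq_add S.eQ S.eQ_iff 0, hd]
    · simp
    · intro q hq
      refine Order.height_eq_zero.2 fun z hz => ?_
      by_contra hc
      have hlt : z < S.eQ q := lt_of_le_not_ge hz hc
      obtain ⟨q', rfl⟩ := hlow _ _ hlt
      rw [S.eQ_iff] at hz hc
      exact hc (hq hz)
    · exact fun q z _ hz => Or.inl (hlow q z hz)
  | succ k ih =>
    replace ih := ih (by omega)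
    obtain ⟨i, rfl⟩ : ∃ i : Fin n, (i : ℕ) = k := ⟨⟨k, hk⟩, rfl⟩
    rw [S.cut_succ i, height_embedding_eq_add (S.eR i) (S.eR_iff i)
      (Order.height d + i * Order.height dd), hdd]
    · push_cast
      ring
    · intro x hx
      obtain ⟨c, rfl⟩ := (isMin_iff_cond hR.min_iff x).1 hx
      rw [← cut_eq_bot, ih]
    · intro x z hx hz
      by_cases h0 : S.mem (i + 1) z
      · exact Or.inl ((S.mem_succ i).1 h0)
      refine Or.inr ?_
      have hxm : S.mem (i + 1) (S.eR i x) := (S.mem_succ i).2 ⟨x, rfl⟩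
      have hlow : ∀ l, S.mem l z → l ≤ i := by
        rcases L.le_cases hz.le with ⟨l, h1, h2⟩ | h
        · have hl := L.index_le hxm h2
          have hl' := L.index_le h2 hxm
          have : l ≠ i := by rintro rfl; exact hx ((S.mem_eR_lower hR i x).1 h2)
          have : l ≠ i + 1 := by rintro rfl; exact h0 h1
          obtain rfl : l = i + 1 + 1 := by omega
          exact absurd (L.min_unique hxm h2 h1 hz.le) hz.ne
        · intro l hl
          have := h l _ hl hxm
          omega
      obtain ⟨c, hc⟩ := L.exists_lt_cut i.2.le hlow
      rw [← ih c]
      exact Order.height_add_one_le hc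

end StackData

/-- The relation `g` matches the points `s c` and `t c'` exactly when `r c c'`, and relates these
points to no others. -/
structure Matches {A B : Type*} (g : A → B → Prop) (r : Bool → Bool → Prop) (s : Bool → A)
    (t : Bool → B) : Prop where
  left : ∀ c v, g (s c) v ↔ ∃ c', r c c' ∧ v = t c'
  right : ∀ c' u, g u (t c') ↔ ∃ c, r c c' ∧ u = s c

theorem Matches.flip {A B : Type*} {g : A → B → Prop} {r : Bool → Bool → Prop} {s : Bool → A}
    {t : Bool → B} (h : Matches g r s t) : Matches (flip g) (flip r) t s :=
  ⟨h.right, h.left⟩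

namespace PartialOrderIso

variable {A B : Type*} [PartialOrder A] [PartialOrder B] {g : A → B → Prop}
  {X X' : A → Prop} {Y Y' : B → Prop}

theorem congr (h : PartialOrderIso g X Y) (hX : ∀ u, X' u ↔ X u) (hY : ∀ v, Y' v ↔ Y v) :
    PartialOrderIso g X' Y' where
  dom u := (hX u).trans (h.dom u)
  cod v := (hY v).trans (h.cod v)
  le_iff := h.le_iff

theorem matches_of (h : PartialOrderIso g X Y) {r : Bool → Bool → Prop} {s : Bool → A}
    {t : Bool → B} (h1 : ∀ c c', r c c' → g (s c) (t c')) (h2 : ∀ c, X (s c) → ∃ c', r c c')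
    (h3 : ∀ c', Y (t c') → ∃ c, r c c') : Matches g r s t where
  left c v := by
    constructor
    · intro hg
      obtain ⟨c', hc'⟩ := h2 c ((h.dom _).2 ⟨_, hg⟩)
      exact ⟨c', hc', h.right_unique hg (h1 _ _ hc')⟩
    · rintro ⟨c', hc', rfl⟩
      exact h1 _ _ hc'
  right c' u := by
    constructor
    · intro hg
      obtain ⟨c, hc⟩ := h3 c' ((h.cod _).2 ⟨_, hg⟩)
      exact ⟨c, hc, h.left_unique hg (h1 _ _ hc)⟩
    · rintro ⟨c, hc, rfl⟩
      exact h1 _ _ hc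

theorem matches_id (h : PartialOrderIso g X Y) {s : Bool → A} {t : Bool → B}
    (h1 : ∀ c, g (s c) (t c)) : Matches g (fun c c' => c' = c) s t :=
  h.matches_of (by rintro c c' rfl; exact h1 _) (fun c _ => ⟨c, rfl⟩) (fun c _ => ⟨c, rfl⟩)

theorem matches_swap (h : PartialOrderIso g X Y) {s : Bool → A} {t : Bool → B}
    (h1 : ∀ c, g (s c) (t !c)) : Matches g (fun c c' => c' = !c) s t :=
  h.matches_of (by rintro c c' rfl; exact h1 _) (fun c _ => ⟨!c, rfl⟩)
    (fun c _ => ⟨!c, (Bool.not_not c).symm⟩)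

theorem matches_single (h : PartialOrderIso g X Y) {s : Bool → A} {t : Bool → B} {e : Bool}
    (h1 : g (s e) (t e)) (h2 : ¬ X (s !e)) (h3 : ¬ Y (t !e)) :
    Matches g (fun c c' => c = e ∧ c' = e) s t := by
  refine h.matches_of (by rintro _ _ ⟨rfl, rfl⟩; exact h1) (fun c hc => ⟨e, ?_, rfl⟩)
    (fun c hc => ⟨e, rfl, ?_⟩)
  · by_contra hce
    exact h2 (Bool.eq_not_of_ne hce ▸ hc)
  · by_contra hce
    exact h3 (Bool.eq_not_of_ne hce ▸ hc)

end PartialOrderIso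

/-- Partial isomorphisms between corresponding layers of two stacks, compatible with the
identifications, where `x` and `y` are the points that are removed. -/
structure LayerMaps {Q R P₁ P₂ : Type*} [PartialOrder Q] [PartialOrder R] [PartialOrder P₁]
    [PartialOrder P₂] {a b d p : Q} {dd pp dbar pbar : R} {n : ℕ} {τ₁ τ₂ : Bool}
    (S₁ : StackData Q R P₁ a b d p dd pp dbar pbar n τ₁)
    (S₂ : StackData Q R P₂ a b d p dd pp dbar pbar n τ₂)
    (g₀ : Q → Q → Prop) (g : Fin n → R → R → Prop) (g₁ : Q → Q → Prop)
    (r : ℕ → Bool → Bool → Prop) (x : P₁) (y : P₂) : Prop where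
  iso_Q : PartialOrderIso g₀ (fun q => S₁.eQ q ≠ x) (fun q => S₂.eQ q ≠ y)
  iso_R : ∀ i, PartialOrderIso (g i) (fun q => S₁.eR i q ≠ x) (fun q => S₂.eR i q ≠ y)
  iso_T : PartialOrderIso g₁ (fun q => S₁.eT q ≠ x) (fun q => S₂.eT q ≠ y)
  matches_Q : Matches g₀ (r 0) (cond · d p) (cond · d p)
  matches_R_bot : ∀ i : Fin n, Matches (g i) (r i) (cond · dbar pbar) (cond · dbar pbar)
  matches_R_top : ∀ i : Fin n, Matches (g i) (r (i + 1)) (cond · dd pp) (cond · dd pp)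
  matches_T : Matches g₁ (r n) (fun c => cond (c ^^ τ₁) d p) (fun c => cond (c ^^ τ₂) d p)

/-- The relation between the `k`-th layers of two stacks induced by relations on `Q` and `R`. -/
def layerRelation {Q R P₁ P₂ : Type*} [PartialOrder Q] [PartialOrder R] [PartialOrder P₁]
    [PartialOrder P₂] {a b d p : Q} {dd pp dbar pbar : R} {n : ℕ} {τ₁ τ₂ : Bool}
    (S₁ : StackData Q R P₁ a b d p dd pp dbar pbar n τ₁)
    (S₂ : StackData Q R P₂ a b d p dd pp dbar pbar n τ₂)
    (g₀ : Q → Q → Prop) (g : Fin n → R → R → Prop) (g₁ : Q → Q → Prop)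
    (k : ℕ) (z : P₁) (w : P₂) : Prop :=
  (k = 0 ∧ ∃ q q', g₀ q q' ∧ z = S₁.eQ q ∧ w = S₂.eQ q') ∨
  (∃ i : Fin n, k = i + 1 ∧ ∃ q q', g i q q' ∧ z = S₁.eR i q ∧ w = S₂.eR i q') ∨
  (k = n + 1 ∧ ∃ q q', g₁ q q' ∧ z = S₁.eT q ∧ w = S₂.eT q')

namespace LayerMaps

variable {Q R P₁ P₂ : Type*} [PartialOrder Q] [PartialOrder R] [PartialOrder P₁]
  [PartialOrder P₂] {a b d p : Q} {dd pp dbar pbar : R} {n : ℕ} {τ₁ τ₂ : Bool}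
  {S₁ : StackData Q R P₁ a b d p dd pp dbar pbar n τ₁}
  {S₂ : StackData Q R P₂ a b d p dd pp dbar pbar n τ₂}
  {g₀ : Q → Q → Prop} {g : Fin n → R → R → Prop} {g₁ : Q → Q → Prop}
  {r : ℕ → Bool → Bool → Prop} {x : P₁} {y : P₂}

theorem flip (h : LayerMaps S₁ S₂ g₀ g g₁ r x y) :
    LayerMaps S₂ S₁ (flip g₀) (fun i => flip (g i)) (flip g₁) (fun k => flip (r k)) y x where
  iso_Q := h.iso_Q.flip
  iso_R i := (h.iso_R i).flip
  iso_T := h.iso_T.flip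
  matches_Q := h.matches_Q.flip
  matches_R_bot i := (h.matches_R_bot i).flip
  matches_R_top i := (h.matches_R_top i).flip
  matches_T := h.matches_T.flip

theorem layerRelation_flip {k : ℕ} {z : P₁} {w : P₂} :
    layerRelation S₂ S₁ (_root_.flip g₀) (fun i => _root_.flip (g i)) (_root_.flip g₁) k w z ↔
      layerRelation S₁ S₂ g₀ g g₁ k z w := by
  unfold layerRelation _root_.flip
  refine or_congr (and_congr_right fun _ => ?_) (or_congr
    (exists_congr fun i => and_congr_right fun _ => ?_) (and_congr_right fun _ => ?_))
  all_goals
    constructor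
    · rintro ⟨q, q', h1, h2, h3⟩; exact ⟨q', q, h1, h3, h2⟩
    · rintro ⟨q, q', h1, h2, h3⟩; exact ⟨q', q, h1, h3, h2⟩

theorem layerRelation_eQ {q : Q} {w : P₂} :
    layerRelation S₁ S₂ g₀ g g₁ 0 (S₁.eQ q) w ↔ ∃ q', g₀ q q' ∧ w = S₂.eQ q' := by
  simp [layerRelation, S₁.eQ_inj]

theorem layerRelation_eR {i : Fin n} {q : R} {w : P₂} :
    layerRelation S₁ S₂ g₀ g g₁ (i + 1) (S₁.eR i q) w ↔ ∃ q', g i q q' ∧ w = S₂.eR i q' := by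
  have hi := i.2
  constructor
  · rintro (⟨h, -⟩ | ⟨j, hj, q₁, q', h1, h2, h3⟩ | ⟨h, -⟩)
    · omega
    · obtain rfl : i = j := Fin.ext (by omega)
      obtain rfl := S₁.eR_inj.1 h2
      exact ⟨q', h1, h3⟩
    · omega
  · rintro ⟨q', h1, h2⟩
    exact Or.inr (Or.inl ⟨i, rfl, q, q', h1, rfl, h2⟩)

theorem layerRelation_eT {q : Q} {w : P₂} :
    layerRelation S₁ S₂ g₀ g g₁ (n + 1) (S₁.eT q) w ↔ ∃ q', g₁ q q' ∧ w = S₂.eT q' := by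
  constructor
  · rintro (⟨h, -⟩ | ⟨j, hj, -⟩ | ⟨-, q₁, q', h1, h2, h3⟩)
    · omega
    · have := j.2
      omega
    · obtain rfl := S₁.eT_inj.1 h2
      exact ⟨q', h1, h3⟩
  · rintro ⟨q', h1, h2⟩
    exact Or.inr (Or.inr ⟨rfl, q, q', h1, rfl, h2⟩)

theorem layerRelation_cut (h : LayerMaps S₁ S₂ g₀ g g₁ r x y) {k : ℕ} (hk : k ≤ n) {c : Bool}
    {w : P₂} :
    layerRelation S₁ S₂ g₀ g g₁ k (S₁.cut k c) w ↔ ∃ c', r k c c' ∧ w = S₂.cut k c' := by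
  cases k with
  | zero =>
    rw [S₁.cut_zero, layerRelation_eQ]
    simp only [h.matches_Q.left c, S₂.cut_zero]
    constructor
    · rintro ⟨_, ⟨c', h1, rfl⟩, h2⟩; exact ⟨c', h1, h2⟩
    · rintro ⟨c', h1, h2⟩; exact ⟨_, ⟨c', h1, rfl⟩, h2⟩
  | succ k =>
    obtain ⟨i, rfl⟩ : ∃ i : Fin n, (i : ℕ) = k := ⟨⟨k, hk⟩, rfl⟩
    rw [S₁.cut_succ, layerRelation_eR]
    simp only [(h.matches_R_top i).left c, S₂.cut_succ]
    constructor
    · rintro ⟨_, ⟨c', h1, rfl⟩, h2⟩; exact ⟨c', h1, h2⟩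
    · rintro ⟨c', h1, h2⟩; exact ⟨_, ⟨c', h1, rfl⟩, h2⟩

theorem layerRelation_cut' (h : LayerMaps S₁ S₂ g₀ g g₁ r x y) {k : ℕ} (hk : k ≤ n) {c : Bool}
    {w : P₂} :
    layerRelation S₁ S₂ g₀ g g₁ (k + 1) (S₁.cut k c) w ↔ ∃ c', r k c c' ∧ w = S₂.cut k c' := by
  rcases hk.lt_or_eq with hk | rfl
  · obtain ⟨i, rfl⟩ : ∃ i : Fin n, (i : ℕ) = k := ⟨⟨k, hk⟩, rfl⟩
    rw [S₁.cut_eq_bot, layerRelation_eR]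
    simp only [(h.matches_R_bot i).left c, S₂.cut_eq_bot]
    constructor
    · rintro ⟨_, ⟨c', h1, rfl⟩, h2⟩; exact ⟨c', h1, h2⟩
    · rintro ⟨c', h1, h2⟩; exact ⟨_, ⟨c', h1, rfl⟩, h2⟩
  · rw [S₁.cut_top, layerRelation_eT]
    simp only [h.matches_T.left c, S₂.cut_top]
    constructor
    · rintro ⟨_, ⟨c', h1, rfl⟩, h2⟩; exact ⟨c', h1, h2⟩
    · rintro ⟨c', h1, h2⟩; exact ⟨_, ⟨c', h1, rfl⟩, h2⟩

theorem mem_of_layerRelation {k : ℕ} {z : P₁} {w : P₂}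
    (h : layerRelation S₁ S₂ g₀ g g₁ k z w) : S₁.mem k z := by
  rcases h with ⟨rfl, q, q', -, rfl, -⟩ | ⟨i, rfl, q, q', -, rfl, -⟩ | ⟨rfl, q, q', -, rfl, -⟩
  · exact S₁.mem_zero.2 ⟨_, rfl⟩
  · exact (S₁.mem_succ i).2 ⟨_, rfl⟩
  · exact S₁.mem_top.2 ⟨_, rfl⟩

theorem ne_of_layerRelation (h : LayerMaps S₁ S₂ g₀ g g₁ r x y) {k : ℕ} {z : P₁} {w : P₂}
    (hk : layerRelation S₁ S₂ g₀ g g₁ k z w) : z ≠ x := by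
  rcases hk with ⟨rfl, q, q', hg, rfl, -⟩ | ⟨i, rfl, q, q', hg, rfl, -⟩ |
    ⟨rfl, q, q', hg, rfl, -⟩
  · exact (h.iso_Q.dom q).2 ⟨_, hg⟩
  · exact ((h.iso_R i).dom q).2 ⟨_, hg⟩
  · exact (h.iso_T.dom q).2 ⟨_, hg⟩

theorem exists_layerRelation (h : LayerMaps S₁ S₂ g₀ g g₁ r x y) {k : ℕ} {z : P₁}
    (hk : S₁.mem k z) (hz : z ≠ x) : ∃ w, layerRelation S₁ S₂ g₀ g g₁ k z w := by
  rcases hk with ⟨rfl, q, rfl⟩ | ⟨i, rfl, q, rfl⟩ | ⟨rfl, q, rfl⟩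
  · obtain ⟨q', hq⟩ := (h.iso_Q.dom q).1 hz
    exact ⟨_, layerRelation_eQ.2 ⟨q', hq, rfl⟩⟩
  · obtain ⟨q', hq⟩ := ((h.iso_R i).dom q).1 hz
    exact ⟨_, layerRelation_eR.2 ⟨q', hq, rfl⟩⟩
  · obtain ⟨q', hq⟩ := (h.iso_T.dom q).1 hz
    exact ⟨_, layerRelation_eT.2 ⟨q', hq, rfl⟩⟩

theorem layerRel (h : LayerMaps S₁ S₂ g₀ g g₁ r x y) :
    LayerRel n S₁.mem S₁.cut S₂.mem S₂.cut (layerRelation S₁ S₂ g₀ g g₁) x y where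
  mem_left := mem_of_layerRelation
  mem_right hk := mem_of_layerRelation (layerRelation_flip.2 hk)
  ne_left := h.ne_of_layerRelation
  ne_right hk := h.flip.ne_of_layerRelation (layerRelation_flip.2 hk)
  total_left := h.exists_layerRelation
  total_right hk hw := (h.flip.exists_layerRelation hk hw).imp fun _ => layerRelation_flip.1
  le_iff := by
    intro k z w z' w' h1 h2
    rcases h1 with ⟨rfl, q, q', hg, rfl, rfl⟩ | ⟨i, rfl, q, q', hg, rfl, rfl⟩ |
      ⟨rfl, q, q', hg, rfl, rfl⟩
    · rcases h2 with ⟨-, u, u', hg', rfl, rfl⟩ | ⟨i, hi, -⟩ | ⟨hi, -⟩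
      · rw [S₁.eQ_iff, S₂.eQ_iff, h.iso_Q.le_iff hg hg']
      · omega
      · omega
    · rcases h2 with ⟨hi, -⟩ | ⟨j, hj, u, u', hg', rfl, rfl⟩ | ⟨hi, -⟩
      · omega
      · obtain rfl : i = j := Fin.ext (by omega)
        rw [S₁.eR_iff, S₂.eR_iff, (h.iso_R i).le_iff hg hg']
      · have := i.2
        omega
    · rcases h2 with ⟨hi, -⟩ | ⟨i, hi, -⟩ | ⟨-, u, u', hg', rfl, rfl⟩
      · omega
      · have := i.2
        omega
      · rw [S₁.eT_iff, S₂.eT_iff, h.iso_T.le_iff hg' hg]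
  cut_left hk := (h.layerRelation_cut hk).trans (h.layerRelation_cut' hk).symm
  cut_right hk := by
    rw [← layerRelation_flip, ← layerRelation_flip (k := _ + 1)]
    exact (h.flip.layerRelation_cut hk).trans (h.flip.layerRelation_cut' hk).symm

end LayerMaps

theorem QHyps.exists_card_max {Q : Type*} [PartialOrder Q] {a b d p : Q} (hQ : QHyps Q a b d p)
    (e : Bool) : ∃ ψ : Card Q (cond e d p) ≃o Card Q (cond (!e) d p),
      cardRel ψ (cond (!e) d p) (cond e d p) := by
  obtain ⟨ψ, hψ⟩ := hQ.iso_del_max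
  have : cardRel ψ p d := ⟨_, _, hψ⟩
  cases e
  · exact ⟨ψ.symm, cardRel_symm this⟩
  · exact ⟨ψ, this⟩

theorem QHyps.exists_card_min {Q : Type*} [PartialOrder Q] {a b d p : Q} (hQ : QHyps Q a b d p)
    (e : Bool) : ∃ ψ : Card Q (cond e a b) ≃o Card Q (cond e a b),
      cardRel ψ (cond (!e) a b) (cond (!e) a b) ∧
      ∀ c, cardRel ψ (cond c d p) (cond (!c) d p) := by
  cases e
  · obtain ⟨h1, h2, h3, ψ, h4, h5, h6⟩ := hQ.auto_del_b
    exact ⟨ψ, ⟨h3, h3, h6⟩, by rintro (_ | _); exacts [⟨h1, h2, h4⟩, ⟨h2, h1, h5⟩]⟩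
  · obtain ⟨h1, h2, h3, ψ, h4, h5, h6⟩ := hQ.auto_del_a
    exact ⟨ψ, ⟨h3, h3, h6⟩, by rintro (_ | _); exacts [⟨h1, h2, h4⟩, ⟨h2, h1, h5⟩]⟩

theorem RHyps.exists_card_min {R : Type*} [PartialOrder R] {dd pp dbar pbar : R}
    (hR : RHyps R dd pp dbar pbar) (e : Bool) :
    ∃ ψ : Card R (cond e dbar pbar) ≃o Card R (cond e dbar pbar),
      cardRel ψ (cond (!e) dbar pbar) (cond (!e) dbar pbar) ∧
      ∀ c, cardRel ψ (cond c dd pp) (cond (!c) dd pp) := by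
  cases e
  · obtain ⟨h1, h2, h3, ψ, h4, h5, h6⟩ := hR.auto_del_pbar
    exact ⟨ψ, ⟨h3, h3, h6⟩, by rintro (_ | _); exacts [⟨h2, h1, h5⟩, ⟨h1, h2, h4⟩]⟩
  · obtain ⟨h1, h2, h3, ψ, h4, h5, h6⟩ := hR.auto_del_dbar
    exact ⟨ψ, ⟨h3, h3, h6⟩, by rintro (_ | _); exacts [⟨h2, h1, h5⟩, ⟨h1, h2, h4⟩]⟩

theorem RHyps.exists_swap {R : Type*} [PartialOrder R] {dd pp dbar pbar : R}
    (hR : RHyps R dd pp dbar pbar) : ∃ φ : R ≃o R,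
      (∀ c, φ (cond c dbar pbar) = cond (!c) dbar pbar) ∧
      ∀ c, φ (cond c dd pp) = cond (!c) dd pp := by
  obtain ⟨φ, h1, h2, h3, h4⟩ := hR.auto_swap
  exact ⟨φ, by rintro (_ | _) <;> assumption, by rintro (_ | _) <;> assumption⟩

theorem cond_ne_cond_not {A : Type*} {u v : A} (h : u ≠ v) (c : Bool) :
    cond (!c) u v ≠ cond c u v := by
  cases c
  · exact h
  · exact h.symm

/-- How the points of the cut `k` are matched after removal of the point `cut i e`. -/
def cutMatch (i : ℕ) (e : Bool) (k : ℕ) : Bool → Bool → Prop :=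
  if k < i then fun c c' => c' = c
  else if k = i then fun c c' => c = (!e) ∧ c' = !e
  else fun c c' => c' = !c

section Main

variable {Q R P₁ P₂ : Type*} [PartialOrder Q] [PartialOrder R] [PartialOrder P₁]
  [PartialOrder P₂] {a b d p : Q} {dd pp dbar pbar : R} {n : ℕ} {τ : Bool}

theorem StackData.eQ_ne_cut (S : StackData Q R P₁ a b d p dd pp dbar pbar n τ) [Finite Q]
    [Finite R] (hQ : QHyps Q a b d p) (hR : RHyps R dd pp dbar pbar) {k : ℕ} (hk : k ≤ n)
    (hk0 : k ≠ 0) (c : Bool) (q : Q) : S.eQ q ≠ S.cut k c := fun h => by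
  have := (S.layering hQ hR).eq_or_eq_of_mem_cut hk (h ▸ S.mem_zero.2 ⟨q, rfl⟩)
  omega

theorem StackData.eR_ne_cut (S : StackData Q R P₁ a b d p dd pp dbar pbar n τ) [Finite Q]
    [Finite R] (hQ : QHyps Q a b d p) (hR : RHyps R dd pp dbar pbar) {k : ℕ} (hk : k ≤ n)
    (i : Fin n) (hi : k ≠ i) (hi' : k ≠ i + 1) (c : Bool) (q : R) : S.eR i q ≠ S.cut k c :=
  fun h => by
  have := (S.layering hQ hR).eq_or_eq_of_mem_cut hk (h ▸ (S.mem_succ i).2 ⟨q, rfl⟩)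
  omega

theorem StackData.eT_ne_cut (S : StackData Q R P₁ a b d p dd pp dbar pbar n τ) [Finite Q]
    [Finite R] (hQ : QHyps Q a b d p) (hR : RHyps R dd pp dbar pbar) {k : ℕ} (hk : k < n)
    (c : Bool) (q : Q) : S.eT q ≠ S.cut k c := fun h => by
  have := (S.layering hQ hR).eq_or_eq_of_mem_cut hk.le (h ▸ S.mem_top.2 ⟨q, rfl⟩)
  omega

theorem exists_layerMaps_cut [Finite Q] [Finite R] (hQ : QHyps Q a b d p)
    (hR : RHyps R dd pp dbar pbar)
    (S₁ : StackData Q R P₁ a b d p dd pp dbar pbar n false)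
    (S₂ : StackData Q R P₂ a b d p dd pp dbar pbar n true) {i : ℕ} (hi : i ≤ n) (e : Bool) :
    ∃ g₀ g g₁, LayerMaps S₁ S₂ g₀ g g₁ (cutMatch i e) (S₁.cut i e) (S₂.cut i e) := by
  obtain ⟨φ, hφ, hφ'⟩ := hR.exists_swap
  have exQ : ∃ g₀, PartialOrderIso g₀ (fun q => S₁.eQ q ≠ S₁.cut i e)
      (fun q => S₂.eQ q ≠ S₂.cut i e) ∧
      Matches g₀ (cutMatch i e 0) (cond · d p) (cond · d p) := by
    rcases Nat.eq_zero_or_pos i with rfl | hi0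
    · have key := PartialOrderIso.of_card (OrderIso.refl (Card Q (cond e d p)))
      refine ⟨_, key.congr (fun q => ?_) (fun q => ?_), ?_⟩
      · rw [S₁.cut_zero, Ne, S₁.eQ_inj]
      · rw [S₂.cut_zero, Ne, S₂.eQ_inj]
      · simp only [cutMatch, lt_irrefl, if_false, if_true]
        exact key.matches_single (cardRel_refl (cond_ne_cond_not hQ.dp_ne e)) (by simp) (by simp)
    · refine ⟨_, PartialOrderIso.of_eq.congr (fun q => ?_) (fun q => ?_), ?_⟩
      · exact iff_true_intro (S₁.eQ_ne_cut hQ hR hi hi0.ne' _ _)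
      · exact iff_true_intro (S₂.eQ_ne_cut hQ hR hi hi0.ne' _ _)
      · simp only [cutMatch, hi0, if_true]
        exact PartialOrderIso.of_eq.matches_id fun c => rfl
  have exR : ∀ j : Fin n, ∃ g, PartialOrderIso g (fun q => S₁.eR j q ≠ S₁.cut i e)
      (fun q => S₂.eR j q ≠ S₂.cut i e) ∧
      Matches g (cutMatch i e j) (cond · dbar pbar) (cond · dbar pbar) ∧
      Matches g (cutMatch i e (j + 1)) (cond · dd pp) (cond · dd pp) := by
    intro j
    rcases lt_trichotomy ((j : ℕ) + 1) i with hj | rfl | hj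
    · refine ⟨_, PartialOrderIso.of_eq.congr (fun q => ?_) (fun q => ?_), ?_, ?_⟩
      · exact iff_true_intro (S₁.eR_ne_cut hQ hR hi _ (by omega) (by omega) _ _)
      · exact iff_true_intro (S₂.eR_ne_cut hQ hR hi _ (by omega) (by omega) _ _)
      · simp only [cutMatch, show (j : ℕ) < i by omega, if_true]
        exact PartialOrderIso.of_eq.matches_id fun c => rfl
      · simp only [cutMatch, hj, if_true]
        exact PartialOrderIso.of_eq.matches_id fun c => rfl
    · have key := PartialOrderIso.of_card (OrderIso.refl (Card R (cond e dd pp)))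
      refine ⟨_, key.congr (fun q => ?_) (fun q => ?_), ?_, ?_⟩
      · rw [S₁.cut_succ, Ne, S₁.eR_inj]
      · rw [S₂.cut_succ, Ne, S₂.eR_inj]
      · simp only [cutMatch, Nat.lt_succ_self, if_true]
        refine key.matches_id fun c => cardRel_refl ?_
        intro hc
        obtain ⟨h1, h2, h3, -⟩ := hR.auto_del_pbar
        obtain ⟨h1', h2', -⟩ := hR.auto_del_dbar
        cases c <;> cases e <;> simp_all
      · simp only [cutMatch, lt_irrefl, if_false, if_true]
        exact key.matches_single (cardRel_refl (cond_ne_cond_not hR.dp_ne e)) (by simp) (by simp)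
    · rcases (Nat.lt_succ_iff.1 hj).eq_or_lt with rfl | hj
      · obtain ⟨ψ, h1, h2⟩ := hR.exists_card_min e
        have key := PartialOrderIso.of_card ψ
        refine ⟨_, key.congr (fun q => ?_) (fun q => ?_), ?_, ?_⟩
        · rw [S₁.cut_eq_bot, Ne, S₁.eR_inj]
        · rw [S₂.cut_eq_bot, Ne, S₂.eR_inj]
        · simp only [cutMatch, lt_irrefl, if_false, if_true]
          exact key.matches_single h1 (by simp) (by simp)
        · simp only [cutMatch, show ¬ (j : ℕ) + 1 < j by omega, show ¬ (j : ℕ) + 1 = j by omega,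
            if_false]
          exact key.matches_swap h2
      · have key := PartialOrderIso.of_orderIso φ
        refine ⟨_, key.congr (fun q => ?_) (fun q => ?_), ?_, ?_⟩
        · exact iff_true_intro (S₁.eR_ne_cut hQ hR hi _ (by omega) (by omega) _ _)
        · exact iff_true_intro (S₂.eR_ne_cut hQ hR hi _ (by omega) (by omega) _ _)
        · simp only [cutMatch, show ¬ (j : ℕ) < i by omega, show ¬ (j : ℕ) = i by omega, if_false]
          exact key.matches_swap hφ
        · simp only [cutMatch, show ¬ (j : ℕ) + 1 < i by omega, show ¬ (j : ℕ) + 1 = i by omega,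
            if_false]
          exact key.matches_swap hφ'
  have exT : ∃ g₁, PartialOrderIso g₁ (fun q => S₁.eT q ≠ S₁.cut i e)
      (fun q => S₂.eT q ≠ S₂.cut i e) ∧
      Matches g₁ (cutMatch i e n) (fun c => cond (c ^^ false) d p)
        (fun c => cond (c ^^ true) d p) := by
    simp only [Bool.xor_false, Bool.xor_true]
    rcases hi.eq_or_lt with rfl | hi
    · obtain ⟨ψ, hψ⟩ := hQ.exists_card_max e
      have key := PartialOrderIso.of_card ψ
      refine ⟨_, key.congr (fun q => ?_) (fun q => ?_), ?_⟩
      · rw [S₁.cut_top, Ne, S₁.eT_inj, Bool.xor_false]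
      · rw [S₂.cut_top, Ne, S₂.eT_inj, Bool.xor_true]
      · simp only [cutMatch, lt_irrefl, if_false, if_true]
        exact key.matches_single (by simpa using hψ) (by simp) (by simp)
    · refine ⟨_, PartialOrderIso.of_eq.congr (fun q => ?_) (fun q => ?_), ?_⟩
      · exact iff_true_intro (S₁.eT_ne_cut hQ hR hi _ _)
      · exact iff_true_intro (S₂.eT_ne_cut hQ hR hi _ _)
      · simp only [cutMatch, hi.not_gt, hi.ne', if_false]
        exact PartialOrderIso.of_eq.matches_swap fun c => by simp
  obtain ⟨g₀, h1, h2⟩ := exQ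
  choose g h3 h4 h5 using exR
  obtain ⟨g₁, h6, h7⟩ := exT
  exact ⟨g₀, g, g₁, h1, h3, h6, h2, h4, h5, h7⟩

theorem exists_card_iso_cut [Finite Q] [Finite R] [Finite P₁] [Finite P₂] (hQ : QHyps Q a b d p)
    (hR : RHyps R dd pp dbar pbar)
    (S₁ : StackData Q R P₁ a b d p dd pp dbar pbar n false)
    (S₂ : StackData Q R P₂ a b d p dd pp dbar pbar n true) {i : ℕ} (hi : i ≤ n) (e : Bool) :
    ∃ Φ : Card P₁ (S₁.cut i e) ≃o Card P₂ (S₂.cut i e),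
      (∀ z, Order.height (Φ z).val = Order.height z.val) ∧
      cardRel Φ (S₁.cut i !e) (S₂.cut i !e) := by
  obtain ⟨g₀, g, g₁, h⟩ := exists_layerMaps_cut hQ hR S₁ S₂ hi e
  have L₁ := S₁.layering hQ hR
  have L₂ := S₂.layering hQ hR
  obtain ⟨Φ, h1, h2⟩ := h.layerRel.exists_orderIso L₁ L₂
  refine ⟨Φ, L₁.height_card_iso L₂ hi (S₁.height_cut hQ hR hi) (S₂.height_cut hQ hR hi) Φ h1,
    h2 i _ _ ((h.layerRelation_cut hi).2 ⟨!e, ?_, rfl⟩)⟩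
  simp [cutMatch]

theorem nonempty_nbhd_cut [Finite Q] [Finite R] [Finite P₁] [Finite P₂] (hQ : QHyps Q a b d p)
    (hR : RHyps R dd pp dbar pbar)
    (S₁ : StackData Q R P₁ a b d p dd pp dbar pbar n false)
    (S₂ : StackData Q R P₂ a b d p dd pp dbar pbar n true) {i : ℕ} (hi : i ≤ n) (e : Bool) :
    Nonempty (Nbhd P₁ (S₁.cut i e) ≃o Nbhd P₂ (S₂.cut i e)) := by
  obtain ⟨Φ, -, hΦ⟩ := exists_card_iso_cut hQ hR S₁ S₂ hi !e
  have L₁ := S₁.layering hQ hR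
  have L₂ := S₂.layering hQ hR
  have h₁ := L₁.not_cut_le_cut (b := !e) hi
  have h₂ := L₂.not_cut_le_cut (b := !e) hi
  rw [Bool.not_not] at hΦ h₁ h₂
  exact nonempty_nbhd_orderIso Φ (L₁.not_cut_le_cut hi) h₁ (L₂.not_cut_le_cut hi) h₂ hΦ

theorem QHyps.not_cond_le {a b d p : Q} (hQ : QHyps Q a b d p) {e e' : Bool} (h : e ≠ e') :
    ¬ cond e a b ≤ cond e' a b := fun hc =>
  h (StackData.cond_injective hQ.ab_ne ((StackData.isMin_cond hQ.min_iff e').eq_of_le hc))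

theorem StackData.eR_ne_eQ_of_not_isMax (S : StackData Q R P₁ a b d p dd pp dbar pbar n τ)
    (hQ : QHyps Q a b d p) {q : Q} (hq : ¬ IsMax q) (i : Fin n) (r : R) :
    S.eR i r ≠ S.eQ q := fun h => by
  rcases (S.eQ_meet_eR _ _ _ h.symm).2 with h | h
  · exact hq ((hQ.max_iff q).2 (Or.inl h.1))
  · exact hq ((hQ.max_iff q).2 (Or.inr h.1))

theorem StackData.eR_ne_eT_of_not_isMax (S : StackData Q R P₁ a b d p dd pp dbar pbar n τ)
    (hQ : QHyps Q a b d p) {q : Q} (hq : ¬ IsMax q) (i : Fin n) (r : R) :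
    S.eR i r ≠ S.eT q := fun h => by
  rw [hQ.max_iff] at hq
  have := (S.eR_meet_eT _ _ _ h).2
  cases τ <;> simp_all

theorem QHyps.not_isMax_cond {a b d p : Q} (hQ : QHyps Q a b d p) (e : Bool) :
    ¬ IsMax (cond e a b) := by
  rw [hQ.max_iff]
  obtain ⟨h1, h2, -⟩ := hQ.auto_del_a
  obtain ⟨h1', h2', -⟩ := hQ.auto_del_b
  cases e
  · rintro (h | h)
    exacts [h2' h.symm, h1' h.symm]
  · rintro (h | h)
    exacts [h2 h.symm, h1 h.symm]

theorem nonempty_nbhd_eQ [Finite Q] [Finite R] (hQ : QHyps Q a b d p)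
    (hR : RHyps R dd pp dbar pbar)
    (S₁ : StackData Q R P₁ a b d p dd pp dbar pbar n false)
    (S₂ : StackData Q R P₂ a b d p dd pp dbar pbar n true) (e : Bool) :
    Nonempty (Nbhd P₁ (S₁.eQ (cond e a b)) ≃o Nbhd P₂ (S₂.eQ (cond e a b))) := by
  obtain ⟨φ, hφ, hφ'⟩ := hR.exists_swap
  obtain ⟨ψ, h1, h2⟩ := hQ.exists_card_min !e
  rw [Bool.not_not] at h1
  have hm := hQ.not_isMax_cond !e
  have keyψ := PartialOrderIso.of_card ψ
  have keyφ := PartialOrderIso.of_orderIso φ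
  have h : LayerMaps S₁ S₂ (cardRel ψ) (fun _ u v => φ u = v) (fun u v => u = v)
      (fun _ c c' => c' = !c) (S₁.eQ (cond (!e) a b)) (S₂.eQ (cond (!e) a b)) :=
    { iso_Q := keyψ.congr (fun q => by rw [Ne, S₁.eQ_inj]) (fun q => by rw [Ne, S₂.eQ_inj])
      iso_R := fun i => keyφ.congr
        (fun q => iff_true_intro (S₁.eR_ne_eQ_of_not_isMax hQ hm i q))
        (fun q => iff_true_intro (S₂.eR_ne_eQ_of_not_isMax hQ hm i q))
      iso_T := PartialOrderIso.of_eq.congr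
        (fun q => iff_true_intro (S₁.eQ_meet_eT _ _).symm)
        (fun q => iff_true_intro (S₂.eQ_meet_eT _ _).symm)
      matches_Q := keyψ.matches_swap h2
      matches_R_bot := fun _ => keyφ.matches_swap hφ
      matches_R_top := fun _ => keyφ.matches_swap hφ'
      matches_T := PartialOrderIso.of_eq.matches_swap fun c => by simp }
  obtain ⟨Φ, -, hΦ⟩ := h.layerRel.exists_orderIso (S₁.layering hQ hR) (S₂.layering hQ hR)
  refine nonempty_nbhd_orderIso Φ ?_ ?_ ?_ ?_
    (hΦ 0 _ _ (LayerMaps.layerRelation_eQ.2 ⟨_, h1, rfl⟩))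
  all_goals
    simp only [StackData.eQ_iff]
    exact hQ.not_cond_le (by simp)

theorem nonempty_nbhd_eT [Finite Q] [Finite R] (hQ : QHyps Q a b d p)
    (hR : RHyps R dd pp dbar pbar)
    (S₁ : StackData Q R P₁ a b d p dd pp dbar pbar n false)
    (S₂ : StackData Q R P₂ a b d p dd pp dbar pbar n true) (e : Bool) :
    Nonempty (Nbhd P₁ (S₁.eT (cond e a b)) ≃o Nbhd P₂ (S₂.eT (cond e a b))) := by
  obtain ⟨ψ, h1, h2⟩ := hQ.exists_card_min !e
  rw [Bool.not_not] at h1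
  have hm := hQ.not_isMax_cond !e
  have keyψ := PartialOrderIso.of_card ψ
  have h : LayerMaps S₁ S₂ (fun u v => u = v) (fun _ u v => u = v) (cardRel ψ)
      (fun _ c c' => c' = c) (S₁.eT (cond (!e) a b)) (S₂.eT (cond (!e) a b)) :=
    { iso_Q := PartialOrderIso.of_eq.congr
        (fun q => iff_true_intro (S₁.eQ_meet_eT _ _))
        (fun q => iff_true_intro (S₂.eQ_meet_eT _ _))
      iso_R := fun i => PartialOrderIso.of_eq.congr
        (fun q => iff_true_intro (S₁.eR_ne_eT_of_not_isMax hQ hm i q))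
        (fun q => iff_true_intro (S₂.eR_ne_eT_of_not_isMax hQ hm i q))
      iso_T := keyψ.congr (fun q => by rw [Ne, S₁.eT_inj]) (fun q => by rw [Ne, S₂.eT_inj])
      matches_Q := PartialOrderIso.of_eq.matches_id fun _ => rfl
      matches_R_bot := fun _ => PartialOrderIso.of_eq.matches_id fun _ => rfl
      matches_R_top := fun _ => PartialOrderIso.of_eq.matches_id fun _ => rfl
      matches_T := keyψ.matches_id fun c => by simpa using h2 c }
  obtain ⟨Φ, -, hΦ⟩ := h.layerRel.exists_orderIso (S₁.layering hQ hR) (S₂.layering hQ hR)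
  refine nonempty_nbhd_orderIso Φ ?_ ?_ ?_ ?_
    (hΦ (n + 1) _ _ (LayerMaps.layerRelation_eT.2 ⟨_, h1, rfl⟩))
  all_goals
    simp only [StackData.eT_iff]
    exact hQ.not_cond_le (by simp)

end Main

/--
With `Q`, `R`, `n`, and the stacked ordered sets `P1` and `P2` as in the construction:
for each `i = 0, …, n` the card `P1∖{d_i}` is order-isomorphic to the card `P2∖{d_i}`
and the card `P1∖{p_i}` is order-isomorphic to the card `P2∖{p_i}`, via isomorphisms
`Φ` with `rank_{P2}(Φ x) = rank_{P1}(x)` for all `x`; moreover, for every element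
`x ∈ {a, b, ã, b̃, d_0, p_0, …, d_n, p_n}` the neighborhood `↕_{P1} x` is
order-isomorphic to the neighborhood `↕_{P2} x`.  (Here `d_0 = eQ d`, `p_0 = eQ p`,
`d_{i+1} = eR i dd`, `p_{i+1} = eR i pp`, `ã = eT a` and `b̃ = eT b`.)
-/
theorem stacked_sets_equal_middle_cards_and_neighborhoods
    {Q R P1 P2 : Type*} [PartialOrder Q] [Fintype Q] [PartialOrder R] [Fintype R]
    [PartialOrder P1] [Fintype P1] [PartialOrder P2] [Fintype P2]
    {a b d p : Q} {dd pp dbar pbar : R} {n : ℕ}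
    (hQ : QHyps Q a b d p) (hR : RHyps R dd pp dbar pbar)
    (S1 : StackData Q R P1 a b d p dd pp dbar pbar n false)
    (S2 : StackData Q R P2 a b d p dd pp dbar pbar n true) :
    -- the cards at d_0 and p_0 are isomorphic, rank preservingly
    (∃ Φ : Card P1 (S1.eQ d) ≃o Card P2 (S2.eQ d),
        ∀ z, Order.height (Φ z).val = Order.height z.val) ∧
    (∃ Φ : Card P1 (S1.eQ p) ≃o Card P2 (S2.eQ p),
        ∀ z, Order.height (Φ z).val = Order.height z.val) ∧
    -- the cards at d_{i+1} = d_i-th top and p_{i+1} (i = 0, …, n-1) are isomorphic,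
    -- rank preservingly
    (∀ i : Fin n,
      (∃ Φ : Card P1 (S1.eR i dd) ≃o Card P2 (S2.eR i dd),
          ∀ z, Order.height (Φ z).val = Order.height z.val) ∧
      (∃ Φ : Card P1 (S1.eR i pp) ≃o Card P2 (S2.eR i pp),
          ∀ z, Order.height (Φ z).val = Order.height z.val)) ∧
    -- the neighborhoods of a, b, ã, b̃ agree
    Nonempty (Nbhd P1 (S1.eQ a) ≃o Nbhd P2 (S2.eQ a)) ∧
    Nonempty (Nbhd P1 (S1.eQ b) ≃o Nbhd P2 (S2.eQ b)) ∧
    Nonempty (Nbhd P1 (S1.eT a) ≃o Nbhd P2 (S2.eT a)) ∧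
    Nonempty (Nbhd P1 (S1.eT b) ≃o Nbhd P2 (S2.eT b)) ∧
    -- the neighborhoods of d_0, p_0, …, d_n, p_n agree
    Nonempty (Nbhd P1 (S1.eQ d) ≃o Nbhd P2 (S2.eQ d)) ∧
    Nonempty (Nbhd P1 (S1.eQ p) ≃o Nbhd P2 (S2.eQ p)) ∧
    (∀ i : Fin n,
      Nonempty (Nbhd P1 (S1.eR i dd) ≃o Nbhd P2 (S2.eR i dd)) ∧
      Nonempty (Nbhd P1 (S1.eR i pp) ≃o Nbhd P2 (S2.eR i pp))) := by
  have hcard := fun (i : ℕ) (hi : i ≤ n) (e : Bool) =>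
    (exists_card_iso_cut hQ hR S1 S2 hi e).imp fun _ h => h.1
  have hnbhd := fun (i : ℕ) (hi : i ≤ n) (e : Bool) => nonempty_nbhd_cut hQ hR S1 S2 hi e
  refine ⟨hcard 0 (Nat.zero_le n) true, hcard 0 (Nat.zero_le n) false, fun i => ?_,
    nonempty_nbhd_eQ hQ hR S1 S2 true, nonempty_nbhd_eQ hQ hR S1 S2 false,
    nonempty_nbhd_eT hQ hR S1 S2 true, nonempty_nbhd_eT hQ hR S1 S2 false,
    hnbhd 0 (Nat.zero_le n) true, hnbhd 0 (Nat.zero_le n) false, fun i => ?_⟩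
  · have h1 := hcard (i + 1) i.2 true
    have h2 := hcard (i + 1) i.2 false
    rw [S1.cut_succ, S2.cut_succ] at h1 h2
    exact ⟨h1, h2⟩
  · have h1 := hnbhd (i + 1) i.2 true
    have h2 := hnbhd (i + 1) i.2 false
    rw [S1.cut_succ, S2.cut_succ] at h1 h2
    exact ⟨h1, h2⟩
end
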